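/- arXiv:2005.01635 — 2 statements merged into one kernel-verified Lean document; each statement's English description precedes it below -/
import Mathlib

section
/- Let Γ be a finite connected simple cubic vertex-transitive graph of girth 6 with signature (a, b, c) where c = 4. Then a = b = 4 and Γ is isomorphic either to the Pappus graph Σ_3 = Cay(D_3 × Z_3, {(τ_1, 0), (τ_0, 1), (τ_0, 2)}) or to the Desargues graph GP(10, 3). -/
/-- The Cayley graph of a group on a (symmetric) connection set `S`:
distinct `g, h` are adjacent iff `g * h⁻¹ ∈ S`. -/
def cayley {G : Type*} [Group G] (S : Set G) : SimpleGraph G :=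
  SimpleGraph.fromRel (fun x y => x * y⁻¹ ∈ S)

/-- In the dihedral group `D_n = ⟨ρ, τ⟩`, the element `τ_i = ρ^i * τ`. -/
def dihTau {n : ℕ} (i : ℕ) : DihedralGroup n :=
  (DihedralGroup.r 1) ^ i * DihedralGroup.sr 0

/-- The number of cycles of length 6 in `G` (identified with their edge sets)
that contain the edge `e`. -/
noncomputable def sixCycleCount {V : Type*} (G : SimpleGraph V) (e : Sym2 V) : ℕ :=
  Set.ncard {s : Set (Sym2 V) |
    (∃ (v : V) (w : G.Walk v v), w.IsCycle ∧ w.length = 6 ∧ s = {e' | e' ∈ w.edges}) ∧ e ∈ s}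

/-- A cubic graph of girth 6 is girth-regular with signature `(a, b, c)` if every vertex is
incident with exactly three edges, on which the numbers of girth cycles (6-cycles) are
`a`, `b`, `c` respectively. -/
def hasSignature {V : Type*} (G : SimpleGraph V) (a b c : ℕ) : Prop :=
  ∀ v : V, ∃ e₁ e₂ e₃ : Sym2 V, e₁ ≠ e₂ ∧ e₁ ≠ e₃ ∧ e₂ ≠ e₃ ∧
    G.incidenceSet v = {e₁, e₂, e₃} ∧
    sixCycleCount G e₁ = a ∧ sixCycleCount G e₂ = b ∧ sixCycleCount G e₃ = c

/-- The graph `Σ_n = Cay(D_n × Z_3, {(τ_1, 0), (τ_0, 1), (τ_0, 2)})`,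
where `Z_3` is the cyclic group of order 3 (written multiplicatively). -/
def sigmaGraph (n : ℕ) : SimpleGraph (DihedralGroup n × Multiplicative (ZMod 3)) :=
  cayley ({(dihTau 1, 1), (dihTau 0, Multiplicative.ofAdd 1), (dihTau 0, Multiplicative.ofAdd 2)} :
    Set (DihedralGroup n × Multiplicative (ZMod 3)))

/-- The generalized Petersen graph `GP(n, k)`: the outer vertices `a_i` are encoded
as `(i, false)`, the inner vertices `b_i` as `(i, true)`, with edges
`{a_i, a_{i+1}}`, `{a_i, b_i}`, and `{b_i, b_{i+k}}`. -/
def genPetersen (n k : ℕ) : SimpleGraph (ZMod n × Bool) :=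
  SimpleGraph.fromRel (fun p q =>
    (p.2 = false ∧ q.2 = false ∧ q.1 = p.1 + 1) ∨
    (p.2 = false ∧ q.2 = true ∧ q.1 = p.1) ∨
    (p.2 = true ∧ q.2 = true ∧ q.1 = p.1 + (k : ZMod n)))

namespace HexCount

open SimpleGraph

variable {V : Type*} {G : SimpleGraph V}

section

/-- The graph has no cycle of length less than six. -/
structure NoShortCycle (G : SimpleGraph V) : Prop where
  tri : ∀ {a b c : V}, G.Adj a b → G.Adj b c → G.Adj c a → False
  quad : ∀ {a b c d : V}, G.Adj a b → G.Adj b c → G.Adj c d → G.Adj d a → a ≠ c → b = d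
  pent : ∀ {a b c d e : V}, G.Adj a b → G.Adj b c → G.Adj c d → G.Adj d e → G.Adj e a → False

theorem NoShortCycle.of_girth (h : G.girth = 6) : NoShortCycle G := by
  have tri : ∀ {a b c : V}, G.Adj a b → G.Adj b c → G.Adj c a → False := by
    intro a b c h1 h2 h3
    have := G.girth_le_length (w := .cons h1 (.cons h2 (.cons h3 .nil))) (by
      have := h1.ne; have := h2.ne; have := h3.ne
      simp [Walk.cons_isCycle_iff, Walk.cons_isPath_iff]
      grind)
    simp [h] at this
  have quad : ∀ {a b c d : V}, G.Adj a b → G.Adj b c → G.Adj c d → G.Adj d a → a ≠ c → b = d := by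
    intro a b c d h1 h2 h3 h4 hac
    by_contra hbd
    have := G.girth_le_length (w := .cons h1 (.cons h2 (.cons h3 (.cons h4 .nil)))) (by
      have := h1.ne; have := h2.ne; have := h3.ne; have := h4.ne
      simp [Walk.cons_isCycle_iff, Walk.cons_isPath_iff]
      grind)
    simp [h] at this
  refine ⟨tri, quad, ?_⟩
  intro a b c d e h1 h2 h3 h4 h5
  have hac : a ≠ c := by rintro rfl; exact tri h3 h4 h5
  have had : a ≠ d := by rintro rfl; exact tri h1 h2 h3
  have hbd : b ≠ d := by rintro rfl; exact tri h1 h4 h5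
  have hbe : b ≠ e := by rintro rfl; exact tri h2 h3 h4
  have hce : c ≠ e := by rintro rfl; exact tri h1 h2 h5
  have := G.girth_le_length (w := .cons h1 (.cons h2 (.cons h3 (.cons h4 (.cons h5 .nil))))) (by
    have := h1.ne; have := h2.ne; have := h3.ne; have := h4.ne; have := h5.ne
    simp [Walk.cons_isCycle_iff, Walk.cons_isPath_iff]
    grind)
  simp [h] at this

/-- The neighbours of `v` are exactly the three distinct vertices `a`, `b`, `c`. -/
def IsNbrs (G : SimpleGraph V) (v a b c : V) : Prop :=
  a ≠ b ∧ a ≠ c ∧ b ≠ c ∧ ∀ x, G.Adj v x ↔ x = a ∨ x = b ∨ x = c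

theorem sum_nbrs {q r p p' : V} (h : IsNbrs G q r p p') {α : Type*} [Fintype α] (f : α → V)
    (P : α → Prop) [DecidablePred P] (hf : ∀ a, P a → G.Adj q (f a) ∧ f a ≠ r) [DecidableEq V] :
    (Finset.univ.filter P).card =
      (Finset.univ.filter fun a => P a ∧ f a = p).card +
        (Finset.univ.filter fun a => P a ∧ f a = p').card := by
  classical
  rw [← Finset.card_union_of_disjoint]
  · congr 1
    ext a
    have := hf a
    have := (h.2.2.2 (f a))
    simp only [Finset.mem_filter, Finset.mem_univ, true_and, Finset.mem_union]
    tauto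
  · rw [Finset.disjoint_left]
    intro a ha hb
    simp only [Finset.mem_filter, Finset.mem_univ, true_and] at ha hb
    exact h.2.2.1 (ha.2.symm.trans hb.2)

section count

variable [Fintype V]

open Classical in
/-- The number of 6-cycles through the path `p q r s`. -/
noncomputable def count₃ (G : SimpleGraph V) (p q r s : V) : ℕ :=
  (Finset.univ.filter fun z : V × V =>
    G.Adj p z.1 ∧ z.1 ≠ q ∧ G.Adj z.1 z.2 ∧ G.Adj z.2 s ∧ z.2 ≠ r).card

open Classical in
/-- The number of 6-cycles through the path `p q r`. -/
noncomputable def count₂ (G : SimpleGraph V) (p q r : V) : ℕ :=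
  (Finset.univ.filter fun z : V × V × V =>
    G.Adj p z.1 ∧ z.1 ≠ q ∧ G.Adj z.1 z.2.1 ∧ G.Adj z.2.1 z.2.2 ∧ z.2.1 ≠ r ∧
      G.Adj z.2.2 r ∧ z.2.2 ≠ q).card

open Classical in
/-- The quadruples completing the edge `q r` to a 6-cycle. -/
noncomputable def completions (G : SimpleGraph V) (q r : V) : Finset (V × V × V × V) :=
  Finset.univ.filter fun z : V × V × V × V =>
    G.Adj q z.1 ∧ z.1 ≠ r ∧ G.Adj z.1 z.2.1 ∧ z.2.1 ≠ q ∧ G.Adj z.2.1 z.2.2.1 ∧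
      G.Adj z.2.2.1 z.2.2.2 ∧ z.2.2.1 ≠ r ∧ G.Adj z.2.2.2 r ∧ z.2.2.2 ≠ q

/-- The number of 6-cycles through the edge `q r`. -/
noncomputable def count₁ (G : SimpleGraph V) (q r : V) : ℕ := (completions G q r).card

theorem count₃_comm (p q r s : V) : count₃ G p q r s = count₃ G s r q p := by
  classical
  refine Finset.card_equiv (Equiv.prodComm V V) ?_
  rintro ⟨x, y⟩
  simp only [Finset.mem_filter, Finset.mem_univ, true_and, Equiv.prodComm_apply, Prod.swap_prod_mk,
    G.adj_comm p, G.adj_comm s, G.adj_comm x y]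
  tauto

theorem count₁_comm (q r : V) : count₁ G q r = count₁ G r q := by
  classical
  let e : V × V × V × V ≃ V × V × V × V :=
    ⟨fun z => (z.2.2.2, z.2.2.1, z.2.1, z.1), fun z => (z.2.2.2, z.2.2.1, z.2.1, z.1),
      fun _ => rfl, fun _ => rfl⟩
  refine Finset.card_equiv e ?_
  rintro ⟨p, x, y, s⟩
  simp only [completions, Finset.mem_filter, Finset.mem_univ, true_and, e, Equiv.coe_fn_mk,
    G.adj_comm q, G.adj_comm r, G.adj_comm x y, G.adj_comm p x, G.adj_comm s y]
  tauto

theorem count₂_comm (hG : NoShortCycle G) {p q r : V} (hpq : G.Adj p q) (hqr : G.Adj q r)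
    (hpr : p ≠ r) : count₂ G p q r = count₂ G r q p := by
  classical
  let e : V × V × V ≃ V × V × V :=
    ⟨fun z => (z.2.2, z.2.1, z.1), fun z => (z.2.2, z.2.1, z.1), fun _ => rfl, fun _ => rfl⟩
  refine Finset.card_equiv e ?_
  rintro ⟨x, y, s⟩
  simp only [Finset.mem_filter, Finset.mem_univ, true_and, e, Equiv.coe_fn_mk]
  constructor
  · rintro ⟨h1, h2, h3, h4, h5, h6, h7⟩
    refine ⟨h6.symm, h7, h4.symm, h3.symm, ?_, h1.symm, h2⟩
    rintro rfl
    exact h7 (hG.quad hpq hqr h6.symm h4.symm hpr).symm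
  · rintro ⟨h1, h2, h3, h4, h5, h6, h7⟩
    refine ⟨h6.symm, h7, h4.symm, h3.symm, ?_, h1.symm, h2⟩
    rintro rfl
    exact h7 (hG.quad hpq hqr h4 h6 hpr).symm

theorem count₂_eq {p q r s s' : V} (h : IsNbrs G r q s s') :
    count₂ G p q r = count₃ G p q r s + count₃ G p q r s' := by
  classical
  have key : ∀ t, G.Adj r t → t ≠ q → (Finset.univ.filter fun z : V × V × V =>
      (G.Adj p z.1 ∧ z.1 ≠ q ∧ G.Adj z.1 z.2.1 ∧ G.Adj z.2.1 z.2.2 ∧ z.2.1 ≠ r ∧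
        G.Adj z.2.2 r ∧ z.2.2 ≠ q) ∧ z.2.2 = t).card = count₃ G p q r t := by
    intro t ht htq
    refine (Finset.card_bij (fun (z : V × V) _ => (z.1, z.2, t)) ?_ ?_ ?_).symm
    · rintro ⟨x, y⟩ hz
      simp only [Finset.mem_filter, Finset.mem_univ, true_and] at hz ⊢
      exact ⟨⟨hz.1, hz.2.1, hz.2.2.1, hz.2.2.2.1, hz.2.2.2.2, ht.symm, htq⟩, trivial⟩
    · rintro ⟨x, y⟩ _ ⟨x', y'⟩ _ he
      simp_all
    · rintro ⟨x, y, u⟩ hz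
      simp only [Finset.mem_filter, Finset.mem_univ, true_and] at hz
      obtain ⟨hz, rfl⟩ := hz
      exact ⟨(x, y), by simp [hz], rfl⟩
  rw [count₂, sum_nbrs h (fun z => z.2.2) _ (fun a ha => ⟨ha.2.2.2.2.2.1.symm, ha.2.2.2.2.2.2⟩),
    key s, key s']
  · exact (h.2.2.2 _).2 (by simp)
  · exact h.2.1.symm
  · exact (h.2.2.2 _).2 (by simp)
  · exact h.1.symm

theorem count₁_eq {q r p p' : V} (h : IsNbrs G q r p p') :
    count₁ G q r = count₂ G p q r + count₂ G p' q r := by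
  classical
  have key : ∀ t, G.Adj q t → t ≠ r → (Finset.univ.filter fun z : V × V × V × V =>
      (G.Adj q z.1 ∧ z.1 ≠ r ∧ G.Adj z.1 z.2.1 ∧ z.2.1 ≠ q ∧ G.Adj z.2.1 z.2.2.1 ∧
      G.Adj z.2.2.1 z.2.2.2 ∧ z.2.2.1 ≠ r ∧ G.Adj z.2.2.2 r ∧ z.2.2.2 ≠ q) ∧ z.1 = t).card =
        count₂ G t q r := by
    intro t ht htq
    refine (Finset.card_bij (fun z _ => (t, z.1, z.2.1, z.2.2)) ?_ ?_ ?_).symm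
    · rintro ⟨x, y, s⟩ hz
      simp only [Finset.mem_filter, Finset.mem_univ, true_and] at hz ⊢
      exact ⟨⟨ht, htq, hz⟩, trivial⟩
    · rintro ⟨x, y, s⟩ _ ⟨x', y', s'⟩ _ he
      simp_all
    · rintro ⟨u, x, y, s⟩ hz
      simp only [Finset.mem_filter, Finset.mem_univ, true_and] at hz
      obtain ⟨hz, rfl⟩ := hz
      exact ⟨(x, y, s), by simp [hz], rfl⟩
  rw [count₁, completions, sum_nbrs h (fun z => z.1) _ (fun a ha => ⟨ha.1, ha.2.1⟩),
    key p, key p']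
  · exact (h.2.2.2 _).2 (by simp)
  · exact h.2.1.symm
  · exact (h.2.2.2 _).2 (by simp)
  · exact h.1.symm

theorem one_le_count₃ {p q r s x y : V} (h1 : G.Adj p x) (h2 : x ≠ q) (h3 : G.Adj x y)
    (h4 : G.Adj y s) (h5 : y ≠ r) : 1 ≤ count₃ G p q r s := by
  classical
  exact Finset.card_pos.2 ⟨(x, y), by simp [*]⟩

theorem two_le_count₃ {p q r s x y x' y' : V} (h1 : G.Adj p x) (h2 : x ≠ q) (h3 : G.Adj x y)
    (h4 : G.Adj y s) (h5 : y ≠ r) (h1' : G.Adj p x') (h2' : x' ≠ q) (h3' : G.Adj x' y')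
    (h4' : G.Adj y' s) (h5' : y' ≠ r) (h : x ≠ x' ∨ y ≠ y') : 2 ≤ count₃ G p q r s := by
  classical
  refine Finset.one_lt_card.2 ⟨(x, y), by simp [*], (x', y'), by simp [*], ?_⟩
  rintro he
  simp_all

theorem exists_of_one_le_count₃ {p q r s : V} (h : 1 ≤ count₃ G p q r s) :
    ∃ x y, G.Adj p x ∧ x ≠ q ∧ G.Adj x y ∧ G.Adj y s ∧ y ≠ r := by
  classical
  obtain ⟨⟨x, y⟩, hz⟩ := Finset.card_pos.1 h
  exact ⟨x, y, by simpa using hz⟩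

theorem count₃_le_two (hG : NoShortCycle G) {p q r s x x' : V} (hp : IsNbrs G p q x x')
    (hqr : G.Adj q r) (hrs : G.Adj r s) (hpr : p ≠ r) (hqs : q ≠ s) :
    count₃ G p q r s ≤ 2 := by
  classical
  have hpq : G.Adj p q := (hp.2.2.2 _).2 (by simp)
  have hinj : Set.InjOn (Prod.fst : V × V → V) (Finset.univ.filter fun z : V × V =>
    G.Adj p z.1 ∧ z.1 ≠ q ∧ G.Adj z.1 z.2 ∧ G.Adj z.2 s ∧ z.2 ≠ r) := by
    rintro ⟨u, y⟩ hz ⟨u', y'⟩ hz' (rfl : u = u')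
    simp only [Finset.coe_filter, Finset.mem_univ, true_and, Set.mem_ofPred_eq] at hz hz'
    have : u ≠ s := by
      rintro rfl
      exact hqs (hG.quad hpq hqr hrs hz.1.symm hpr)
    rw [hG.quad hz.2.2.1 hz.2.2.2.1 hz'.2.2.2.1.symm hz'.2.2.1.symm this]
  rw [count₃, ← Finset.card_image_of_injOn hinj]
  refine (Finset.card_le_card (t := {x, x'}) ?_).trans Finset.card_le_two
  intro u hu
  simp only [Finset.mem_image, Finset.mem_filter, Finset.mem_univ, true_and] at hu
  obtain ⟨⟨u', y⟩, hz, rfl⟩ := hu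
  have := (hp.2.2.2 u').1 hz.1
  simp only [Finset.mem_insert, Finset.mem_singleton]
  tauto

theorem matching_of_count₃_eq_two (hG : NoShortCycle G) {p q r s x x' y y' : V}
    (hp : IsNbrs G p q x x') (hs : IsNbrs G s r y y')
    (hqr : G.Adj q r) (hpr : p ≠ r) (hqs : q ≠ s) (h : 2 ≤ count₃ G p q r s) :
    (G.Adj x y ∧ G.Adj x' y') ∨ (G.Adj x y' ∧ G.Adj x' y) := by
  classical
  have hpq : G.Adj p q := (hp.2.2.2 _).2 (by simp)
  have hsr : G.Adj s r := (hs.2.2.2 _).2 (by simp)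
  have hps : ∀ {u}, G.Adj p u → u ≠ q → u ≠ s := by
    rintro u hu huq rfl
    exact hqs (hG.quad hpq hqr hsr.symm hu.symm hpr)
  have hsp : ∀ {u}, G.Adj s u → u ≠ r → u ≠ p := by
    rintro u hu huq rfl
    exact hqs (hG.quad hpq hqr hsr.symm hu hpr)
  obtain ⟨⟨u, w⟩, h1, ⟨u', w'⟩, h2, hne⟩ := Finset.one_lt_card.1 h
  simp only [Finset.mem_filter, Finset.mem_univ, true_and, ne_eq, Prod.mk.injEq] at h1 h2 hne
  have hu : u ≠ u' := by
    rintro rfl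
    exact hne ⟨rfl, hG.quad h1.2.2.1 h1.2.2.2.1 h2.2.2.2.1.symm h2.2.2.1.symm (hps h1.1 h1.2.1)⟩
  have hw : w ≠ w' := by
    rintro rfl
    exact hu (hG.quad h1.2.2.1.symm h1.1.symm h2.1 h2.2.2.1
      (hsp h1.2.2.2.1.symm h1.2.2.2.2)).symm.symm
  have e1 := (hp.2.2.2 u).1 h1.1
  have e2 := (hp.2.2.2 u').1 h2.1
  have e3 := (hs.2.2.2 w).1 h1.2.2.2.1.symm
  have e4 := (hs.2.2.2 w').1 h2.2.2.2.1.symm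
  grind

theorem count₃_map (φ : G ≃g G) (p q r s : V) :
    count₃ G (φ p) (φ q) (φ r) (φ s) = count₃ G p q r s := by
  classical
  refine (Finset.card_equiv (φ.toEquiv.prodCongr φ.toEquiv) ?_).symm
  rintro ⟨x, y⟩
  simp [φ.map_adj_iff]

theorem count₁_map (φ : G ≃g G) (q r : V) : count₁ G (φ q) (φ r) = count₁ G q r := by
  classical
  let e := φ.toEquiv
  refine (Finset.card_equiv (e.prodCongr (e.prodCongr (e.prodCongr e))) ?_).symm
  rintro ⟨p, x, y, s⟩
  simp [completions, e, φ.map_adj_iff]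

end count

end

section

/-- The edge set of a closed walk with the six given vertices. -/
def hexEdges (a b c d e f : V) : Set (Sym2 V) :=
  {s(a, b), s(b, c), s(c, d), s(d, e), s(e, f), s(f, a)}

theorem exists_hexEdges {v : V} (w : G.Walk v v) (hw : w.IsCycle) (hl : w.length = 6) :
    ∃ a b c d e f : V, G.Adj a b ∧ G.Adj b c ∧ G.Adj c d ∧ G.Adj d e ∧ G.Adj e f ∧ G.Adj f a ∧
      [a, b, c, d, e, f].Nodup ∧ {e' | e' ∈ w.edges} = hexEdges a b c d e f := by
  match w, hl with
  | .cons (v := b) h1 (.cons (v := c) h2 (.cons (v := d) h3 (.cons (v := e) h4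
      (.cons (v := f) h5 (.cons h6 .nil))))), _ =>
    refine ⟨v, b, c, d, e, f, h1, h2, h3, h4, h5, h6, ?_, ?_⟩
    · have := hw.support_nodup
      simp only [Walk.support_cons, Walk.support_nil, List.tail_cons] at this
      simp only [List.nodup_cons, List.mem_cons, List.not_mem_nil] at this ⊢
      grind
    · ext x
      simp [hexEdges]

theorem exists_walk_of_hexagon {a b c d e f : V} (h1 : G.Adj a b) (h2 : G.Adj b c)
    (h3 : G.Adj c d) (h4 : G.Adj d e) (h5 : G.Adj e f) (h6 : G.Adj f a)
    (h : [a, b, c, d, e, f].Nodup) :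
    ∃ (v : V) (w : G.Walk v v), w.IsCycle ∧ w.length = 6 ∧
      hexEdges a b c d e f = {e' | e' ∈ w.edges} := by
  refine ⟨a, .cons h1 (.cons h2 (.cons h3 (.cons h4 (.cons h5 (.cons h6 .nil))))), ?_, rfl, ?_⟩
  · simp only [List.nodup_cons, List.mem_cons, List.not_mem_nil] at h
    simp [Walk.cons_isCycle_iff, Walk.cons_isPath_iff]
    grind
  · ext x
    simp [hexEdges]

theorem exists_hexEdges_of_mem {a b c d e f q r : V} (h1 : G.Adj a b) (h2 : G.Adj b c)
    (h3 : G.Adj c d) (h4 : G.Adj d e) (h5 : G.Adj e f) (h6 : G.Adj f a)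
    (h : [a, b, c, d, e, f].Nodup) (hm : s(q, r) ∈ hexEdges a b c d e f) :
    ∃ p x y s, G.Adj q p ∧ p ≠ r ∧ G.Adj p x ∧ x ≠ q ∧ G.Adj x y ∧ G.Adj y s ∧ y ≠ r ∧
      G.Adj s r ∧ s ≠ q ∧ hexEdges a b c d e f = hexEdges q r s y x p := by
  have hrot : ∀ {a b c d e f : V}, hexEdges a b c d e f = hexEdges b c d e f a := by
    intro a b c d e f
    ext z
    simp only [hexEdges, Set.mem_insert_iff, Set.mem_singleton_iff]
    tauto
  have hrev : ∀ {a b c d e f : V}, hexEdges a b c d e f = hexEdges b a f e d c := by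
    intro a b c d e f
    ext z
    simp only [hexEdges, Set.mem_insert_iff, Set.mem_singleton_iff, Sym2.eq_swap (a := b) (b := a),
      Sym2.eq_swap (a := a) (b := f), Sym2.eq_swap (a := f) (b := e),
      Sym2.eq_swap (a := e) (b := d), Sym2.eq_swap (a := d) (b := c),
      Sym2.eq_swap (a := c) (b := b)]
    tauto
  have base : ∀ {a b c d e f : V}, G.Adj a b → G.Adj b c → G.Adj c d → G.Adj d e → G.Adj e f →
      G.Adj f a → [a, b, c, d, e, f].Nodup → s(q, r) = s(a, b) →
      ∃ p x y s, G.Adj q p ∧ p ≠ r ∧ G.Adj p x ∧ x ≠ q ∧ G.Adj x y ∧ G.Adj y s ∧ y ≠ r ∧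
        G.Adj s r ∧ s ≠ q ∧ hexEdges a b c d e f = hexEdges q r s y x p := by
    intro a b c d e f h1 h2 h3 h4 h5 h6 h hm
    simp only [List.nodup_cons, List.mem_cons, List.not_mem_nil] at h
    rcases Sym2.eq_iff.1 hm with ⟨rfl, rfl⟩ | ⟨rfl, rfl⟩
    · exact ⟨f, e, d, c, h6.symm, by grind, h5.symm, by grind, h4.symm, h3.symm, by grind,
        h2.symm, by grind, rfl⟩
    · exact ⟨c, d, e, f, h2, by grind, h3, by grind, h4, h5, by grind, h6, by grind, hrev⟩
  have nrot : ∀ {a b c d e f : V}, [a, b, c, d, e, f].Nodup → [b, c, d, e, f, a].Nodup := by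
    intro a b c d e f h
    simp only [List.nodup_cons, List.mem_cons, List.not_mem_nil] at h ⊢
    grind
  have hm' := hm
  simp only [hexEdges, Set.mem_insert_iff, Set.mem_singleton_iff] at hm'
  rcases hm' with hm | hm | hm | hm | hm | hm
  · exact base h1 h2 h3 h4 h5 h6 h hm
  · rw [hrot]
    exact base h2 h3 h4 h5 h6 h1 (nrot h) hm
  · rw [hrot, hrot]
    exact base h3 h4 h5 h6 h1 h2 (nrot (nrot h)) hm
  · rw [hrot, hrot, hrot]
    exact base h4 h5 h6 h1 h2 h3 (nrot (nrot (nrot h))) hm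
  · rw [hrot, hrot, hrot, hrot]
    exact base h5 h6 h1 h2 h3 h4 (nrot (nrot (nrot (nrot h)))) hm
  · rw [hrot, hrot, hrot, hrot, hrot]
    exact base h6 h1 h2 h3 h4 h5 (nrot (nrot (nrot (nrot (nrot h))))) hm

theorem nodup_of_completion (hG : NoShortCycle G) {q r p x y s : V} (h0 : G.Adj q r)
    (h1 : G.Adj q p) (h2 : p ≠ r) (h3 : G.Adj p x) (h4 : x ≠ q) (h5 : G.Adj x y)
    (h6 : G.Adj y s) (h7 : y ≠ r) (h8 : G.Adj s r) (h9 : s ≠ q) : [q, r, s, y, x, p].Nodup := by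
  have a1 : q ≠ y := by rintro rfl; exact hG.tri h6 h8 h0.symm
  have a2 : r ≠ x := by rintro rfl; exact hG.tri h0 h3.symm h1.symm
  have a3 : s ≠ p := by rintro rfl; exact hG.tri h1 h8 h0.symm
  have a4 : s ≠ x := by rintro rfl; exact h9 (hG.quad h3.symm.symm h8 h0.symm h1 h2)
  have a5 : y ≠ p := by rintro rfl; exact h9 (hG.quad h1.symm h0 h8.symm h6.symm h2).symm
  have := h0.ne; have := h1.ne; have := h3.ne; have := h5.ne; have := h6.ne; have := h8.ne
  simp only [List.nodup_cons, List.mem_cons, List.not_mem_nil]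
  grind

theorem hexEdges_inj {q r s y x p s' y' x' p' : V} (h : [q, r, s, y, x, p].Nodup)
    (h' : [q, r, s', y', x', p'].Nodup)
    (he : hexEdges q r s y x p = hexEdges q r s' y' x' p') :
    p = p' ∧ x = x' ∧ y = y' ∧ s = s' := by
  simp only [List.nodup_cons, List.mem_cons, List.not_mem_nil] at h h'
  have key : ∀ z, z ∈ hexEdges q r s y x p ↔ z ∈ hexEdges q r s' y' x' p' := by simp [he]
  simp only [hexEdges, Set.mem_insert_iff, Set.mem_singleton_iff] at key
  have hs : s = s' := by
    have := (key s(r, s)).1 (by simp)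
    simp only [Sym2.eq_iff] at this
    grind
  have hp : p = p' := by
    have := (key s(p, q)).1 (by simp)
    simp only [Sym2.eq_iff] at this
    grind
  have hy : y = y' := by
    have := (key s(s, y)).1 (by simp)
    simp only [Sym2.eq_iff] at this
    grind
  have hx : x = x' := by
    have := (key s(x, p)).1 (by simp)
    simp only [Sym2.eq_iff] at this
    grind
  exact ⟨hp, hx, hy, hs⟩

theorem sixCycleCount_eq [Fintype V] (hG : NoShortCycle G) {q r : V} (h0 : G.Adj q r) :
    sixCycleCount G s(q, r) = count₁ G q r := by
  classical
  have hmem : ∀ z : V × V × V × V, z ∈ completions G q r ↔ G.Adj q z.1 ∧ z.1 ≠ r ∧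
      G.Adj z.1 z.2.1 ∧ z.2.1 ≠ q ∧ G.Adj z.2.1 z.2.2.1 ∧
      G.Adj z.2.2.1 z.2.2.2 ∧ z.2.2.1 ≠ r ∧ G.Adj z.2.2.2 r ∧ z.2.2.2 ≠ q := by
    simp [completions]
  have hset : {s : Set (Sym2 V) | (∃ (v : V) (w : G.Walk v v), w.IsCycle ∧ w.length = 6 ∧
      s = {e' | e' ∈ w.edges}) ∧ s(q, r) ∈ s} =
      (fun z : V × V × V × V => hexEdges q r z.2.2.2 z.2.2.1 z.2.1 z.1) ''
        (completions G q r : Set (V × V × V × V)) := by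
    ext S
    constructor
    · rintro ⟨⟨v, w, hw, hl, rfl⟩, hm⟩
      obtain ⟨a, b, c, d, e, f, h1, h2, h3, h4, h5, h6, hn, he⟩ := exists_hexEdges w hw hl
      rw [he] at hm ⊢
      obtain ⟨p, x, y, s, hh⟩ := exists_hexEdges_of_mem h1 h2 h3 h4 h5 h6 hn hm
      refine ⟨(p, x, y, s), ?_, ?_⟩
      · rw [Finset.mem_coe, hmem]
        tauto
      · exact hh.2.2.2.2.2.2.2.2.2.symm
    · rintro ⟨⟨p, x, y, s⟩, hz, rfl⟩
      rw [Finset.mem_coe, hmem] at hz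
      obtain ⟨h1, h2, h3, h4, h5, h6, h7, h8, h9⟩ := hz
      refine ⟨exists_walk_of_hexagon h0 h8.symm h6.symm h5.symm h3.symm h1.symm
        (nodup_of_completion hG h0 h1 h2 h3 h4 h5 h6 h7 h8 h9), ?_⟩
      simp [hexEdges]
  rw [sixCycleCount, hset, Set.InjOn.ncard_image, Set.ncard_coe_finset, count₁]
  rintro ⟨p, x, y, s⟩ hz ⟨p', x', y', s'⟩ hz' he
  rw [Finset.mem_coe, hmem] at hz hz'
  obtain ⟨h1, h2, h3, h4, h5, h6, h7, h8, h9⟩ := hz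
  obtain ⟨h1', h2', h3', h4', h5', h6', h7', h8', h9'⟩ := hz'
  obtain ⟨rfl, rfl, rfl, rfl⟩ :=
    hexEdges_inj (nodup_of_completion hG h0 h1 h2 h3 h4 h5 h6 h7 h8 h9)
      (nodup_of_completion hG h0 h1' h2' h3' h4' h5' h6' h7' h8' h9') he
  rfl

theorem exists_labelled_nbrs [Fintype V] (hG : NoShortCycle G) {a b c : ℕ}
    (h : hasSignature G a b c) (v : V) :
    ∃ n₁ n₂ n₃, IsNbrs G v n₁ n₂ n₃ ∧ count₁ G v n₁ = a ∧ count₁ G v n₂ = b ∧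
      count₁ G v n₃ = c := by
  obtain ⟨e₁, e₂, e₃, h12, h13, h23, hinc, h1, h2, h3⟩ := h v
  have key : ∀ e ∈ ({e₁, e₂, e₃} : Set (Sym2 V)), ∃ n, G.Adj v n ∧ e = s(v, n) := by
    intro e he
    rw [← hinc] at he
    obtain ⟨n, rfl⟩ := he.2
    exact ⟨n, he.1, rfl⟩
  obtain ⟨n₁, a1, rfl⟩ := key e₁ (by simp)
  obtain ⟨n₂, a2, rfl⟩ := key e₂ (by simp)
  obtain ⟨n₃, a3, rfl⟩ := key e₃ (by simp)
  rw [sixCycleCount_eq hG a1] at h1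
  rw [sixCycleCount_eq hG a2] at h2
  rw [sixCycleCount_eq hG a3] at h3
  refine ⟨n₁, n₂, n₃, ⟨?_, ?_, ?_, ?_⟩, h1, h2, h3⟩
  · rintro rfl; exact h12 rfl
  · rintro rfl; exact h13 rfl
  · rintro rfl; exact h23 rfl
  · intro x
    constructor
    · intro hx
      have : s(v, x) ∈ G.incidenceSet v := ⟨hx, by simp⟩
      rw [hinc] at this
      simp only [Set.mem_insert_iff, Set.mem_singleton_iff, Sym2.eq_iff] at this
      have := hx.ne
      grind
    · rintro (rfl | rfl | rfl) <;> assumption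

end

section

namespace IsNbrs
variable {v a b c : V}

theorem swap (h : IsNbrs G v a b c) : IsNbrs G v a c b :=
  ⟨h.2.1, h.1, h.2.2.1.symm, fun x => (h.2.2.2 x).trans (by tauto)⟩

theorem rotate (h : IsNbrs G v a b c) : IsNbrs G v b c a :=
  ⟨h.2.2.1, h.1.symm, h.2.1.symm, fun x => (h.2.2.2 x).trans (by tauto)⟩

theorem adj₁ (h : IsNbrs G v a b c) : G.Adj v a := (h.2.2.2 a).2 (by simp)

theorem adj₂ (h : IsNbrs G v a b c) : G.Adj v b := (h.2.2.2 b).2 (by simp)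

theorem adj₃ (h : IsNbrs G v a b c) : G.Adj v c := (h.2.2.2 c).2 (by simp)

theorem eq_or (h : IsNbrs G v a b c) {x : V} (hx : G.Adj v x) : x = a ∨ x = b ∨ x = c :=
  (h.2.2.2 x).1 hx

theorem exists_of_adj (h : IsNbrs G v a b c) {x : V} (hx : G.Adj v x) :
    ∃ y z, IsNbrs G v x y z := by
  rcases h.eq_or hx with rfl | rfl | rfl
  · exact ⟨_, _, h⟩
  · exact ⟨_, _, h.rotate⟩
  · exact ⟨_, _, h.rotate.rotate⟩

theorem exists_third (h : IsNbrs G v a b c) {x y : V} (hx : G.Adj v x) (hy : G.Adj v y)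
    (hxy : x ≠ y) : ∃ z, IsNbrs G v x y z := by
  obtain ⟨u, w, hn⟩ := h.exists_of_adj hx
  rcases hn.eq_or hy with rfl | rfl | rfl
  · exact absurd rfl hxy
  · exact ⟨_, hn⟩
  · exact ⟨_, hn.swap⟩

end IsNbrs

variable [Fintype V]

/-- Every vertex has three neighbours. -/
def Cubic (G : SimpleGraph V) : Prop := ∀ v, ∃ a b c, IsNbrs G v a b c

theorem edge_system (hG : NoShortCycle G) (hC : Cubic G) {q r p p' s s' : V}
    (hq : IsNbrs G q r p p') (hr : IsNbrs G r q s s') :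
    count₂ G p q r = count₃ G p q r s + count₃ G p q r s' ∧
    count₂ G p' q r = count₃ G p' q r s + count₃ G p' q r s' ∧
    count₂ G s r q = count₃ G p q r s + count₃ G p' q r s ∧
    count₂ G s' r q = count₃ G p q r s' + count₃ G p' q r s' ∧
    count₃ G p q r s ≤ 2 ∧ count₃ G p q r s' ≤ 2 ∧ count₃ G p' q r s ≤ 2 ∧
    count₃ G p' q r s' ≤ 2 := by
  have le : ∀ {t u}, G.Adj q t → t ≠ r → G.Adj r u → u ≠ q → count₃ G t q r u ≤ 2 := by
    intro t u ht htr hu huq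
    obtain ⟨a, b, c, ht'⟩ := hC t
    obtain ⟨x, y, hn⟩ := ht'.exists_of_adj ht.symm
    exact count₃_le_two hG hn hq.adj₁ hu htr huq.symm
  refine ⟨count₂_eq hr, count₂_eq hr, ?_, ?_, le hq.adj₂ hq.1.symm hr.adj₂ hr.1.symm,
    le hq.adj₂ hq.1.symm hr.adj₃ hr.2.1.symm, le hq.adj₃ hq.2.1.symm hr.adj₂ hr.1.symm,
    le hq.adj₃ hq.2.1.symm hr.adj₃ hr.2.1.symm⟩
  · rw [count₂_eq hq, count₃_comm p, count₃_comm p']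
  · rw [count₂_eq hq, count₃_comm p, count₃_comm p']

theorem vertex_system (hG : NoShortCycle G) {v a b c : V} (h : IsNbrs G v a b c) :
    count₁ G v a = count₂ G a v b + count₂ G a v c ∧
    count₁ G v b = count₂ G a v b + count₂ G b v c ∧
    count₁ G v c = count₂ G a v c + count₂ G b v c := by
  refine ⟨?_, ?_, ?_⟩
  · rw [count₁_eq h, count₂_comm hG h.adj₂.symm h.adj₁ h.1.symm,
      count₂_comm hG h.adj₃.symm h.adj₁ h.2.1.symm]
  · rw [count₁_eq h.rotate, add_comm, count₂_comm hG h.adj₃.symm h.adj₂ h.2.2.1.symm]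
  · rw [count₁_eq h.rotate.rotate]

/-- Every vertex is incident with one edge on `m` six-cycles and two on `d` six-cycles. -/
def IsMatched (G : SimpleGraph V) (m d : ℕ) : Prop :=
  ∀ v, ∃ q x y, IsNbrs G v q x y ∧ count₁ G v q = m ∧ count₁ G v x = d ∧ count₁ G v y = d

/-- `v w` is an edge on exactly `k` six-cycles. -/
def EdgeOn (G : SimpleGraph V) (k : ℕ) (v w : V) : Prop := G.Adj v w ∧ count₁ G v w = k

theorem EdgeOn.symm {k : ℕ} {v w : V} (h : EdgeOn G k v w) : EdgeOn G k w v :=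
  ⟨h.1.symm, (count₁_comm w v).trans h.2⟩

namespace IsMatched

variable {m d : ℕ}

theorem cubic (hM : IsMatched G m d) : Cubic G := fun v => by
  obtain ⟨q, x, y, h, -⟩ := hM v
  exact ⟨_, _, _, h⟩

theorem exists_mate (hM : IsMatched G m d) (v : V) : ∃ q, EdgeOn G m v q := by
  obtain ⟨q, x, y, h, h1, -⟩ := hM v
  exact ⟨q, h.adj₁, h1⟩

theorem mate_or (hM : IsMatched G m d) {v w : V} (h : G.Adj v w) :
    EdgeOn G m v w ∨ EdgeOn G d v w := by
  obtain ⟨q, x, y, hn, h1, h2, h3⟩ := hM v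
  rcases hn.eq_or h with rfl | rfl | rfl
  · exact .inl ⟨h, h1⟩
  · exact .inr ⟨h, h2⟩
  · exact .inr ⟨h, h3⟩

theorem unique_mate (hM : IsMatched G m d) (hmd : m ≠ d) {v w w' : V} (h : EdgeOn G m v w)
    (h' : EdgeOn G m v w') : w = w' := by
  obtain ⟨q, x, y, hn, h1, h2, h3⟩ := hM v
  have key : ∀ {u}, EdgeOn G m v u → u = q := by
    intro u hu
    rcases hn.eq_or hu.1 with rfl | rfl | rfl
    · rfl
    · exact absurd (hu.2.symm.trans h2) hmd
    · exact absurd (hu.2.symm.trans h3) hmd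
  rw [key h, key h']

theorem of_mate (hM : IsMatched G m d) (hmd : m ≠ d) {v w : V} (h : EdgeOn G m v w) :
    ∃ x y, IsNbrs G v w x y ∧ EdgeOn G d v x ∧ EdgeOn G d v y := by
  obtain ⟨q, x, y, hn, h1, h2, h3⟩ := hM v
  obtain rfl := hM.unique_mate hmd h ⟨hn.adj₁, h1⟩
  exact ⟨x, y, hn, ⟨hn.adj₂, h2⟩, ⟨hn.adj₃, h3⟩⟩

theorem of_nonmate (hM : IsMatched G m d) (hmd : m ≠ d) {v w : V} (h : EdgeOn G d v w) :
    ∃ q x, IsNbrs G v w q x ∧ EdgeOn G m v q ∧ EdgeOn G d v x := by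
  obtain ⟨q, x, y, hn, h1, h2, h3⟩ := hM v
  rcases hn.eq_or h.1 with rfl | rfl | rfl
  · exact absurd (h1.symm.trans h.2) hmd
  · exact ⟨q, y, hn.rotate.swap, ⟨hn.adj₁, h1⟩, ⟨hn.adj₃, h3⟩⟩
  · exact ⟨q, x, hn.rotate.rotate, ⟨hn.adj₁, h1⟩, ⟨hn.adj₂, h2⟩⟩

theorem isNbrs (hM : IsMatched G m d) (hmd : m ≠ d) {v w x y : V} (h : EdgeOn G m v w)
    (hx : EdgeOn G d v x)
    (hy : EdgeOn G d v y) (hxy : x ≠ y) : IsNbrs G v w x y := by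
  obtain ⟨x', y', hn, hx', hy'⟩ := hM.of_mate hmd h
  have key : ∀ {u}, EdgeOn G d v u → u ≠ w := by
    rintro u hu rfl
    exact hmd (h.2.symm.trans hu.2)
  rcases hn.eq_or hx.1 with rfl | rfl | rfl <;> rcases hn.eq_or hy.1 with rfl | rfl | rfl
  all_goals first
    | exact absurd rfl hxy
    | exact absurd rfl (key hx)
    | exact absurd rfl (key hy)
    | exact hn
    | exact hn.swap

theorem count₂_mate (hM : IsMatched G m d) (hG : NoShortCycle G) (hmd : m ≠ d)
    {v w x y : V} (h : EdgeOn G m v w)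
    (hx : EdgeOn G d v x) (hy : EdgeOn G d v y) (hxy : x ≠ y) :
    2 * count₂ G w v x = m ∧ 2 * count₂ G w v y = m ∧ 2 * count₂ G x v y + m = 2 * d := by
  have := vertex_system hG (hM.isNbrs hmd h hx hy hxy)
  have h1 := h.2; have h2 := hx.2; have h3 := hy.2
  omega

theorem nonmate_system (hM : IsMatched G m d) (hG : NoShortCycle G) (hmd : m ≠ d)
    {q r p p' s s' : V}
    (h : EdgeOn G d q r) (hp : EdgeOn G m q p) (hp' : EdgeOn G d q p') (hpr : p' ≠ r)
    (hs : EdgeOn G m r s) (hs' : EdgeOn G d r s') (hsq : s' ≠ q) :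
    2 * (count₃ G p q r s + count₃ G p q r s') = m ∧
    2 * (count₃ G p' q r s + count₃ G p' q r s') + m = 2 * d ∧
    2 * (count₃ G p q r s + count₃ G p' q r s) = m ∧
    2 * (count₃ G p q r s' + count₃ G p' q r s') + m = 2 * d ∧
    count₃ G p q r s ≤ 2 ∧ count₃ G p q r s' ≤ 2 ∧ count₃ G p' q r s ≤ 2 ∧
    count₃ G p' q r s' ≤ 2 := by
  have h1 := edge_system hG hM.cubic (hM.isNbrs hmd hp h hp' hpr.symm).rotate.swap
    (hM.isNbrs hmd hs h.symm hs' hsq.symm).rotate.swap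
  have h2 := hM.count₂_mate hG hmd hp h hp' hpr.symm
  have h3 := hM.count₂_mate hG hmd hs h.symm hs' hsq.symm
  have h4 := count₂_comm hG hp'.1.symm h.1 hpr
  have h5 := count₂_comm hG hs'.1.symm h.1.symm hsq
  omega

end IsMatched

theorem not_isMatched_zero_four [Nonempty V] (hG : NoShortCycle G) : ¬ IsMatched G 0 4 := by
  intro hM
  obtain ⟨q⟩ := ‹Nonempty V›
  obtain ⟨p, hp⟩ := hM.exists_mate q
  obtain ⟨r, p', hn, hr, hp'⟩ := hM.of_mate (by decide) hp
  obtain ⟨s, s', hn', hs, hs'⟩ := hM.of_nonmate (by decide) hr.symm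
  have := hM.nonmate_system hG (by decide) hr hp hp' hn.2.2.1.symm hs hs' hn'.2.1.symm
  omega

theorem not_signature_one_three [Nonempty V] (hG : NoShortCycle G) :
    ¬ ∀ v, ∃ n₁ n₂ n₃, IsNbrs G v n₁ n₂ n₃ ∧ count₁ G v n₁ = 1 ∧ count₁ G v n₂ = 3 ∧
      count₁ G v n₃ = 4 := by
  intro h
  have hC : Cubic G := fun v => by
    obtain ⟨a, b, c, hn, -⟩ := h v
    exact ⟨a, b, c, hn⟩
  obtain ⟨q⟩ := ‹Nonempty V›
  obtain ⟨p, r, p', hn, h1, h2, h3⟩ := h q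
  obtain ⟨s, q', s', hn', h1', h2', h3'⟩ := h r
  obtain rfl : q = q' := by
    rw [count₁_comm] at h2
    rcases hn'.eq_or hn.adj₂.symm with rfl | rfl | rfl
    · omega
    · rfl
    · omega
  have v1 := vertex_system hG hn
  have v2 := vertex_system hG hn'
  have := edge_system hG hC hn.rotate.swap hn'.rotate.swap
  have h4 := count₂_comm hG hn.adj₃.symm hn.adj₂ hn.2.2.1.symm
  have h5 := count₂_comm hG hn'.adj₃.symm hn'.adj₂ hn'.2.2.1.symm
  omega

end

section

variable [Fintype V]

theorem one_le_count₂ {p q r x y s : V} (h1 : G.Adj p x) (h2 : x ≠ q) (h3 : G.Adj x y)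
    (h4 : G.Adj y s) (h5 : y ≠ r) (h6 : G.Adj s r) (h7 : s ≠ q) : 1 ≤ count₂ G p q r := by
  classical
  exact Finset.card_pos.2 ⟨(x, y, s), by simp [*]⟩

theorem not_isMatched_four_two [Nonempty V] (hG : NoShortCycle G) : ¬ IsMatched G 4 2 := by
  intro hM
  have hmd : (4 : ℕ) ≠ 2 := by decide
  obtain ⟨p₂⟩ := ‹Nonempty V›
  obtain ⟨q₂, hq₂⟩ := hM.exists_mate p₂
  obtain ⟨p₁, p₃, hn, h1, h3⟩ := hM.of_mate hmd hq₂
  have key : ∀ {p p' : V}, p ≠ p' → EdgeOn G 2 p₂ p → EdgeOn G 2 p₂ p' →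
      ∃ q, EdgeOn G 4 p q ∧ ∀ y, EdgeOn G 2 q₂ y → ∃ x, G.Adj q x ∧ EdgeOn G 4 y x := by
    intro p p' hpp h h'
    obtain ⟨q, p₀, hn1, hq, h0⟩ := hM.of_nonmate hmd h.symm
    have e := hM.nonmate_system hG hmd h.symm hq h0 hn1.2.1.symm hq₂ h' hpp.symm
    have e' := hM.count₂_mate hG hmd hq₂ h h' hpp
    have e0 := hM.count₂_mate hG hmd hq h.symm h0 hn1.2.1
    obtain ⟨x, x', nx, dx, dx'⟩ := hM.of_mate hmd hq.symm
    have hpq : p ≠ q₂ := by rintro rfl; exact hmd (hq₂.2.symm.trans h.2)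
    have hqp : q ≠ p₂ := hn1.1.symm
    have hqq : ¬ G.Adj q q₂ := fun ha => hqp (hG.quad hq.1 ha hq₂.symm.1 h.1 hpq)
    refine ⟨q, hq, fun y hy => ?_⟩
    have key2 : ∀ x, G.Adj q x → x ≠ p → G.Adj x y → EdgeOn G 4 y x := by
      intro x hx hxp hxy
      refine (hM.mate_or hxy.symm).resolve_right fun hd => ?_
      obtain ⟨z, hz⟩ := hM.exists_mate y
      have hxq : x ≠ q₂ := by rintro rfl; exact hqq hx
      have e := hM.count₂_mate hG hmd hz hd hy.symm hxq
      have hyq : q ≠ y := by rintro rfl; exact hqq hy.symm.1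
      have hyp : p₂ ≠ y := by rintro rfl; exact hmd (hq₂.symm.2.symm.trans hy.2)
      have := one_le_count₂ (G := G) hx.symm hyq hq.symm.1 h.symm.1 hpq hq₂.1 hyp
      omega
    have hyp : y ≠ p₂ := by rintro rfl; exact hmd (hq₂.symm.2.symm.trans hy.2)
    obtain ⟨a, b, c, nq⟩ := hM.cubic q₂
    obtain ⟨y', ny⟩ := nq.exists_third hq₂.symm.1 hy.1 hyp.symm
    rcases matching_of_count₃_eq_two hG nx ny h.symm.1 hqp hpq (by omega) with ⟨g, -⟩ | ⟨-, g⟩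
    · exact ⟨x, dx.1, key2 x dx.1 nx.1.symm g⟩
    · exact ⟨x', dx'.1, key2 x' dx'.1 nx.2.1.symm g⟩
  obtain ⟨q₁, hq₁, k1⟩ := key hn.2.2.1 h1 h3
  obtain ⟨q₃, hq₃, k3⟩ := key hn.2.2.1.symm h3 h1
  obtain ⟨y, y', ny, dy, dy'⟩ := hM.of_mate hmd hq₂.symm
  obtain ⟨x, hx, hyx⟩ := k1 y dy
  obtain ⟨x', hx', hyx'⟩ := k1 y' dy'
  obtain ⟨z, hz, hyz⟩ := k3 y dy
  obtain ⟨z', hz', hyz'⟩ := k3 y' dy'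
  obtain rfl := hM.unique_mate hmd hyx hyz
  obtain rfl := hM.unique_mate hmd hyx' hyz'
  have hxx : x ≠ x' := by
    rintro rfl
    exact ny.2.2.1 (hM.unique_mate hmd hyx.symm hyx'.symm)
  have := hG.quad hx.symm hx' hz'.symm hz hxx
  subst this
  exact hn.2.2.1 (hM.unique_mate hmd hq₁.symm hq₃.symm)

end

section

variable [Fintype V]

theorem not_isMatched_two_four [Nonempty V] (hG : NoShortCycle G) : ¬ IsMatched G 2 4 := by
  intro hM
  have hmd : (2 : ℕ) ≠ 4 := by decide
  have ne : ∀ {v x y : V}, EdgeOn G 2 v x → EdgeOn G 4 v y → x ≠ y := by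
    rintro v x y h h' rfl
    exact hmd (h.2.symm.trans h'.2)
  have cross : ∀ {p₀ p₁ p₂ p₃ p₄ p₅ q₁ q₄ : V}, EdgeOn G 4 p₀ p₁ → EdgeOn G 4 p₁ p₂ →
      EdgeOn G 4 p₂ p₃ → EdgeOn G 4 p₃ p₄ → EdgeOn G 4 p₄ p₅ → p₀ ≠ p₂ → p₁ ≠ p₃ → p₂ ≠ p₄ →
      p₃ ≠ p₅ → EdgeOn G 2 p₁ q₁ → EdgeOn G 2 p₄ q₄ → G.Adj p₀ q₄ ∧ G.Adj q₁ p₅ := by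
    intro p₀ p₁ p₂ p₃ p₄ p₅ q₁ q₄ h0 h1 h2 h3 h4 n0 n1 n2 n3 m1 m4
    have c14 : ¬ G.Adj p₁ p₄ := fun h => n2 (hG.quad h1.1 h2.1 h3.1 h.symm n1)
    obtain ⟨m2, hm2⟩ := hM.exists_mate p₂
    obtain ⟨m3, hm3⟩ := hM.exists_mate p₃
    have e := hM.nonmate_system hG hmd h2 hm2 h1.symm n1 hm3 h3 n2.symm
    rcases matching_of_count₃_eq_two hG (hM.isNbrs hmd m1 h1 h0.symm n0.symm).rotate
      (hM.isNbrs hmd m4 h3.symm h4 n3).rotate h2.1 n1 n2 (by omega) with ⟨h05, h14⟩ | h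
    · exfalso
      have n4 : p₄ ≠ q₁ := by rintro rfl; exact c14 m1.1
      have n5 : p₁ ≠ q₄ := by rintro rfl; exact c14 m4.1.symm
      have n6 : p₅ ≠ p₁ := by rintro rfl; exact c14 h4.1.symm
      have t1 := one_le_count₃ (G := G) m4.1.symm n4 h3.symm.1 h2.symm.1 n1.symm
      have t2 := one_le_count₃ (G := G) m4.1.symm n4 h4.1 h05.symm n6
      have d14 : EdgeOn G 4 q₁ q₄ := (hM.mate_or h14).resolve_left fun h =>
        n5 (hM.unique_mate hmd m1.symm h)
      obtain ⟨q, y, ny, -, hy⟩ := hM.of_nonmate hmd d14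
      have c := hM.count₂_mate hG hmd m1.symm d14 hy ny.2.1
      have c' := count₂_comm hG m1.1 h14 n5
      have c'' := count₂_eq (p := q₄) (hM.isNbrs hmd m1 h1 h0.symm n0.symm)
      omega
    · exact h
  obtain ⟨p₂⟩ := ‹Nonempty V›
  obtain ⟨q₂, hq₂⟩ := hM.exists_mate p₂
  obtain ⟨p₁, p₃, hn, h1, h2⟩ := hM.of_mate hmd hq₂
  obtain ⟨q₁, p₀, hn1, m1, h0⟩ := hM.of_nonmate hmd h1.symm
  obtain ⟨q₃, p₄, hn3, m3, h3⟩ := hM.of_nonmate hmd h2.symm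
  obtain ⟨q₄, p₅, hn4, m4, h4⟩ := hM.of_nonmate hmd h3.symm
  have n0 := hn1.2.1.symm
  have n1 := hn.2.2.1
  have n2 := hn3.2.1
  have n3 := hn4.2.1
  obtain ⟨a, b⟩ := cross h0.symm h1.symm h2 h3 h4 n0 n1 n2 n3 m1 m4
  obtain ⟨q₀, m0⟩ := hM.exists_mate p₀
  have nq : p₀ ≠ p₄ := by
    rintro rfl
    exact n2 (hG.quad h1.1.symm h2.1 h3.1 h0.1.symm n1)
  have d : EdgeOn G 4 p₀ q₄ := (hM.mate_or a).resolve_left fun h =>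
    nq (hM.unique_mate hmd h.symm m4.symm)
  have nq' : q₄ ≠ p₁ := by
    rintro rfl
    exact n2 (hG.quad h1.1.symm h2.1 h3.1 m4.1 n1)
  obtain ⟨-, b'⟩ := cross d.symm h0.symm h1.symm h2 h3 nq' n0 n1 n2 m0 m3
  rcases hn4.eq_or b'.symm with rfl | rfl | rfl
  · exact n1 (hG.quad h0.1.symm h1.1.symm h2.1 m0.1.symm n0)
  · exact ne m0 d rfl
  · have := hG.quad h0.1.symm m1.1 b m0.1.symm (ne m1 h0).symm
    subst this
    exact n2 (hG.quad h1.1.symm h2.1 h3.1 h4.1 n1)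

end

section

variable [Fintype V]

theorem EdgeOn.map {k : ℕ} {v w : V} (h : EdgeOn G k v w) (φ : G ≃g G) :
    EdgeOn G k (φ v) (φ w) :=
  ⟨φ.map_adj_iff.2 h.1, (count₁_map φ v w).trans h.2⟩

theorem IsMatched.count₃_le_one (hG : NoShortCycle G) (hM : IsMatched G 4 3)
    (hvt : ∀ u v : V, ∃ φ : G ≃g G, φ u = v) {p q r s : V} (hp : EdgeOn G 4 q p)
    (h : EdgeOn G 3 q r) (hs : EdgeOn G 4 r s) : count₃ G p q r s ≤ 1 := by
  have hmd : (4 : ℕ) ≠ 3 := by decide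
  have ne : ∀ {v x y : V}, EdgeOn G 4 v x → EdgeOn G 3 v y → x ≠ y := by
    rintro v x y h h' rfl
    exact hmd (h.2.symm.trans h'.2)
  by_contra hlt
  have h2 : 2 ≤ count₃ G p q r s := by omega
  obtain ⟨x, x', nx, dx, dx'⟩ := hM.of_mate hmd hp.symm
  obtain ⟨y, y', ny, dy, dy'⟩ := hM.of_mate hmd hs.symm
  have hqs : q ≠ s := (ne hs h.symm).symm
  have hpr : p ≠ r := ne hp h
  have hps : ¬ G.Adj p s := fun ha => hpr (hG.quad h.1 hs.1 ha.symm hp.symm.1 hqs).symm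
  have key : ∀ {x x' y y'}, EdgeOn G 3 p x → EdgeOn G 3 p x' → x ≠ x' → EdgeOn G 3 s y →
      EdgeOn G 3 s y' → G.Adj x y → G.Adj x' y' →
      ∃ z, EdgeOn G 4 x z ∧ count₃ G q p x z ≤ 1 := by
    intro x x' y y' dx dx' nx dy dy' hxy hxy'
    have hsx : s ≠ x := by rintro rfl; exact hps dx.1
    have hpy : y ≠ p := by rintro rfl; exact hps dy.symm.1
    have hpy' : y' ≠ p := by rintro rfl; exact hps dy'.symm.1
    have c := count₂_eq (p := y) (hM.isNbrs hmd hp.symm dx dx' nx).rotate.swap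
    have c1 := one_le_count₃ (G := G) dy.1.symm hsx hs.symm.1 h.symm.1 hpr.symm
    have c2 := one_le_count₃ (G := G) dy.1.symm hsx dy'.1 hxy'.symm hpy'
    obtain ⟨m, x₀, n₀, hm, h₀⟩ := hM.of_nonmate hmd dx.symm
    have hxm : EdgeOn G 4 x y := (hM.mate_or hxy).resolve_right fun hd => by
      have c3 := hM.count₂_mate hG hmd hm hd dx.symm hpy
      omega
    refine ⟨y, hxm, ?_⟩
    have c3 := hM.count₂_mate hG hmd hxm dx.symm h₀ n₀.2.1
    rw [count₃_comm]
    omega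
  obtain ⟨φ, hφ⟩ := hvt q p
  have e1 := hp.map φ
  have e2 := h.map φ
  have e3 := hs.map φ
  have e4 := count₃_map φ p q r s
  rw [hφ] at e1 e2 e4
  rw [hM.unique_mate hmd e1 hp.symm] at e4
  have fin : ∀ {u}, EdgeOn G 3 p u → ∃ z, EdgeOn G 4 u z ∧ count₃ G q p u z ≤ 1 := by
    intro u hu
    rcases matching_of_count₃_eq_two hG nx ny h.1 hpr hqs h2 with ⟨g, g'⟩ | ⟨g, g'⟩ <;>
      rcases nx.eq_or hu.1 with rfl | rfl | rfl
    · exact absurd rfl (ne hp.symm hu)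
    · exact key dx dx' nx.2.2.1 dy dy' g g'
    · exact key dx' dx nx.2.2.1.symm dy' dy g' g
    · exact absurd rfl (ne hp.symm hu)
    · exact key dx dx' nx.2.2.1 dy' dy g g'
    · exact key dx' dx nx.2.2.1.symm dy dy' g' g
  obtain ⟨z, hz, hz'⟩ := fin e2
  rw [hM.unique_mate hmd hz e3] at hz'
  omega

theorem not_isMatched_four_three [Nonempty V] (hG : NoShortCycle G)
    (hvt : ∀ u v : V, ∃ φ : G ≃g G, φ u = v) : ¬ IsMatched G 4 3 := by
  intro hM
  have hmd : (4 : ℕ) ≠ 3 := by decide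
  have ne : ∀ {v x y : V}, EdgeOn G 4 v x → EdgeOn G 3 v y → x ≠ y := by
    rintro v x y h h' rfl
    exact hmd (h.2.symm.trans h'.2)
  have nonmate : ∀ {v w x : V}, EdgeOn G 4 v w → G.Adj v x → x ≠ w → EdgeOn G 3 v x :=
    fun h hx hxw => (hM.mate_or hx).resolve_left fun h' => hxw (hM.unique_mate hmd h' h)
  have ddd : ∀ {p q r s : V}, EdgeOn G 3 p q → EdgeOn G 3 q r → EdgeOn G 3 r s → p ≠ r → q ≠ s →
      count₃ G p q r s = 0 := by
    intro p q r s h1 h2 h3 hpr hqs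
    obtain ⟨m, hm⟩ := hM.exists_mate q
    obtain ⟨m', hm'⟩ := hM.exists_mate r
    have e := hM.nonmate_system hG hmd h2 hm h1.symm hpr hm' h3 hqs.symm
    have := hM.count₃_le_one hG hvt hm h2 hm'
    omega
  have ddm : ∀ {p q r s : V}, EdgeOn G 3 p q → EdgeOn G 3 q r → EdgeOn G 4 r s → p ≠ r →
      1 ≤ count₃ G p q r s := by
    intro p q r s h1 h2 hm' hpr
    obtain ⟨m, hm⟩ := hM.exists_mate q
    obtain ⟨t, s', n, ht, h3⟩ := hM.of_nonmate hmd h2.symm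
    have e := hM.nonmate_system hG hmd h2 hm h1.symm hpr hm' h3 n.2.1.symm
    have := hM.count₃_le_one hG hvt hm h2 hm'
    omega
  have mdm : ∀ {p q r s : V}, EdgeOn G 4 q p → EdgeOn G 3 q r → EdgeOn G 4 r s →
      1 ≤ count₃ G p q r s := by
    intro p q r s hm h2 hm'
    obtain ⟨t', q', n', ht', h1⟩ := hM.of_nonmate hmd h2
    obtain ⟨t, s', n, ht, h3⟩ := hM.of_nonmate hmd h2.symm
    have e := hM.nonmate_system hG hmd h2 hm h1 n'.2.1.symm hm' h3 n.2.1.symm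
    have := hM.count₃_le_one hG hvt hm h2 hm'
    omega
  have noadj : ∀ {p q r s : V}, EdgeOn G 4 q p → EdgeOn G 3 q r → EdgeOn G 4 r s →
      ¬ G.Adj p s := fun hp h hs ha =>
    ne hp h (hG.quad h.1 hs.1 ha.symm hp.symm.1 (ne hs h.symm).symm).symm
  have opp : ∀ {p q r s : V}, EdgeOn G 4 q p → EdgeOn G 3 q r → EdgeOn G 4 r s →
      ∃ x y, EdgeOn G 3 p x ∧ EdgeOn G 4 x y ∧ EdgeOn G 3 s y := by
    intro p q r s hp h hs
    obtain ⟨x, y, h1, h2, h3, h4, h5⟩ := exists_of_one_le_count₃ (mdm hp h hs)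
    have dx := nonmate hp.symm h1 h2
    have dy := nonmate hs.symm h4.symm h5
    refine ⟨x, y, dx, (hM.mate_or h3).resolve_right fun hd => ?_, dy⟩
    have hn := noadj hp h hs
    have := ddd dx hd dy.symm (by rintro rfl; exact hn h4) (by rintro rfl; exact hn h1)
    have := one_le_count₃ (G := G) hp.symm.1 (ne hp.symm dx) h.1 hs.1 (ne hs.symm dy)
    omega
  have mid : ∀ {p₀ p₁ p₂ s₀ s₂ : V}, EdgeOn G 3 p₁ p₀ → EdgeOn G 3 p₁ p₂ → p₀ ≠ p₂ →
      EdgeOn G 4 p₀ s₀ → EdgeOn G 4 p₂ s₂ → ∃ h, EdgeOn G 3 s₂ h ∧ EdgeOn G 3 s₀ h := by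
    intro p₀ p₁ p₂ s₀ s₂ h0 h2 hne m0 m2
    obtain ⟨x, y, h1, h2', h3, h4, h5⟩ := exists_of_one_le_count₃ (ddm h0.symm h2 m2 hne)
    have dy := nonmate m2.symm h4.symm h5
    have hx : x = s₀ := by
      by_contra hx
      have dx := nonmate m0 h1 hx
      have hyp : y ≠ p₀ := by
        rintro rfl
        exact hne (hG.quad h0.1 h4 m2.symm.1 h2.symm.1 (ne m2 h2.symm).symm)
      have hxp : x ≠ p₂ := by
        rintro rfl
        exact hG.tri h0.1 dx.1 h2.symm.1
      have := ddd dx.symm h0.symm h2 h2' hne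
      have hys : s₂ ≠ p₁ := (ne m2 h2.symm)
      have := one_le_count₃ (G := G) h3 hyp h4 m2.symm.1 hys
      omega
    subst hx
    refine ⟨y, dy, nonmate m0.symm h3 ?_⟩
    rintro rfl
    exact hne (hG.quad h0.1 h4 m2.symm.1 h2.symm.1 (ne m2 h2.symm).symm)
  obtain ⟨p⟩ := ‹Nonempty V›
  obtain ⟨r, hpr⟩ := hM.exists_mate p
  obtain ⟨p₀, p₂, n, h0, h2⟩ := hM.of_mate hmd hpr
  obtain ⟨s₀, m0⟩ := hM.exists_mate p₀
  obtain ⟨s₂, m2⟩ := hM.exists_mate p₂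
  obtain ⟨x₀, u₀, hx0, hu0, hs0⟩ := opp hpr h0 m0
  obtain ⟨x₂, u₂, hx2, hu2, hs2⟩ := opp hpr h2 m2
  have hs : ∀ {p' s'}, EdgeOn G 3 p p' → EdgeOn G 4 p' s' → ∀ {x}, EdgeOn G 3 r x → s' ≠ x := by
    rintro p' s' h m x hx rfl
    exact noadj hpr h m hx.1
  have hu : ∀ {x u}, EdgeOn G 3 r x → EdgeOn G 4 x u → ∀ {p'}, EdgeOn G 3 p p' → u ≠ p' := by
    rintro x u h m p' hp rfl
    exact noadj hpr.symm h m hp.1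
  have hx : x₀ ≠ x₂ := by
    rintro rfl
    obtain rfl := hM.unique_mate hmd hu0 hu2
    have := hM.count₃_le_one hG hvt hpr.symm hx0 hu0
    have := two_le_count₃ (G := G) h0.1 (ne hpr h0).symm m0.1 hs0.1 (hs h0 m0 hx0)
      h2.1 (ne hpr h2).symm m2.1 hs2.1 (hs h2 m2 hx0) (.inl n.2.2.1)
    omega
  have hc : ¬ G.Adj s₀ u₂ := fun ha => by
    have := hM.count₃_le_one hG hvt hpr h0 m0
    have := two_le_count₃ (G := G) hx0.1 (ne hpr.symm hx0).symm hu0.1 hs0.symm.1 (hu hx0 hu0 h0)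
      hx2.1 (ne hpr.symm hx2).symm hu2.1 ha.symm (hu hx2 hu2 h0) (.inl hx)
    omega
  have hc' : ¬ G.Adj s₂ u₀ := fun ha => by
    have := hM.count₃_le_one hG hvt hpr h2 m2
    have := two_le_count₃ (G := G) hx2.1 (ne hpr.symm hx2).symm hu2.1 hs2.symm.1 (hu hx2 hu2 h2)
      hx0.1 (ne hpr.symm hx0).symm hu0.1 ha.symm (hu hx0 hu0 h2) (.inl hx.symm)
    omega
  obtain ⟨h, hh2, hh0⟩ := mid h0 h2 n.2.2.1 m0 m2
  obtain ⟨g, hg2, hg0⟩ := mid hx0 hx2 hx hu0 hu2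
  have hhu : h ≠ u₀ := by rintro rfl; exact hc' hh2.1
  have hhu' : u₂ ≠ h := by rintro rfl; exact hc hh0.1
  have hss : s₂ ≠ s₀ := by
    rintro rfl
    exact n.2.2.1 (hM.unique_mate hmd m0.symm m2.symm)
  have hgs : g ≠ s₀ := by rintro rfl; exact hc hg2.symm.1
  have := ddd hh2 hh0.symm hs0 hss hhu
  have := one_le_count₃ (G := G) hs2.1 hhu' hg2.1 hg0.symm.1 hgs
  omega

end

section

variable [Fintype V]

/-- Every path with three edges lies on exactly one 6-cycle. -/
def Tight (G : SimpleGraph V) : Prop :=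
  ∀ {p q r s : V}, G.Adj p q → G.Adj q r → G.Adj r s → p ≠ r → q ≠ s → count₃ G p q r s = 1

theorem Tight.of_count₁ (hG : NoShortCycle G) (hC : Cubic G)
    (hvt : ∀ u v : V, ∃ φ : G ≃g G, φ u = v) (h4 : ∀ v w, G.Adj v w → count₁ G v w = 4) :
    Tight G := by
  have two : ∀ {p q r : V}, G.Adj q p → G.Adj q r → p ≠ r → count₂ G p q r = 2 := by
    intro p q r hp hr hpr
    obtain ⟨a, b, c, hn⟩ := hC q
    obtain ⟨t, hn'⟩ := hn.exists_third hp hr hpr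
    have := vertex_system hG hn'
    have h1 := h4 _ _ hn'.adj₁
    have h2 := h4 _ _ hn'.adj₂
    have h3 := h4 _ _ hn'.adj₃
    omega
  have le : ∀ {u₁ u v v₁ : V}, G.Adj u₁ u → G.Adj u v → G.Adj v v₁ → u₁ ≠ v → u ≠ v₁ →
      2 ≤ count₃ G u₁ u v v₁ → ∀ {p r}, G.Adj u₁ p → p ≠ u → G.Adj u r → r ≠ u₁ →
        count₃ G p u₁ u r ≤ 1 := by
    intro u₁ u v v₁ h1 h2 h3 n1 n2 ht p r hp hpu hr hru
    obtain ⟨_, _, _, nu₁⟩ := hC u₁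
    obtain ⟨_, _, _, nv₁⟩ := hC v₁
    obtain ⟨_, _, _, nu⟩ := hC u
    obtain ⟨a, nu₁⟩ := nu₁.exists_third h1 hp hpu.symm
    obtain ⟨b, b', nv₁⟩ := nv₁.exists_of_adj h3.symm
    obtain ⟨w, nu⟩ := nu.exists_third h1.symm h2 n1
    have hn : ¬ G.Adj u₁ v₁ := fun h => n2 (hG.quad h1 h2 h3 h.symm n1)
    have one : ∀ {x y}, G.Adj u₁ x → G.Adj x y → G.Adj v₁ y → 1 ≤ count₃ G x u₁ u v :=
      fun hx hxy hy => one_le_count₃ (G := G) hxy (by rintro rfl; exact hn hy.symm) hy.symm h3.symm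
        n2.symm
    have c1 := two nu₁.adj₁ nu₁.adj₂ hpu.symm
    have c2 := count₂_eq (p := p) nu
    have c3 := count₂_eq (p := v) nu₁
    have c4 := two h1.symm h2 n1
    have c5 := two h1 hp hpu.symm
    have c6 := count₂_comm hG h2.symm h1.symm n1.symm
    have c7 := count₂_comm hG h1.symm hp hpu.symm
    rw [count₃_comm v, count₃_comm v] at c3
    have hr' : r = v ∨ r = w := (nu.eq_or hr).resolve_left hru
    rcases matching_of_count₃_eq_two hG nu₁ nv₁ h2 n1 n2 ht with ⟨g, g'⟩ | ⟨g, g'⟩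
    · have o1 := one nu₁.adj₂ g nv₁.adj₂
      have o2 := one nu₁.adj₃ g' nv₁.adj₃
      rcases hr' with rfl | rfl <;> omega
    · have o1 := one nu₁.adj₂ g nv₁.adj₃
      have o2 := one nu₁.adj₃ g' nv₁.adj₂
      rcases hr' with rfl | rfl <;> omega
  have le' : ∀ {u₁ u v v₁ : V}, G.Adj u₁ u → G.Adj u v → G.Adj v v₁ → u₁ ≠ v → u ≠ v₁ →
      2 ≤ count₃ G u₁ u v v₁ → ∀ {p q r}, G.Adj u₁ q → G.Adj u₁ p → p ≠ q → G.Adj q r → r ≠ u₁ →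
        count₃ G p u₁ q r ≤ 1 := by
    intro u₁ u v v₁ h1 h2 h3 n1 n2 ht p q r hq hp hpq hr hru
    obtain ⟨_, _, _, nu₁⟩ := hC u₁
    obtain ⟨_, _, _, nv₁⟩ := hC v₁
    obtain ⟨a, a', nu₁⟩ := nu₁.exists_of_adj h1
    obtain ⟨b, b', nv₁⟩ := nv₁.exists_of_adj h3.symm
    have hn : ¬ G.Adj u₁ v₁ := fun h => n2 (hG.quad h1 h2 h3 h.symm n1)
    have main : ∀ {a b a' b'}, G.Adj u₁ a → u ≠ a → G.Adj v₁ b → v ≠ b → G.Adj u₁ a' → a ≠ a' →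
        G.Adj v₁ b' → b ≠ b' → u ≠ a' → G.Adj a b → G.Adj a' b' → q = a →
        count₃ G p u₁ q r ≤ 1 := by
      rintro a b a' b' ha na hb nb ha' na' hb' nb' nua' hab hab' rfl
      refine le ha hab hb.symm (by rintro rfl; exact hn hb.symm) (by rintro rfl; exact hn ha)
        ?_ hp hpq hr hru
      exact two_le_count₃ (G := G) h1 na h2 h3 nb ha' na'.symm hab' hb'.symm nb'.symm (.inl nua')
    rcases nu₁.eq_or hq with rfl | hq'
    · exact le h1 h2 h3 n1 n2 ht hp hpq hr hru
    · rcases matching_of_count₃_eq_two hG nu₁ nv₁ h2 n1 n2 ht with ⟨g, g'⟩ | ⟨g, g'⟩ <;>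
        rcases hq' with hq' | hq'
      · exact main nu₁.adj₂ nu₁.1 nv₁.adj₂ nv₁.1 nu₁.adj₃ nu₁.2.2.1 nv₁.adj₃ nv₁.2.2.1 nu₁.2.1
          g g' hq'
      · exact main nu₁.adj₃ nu₁.2.1 nv₁.adj₃ nv₁.2.1 nu₁.adj₂ nu₁.2.2.1.symm nv₁.adj₂
          nv₁.2.2.1.symm nu₁.1 g' g hq'
      · exact main nu₁.adj₂ nu₁.1 nv₁.adj₃ nv₁.2.1 nu₁.adj₃ nu₁.2.2.1 nv₁.adj₂ nv₁.2.2.1.symm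
          nu₁.2.1 g g' hq'
      · exact main nu₁.adj₃ nu₁.2.1 nv₁.adj₂ nv₁.1 nu₁.adj₂ nu₁.2.2.1.symm nv₁.adj₃
          nv₁.2.2.1 nu₁.1 g' g hq'
  have le_one : ∀ {p q r s : V}, G.Adj p q → G.Adj q r → G.Adj r s → p ≠ r → q ≠ s →
      count₃ G p q r s ≤ 1 := by
    intro p q r s h1 h2 h3 n1 n2
    by_contra hlt
    obtain ⟨φ, hφ⟩ := hvt q p
    have e := count₃_map φ p q r s
    have a1 : G.Adj (φ q) (φ p) := φ.map_adj_iff.2 h1.symm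
    have a2 : G.Adj (φ q) (φ r) := φ.map_adj_iff.2 h2
    have a3 : φ s ≠ φ q := φ.injective.ne n2.symm
    rw [hφ] at e a1 a2 a3
    have := le' h1 h2 h3 n1 n2 (by omega) a2 a1 (φ.injective.ne n1) (φ.map_adj_iff.2 h3) a3
    omega
  intro p q r s h1 h2 h3 n1 n2
  obtain ⟨_, _, _, nr⟩ := hC r
  obtain ⟨t, nr⟩ := nr.exists_third h2.symm h3 n2
  have := count₂_eq (p := p) nr
  have := two h1.symm h2 n1
  have := le_one h1 h2 h3 n1 n2
  have := le_one h1 h2 nr.adj₃ n1 nr.2.1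
  omega

theorem Tight.exists (hT : Tight G) {p q r s : V} (h1 : G.Adj p q) (h2 : G.Adj q r)
    (h3 : G.Adj r s) (n1 : p ≠ r) (n2 : q ≠ s) :
    ∃ x y, G.Adj p x ∧ x ≠ q ∧ G.Adj x y ∧ G.Adj y s ∧ y ≠ r :=
  exists_of_one_le_count₃ (hT h1 h2 h3 n1 n2).ge

theorem Tight.unique (hT : Tight G) {p q r s x y x' y' : V} (h1 : G.Adj p q) (h2 : G.Adj q r)
    (h3 : G.Adj r s) (n1 : p ≠ r) (n2 : q ≠ s) (hp : G.Adj p x) (hx : x ≠ q) (hxy : G.Adj x y)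
    (hy : G.Adj y s) (hyr : y ≠ r) (hp' : G.Adj p x') (hx' : x' ≠ q) (hxy' : G.Adj x' y')
    (hy' : G.Adj y' s) (hyr' : y' ≠ r) : x = x' ∧ y = y' := by
  by_contra h
  have := two_le_count₃ hp hx hxy hy hyr hp' hx' hxy' hy' hyr' (by tauto)
  have := hT h1 h2 h3 n1 n2
  omega

end

section

/-- The path `i x w y k` closes up to a 6-cycle through a common neighbour `v` of `i` and `k`. -/
structure Link (G : SimpleGraph V) (v i k x y w : V) : Prop where
  ix : G.Adj i x
  ky : G.Adj k y
  xv : x ≠ v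
  yv : y ≠ v
  xw : G.Adj x w
  wy : G.Adj w y
  wi : w ≠ i
  wk : w ≠ k

namespace Link
variable {v i k l x x' y y' w w' : V}

theorem symm (h : Link G v i k x y w) : Link G v k i y x w :=
  ⟨h.ky, h.ix, h.yv, h.xv, h.wy.symm, h.xw.symm, h.wk, h.wi⟩

theorem ne_left (hi : G.Adj v i) (hG : NoShortCycle G) (hik : i ≠ k) (hk : G.Adj v k)
    (h : Link G v i k x y w) : x ≠ y := by
  rintro rfl
  exact hik (hG.quad hi h.ix h.ky.symm hk.symm h.xv.symm)

variable [Fintype V]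

theorem exists_link (hG : NoShortCycle G) (hT : Tight G) (hi : G.Adj v i) (hk : G.Adj v k)
    (hik : i ≠ k) (hx : G.Adj i x) (hxv : x ≠ v) : ∃ y w, Link G v i k x y w := by
  obtain ⟨w, y, h1, h2, h3, h4, h5⟩ := hT.exists hx.symm hi.symm hk hxv hik
  refine ⟨y, w, hx, h4.symm, hxv, h5, h1, h3, h2, ?_⟩
  rintro rfl
  exact hik (hG.quad hi hx h1 hk.symm hxv.symm)

theorem unique_left (hT : Tight G) (hi : G.Adj v i) (hk : G.Adj v k) (hik : i ≠ k)
    (h : Link G v i k x y w) (h' : Link G v i k x' y w') : x = x' ∧ w = w' :=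
  (hT.unique h.ky.symm hk.symm hi h.yv hik.symm h.wy.symm h.wk h.xw.symm h.ix.symm h.xv
    h'.wy.symm h'.wk h'.xw.symm h'.ix.symm h'.xv).symm

theorem class_unique (hG : NoShortCycle G) (hT : Tight G) (hi : G.Adj v i) (hk : G.Adj v k)
    (hl : G.Adj v l) (hik : i ≠ k) (hil : i ≠ l) (h : Link G v i k x y w)
    (h' : Link G v i l x y' w) : y = y' ∧ k = l :=
  hT.unique h.xw.symm h.ix.symm hi.symm h.wi h.xv h.wy (h.ne_left hi hG hik hk).symm h.ky.symm
    hk.symm hik.symm h'.wy (h'.ne_left hi hG hil hl).symm h'.ky.symm hl.symm hil.symm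

theorem isNbrs (hG : NoShortCycle G) (hC : Cubic G) (hT : Tight G) (hv : IsNbrs G v i k l)
    (h : Link G v i k x y w) (h' : Link G v i l x y' w') : IsNbrs G x i w w' := by
  have hw : w ≠ w' := by
    rintro rfl
    exact hv.2.2.1 (h.class_unique hG hT hv.adj₁ hv.adj₂ hv.adj₃ hv.1 hv.2.1 h').2
  obtain ⟨_, _, _, n⟩ := hC x
  obtain ⟨z, n⟩ := n.exists_third h.ix.symm h.xw h.wi.symm
  rcases n.eq_or h'.xw with rfl | rfl | rfl
  · exact absurd rfl h'.wi
  · exact absurd rfl hw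
  · exact n

end Link

/-- The ball of radius three around `v` when the vertices at distance two are joined in a
hexagon. -/
structure Hexagon (G : SimpleGraph V) (v a b c c₀ c₁ c₂ c₃ c₄ c₅ w₀ w₁ w₂ w₃ w₄ w₅ : V) :
    Prop where
  nv : IsNbrs G v a b c
  na : IsNbrs G a v c₀ c₃
  nb : IsNbrs G b v c₁ c₄
  nc : IsNbrs G c v c₂ c₅
  nc₀ : IsNbrs G c₀ a w₅ w₀
  nc₁ : IsNbrs G c₁ b w₀ w₁
  nc₂ : IsNbrs G c₂ c w₁ w₂
  nc₃ : IsNbrs G c₃ a w₂ w₃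
  nc₄ : IsNbrs G c₄ b w₃ w₄
  nc₅ : IsNbrs G c₅ c w₄ w₅

/-- The ball of radius three around `v` when two triples of vertices at distance two are joined
in triangles. -/
structure Triangles (G : SimpleGraph V) (v a b c a₁ b₁ c₁ a₂ b₂ c₂ p q r p' q' r' : V) : Prop where
  nv : IsNbrs G v a b c
  na : IsNbrs G a v a₁ a₂
  nb : IsNbrs G b v b₁ b₂
  nc : IsNbrs G c v c₁ c₂
  na₁ : IsNbrs G a₁ a p r
  nb₁ : IsNbrs G b₁ b q p
  nc₁ : IsNbrs G c₁ c r q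
  na₂ : IsNbrs G a₂ a p' r'
  nb₂ : IsNbrs G b₂ b q' p'
  nc₂ : IsNbrs G c₂ c r' q'

variable [Fintype V]

theorem exists_triangles_or_hexagon (hG : NoShortCycle G) (hC : Cubic G) (hT : Tight G) (v : V) :
    (∃ a b c a₁ b₁ c₁ a₂ b₂ c₂ p q r p' q' r',
      Triangles G v a b c a₁ b₁ c₁ a₂ b₂ c₂ p q r p' q' r') ∨
    ∃ a b c c₀ c₁ c₂ c₃ c₄ c₅ w₀ w₁ w₂ w₃ w₄ w₅,
      Hexagon G v a b c c₀ c₁ c₂ c₃ c₄ c₅ w₀ w₁ w₂ w₃ w₄ w₅ := by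
  obtain ⟨a, b, c, nv⟩ := hC v
  obtain ⟨_, _, _, na⟩ := hC a
  obtain ⟨a₁, a₂, na⟩ := na.exists_of_adj nv.adj₁.symm
  -- the link from `x` leads to `y₂`, as `y₁` is taken by another link
  have other : ∀ {i k x x' y₁ y₂ w}, G.Adj v i → G.Adj v k → i ≠ k → G.Adj i x → x ≠ v →
      IsNbrs G k v y₁ y₂ → Link G v i k x' y₁ w → x' ≠ x → ∃ w', Link G v i k x y₂ w' := by
    intro i k x x' y₁ y₂ w hi hk hik hx hxv nk hl hxx
    obtain ⟨y, w', hl'⟩ := Link.exists_link hG hT hi hk hik hx hxv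
    rcases nk.eq_or hl'.ky with rfl | rfl | rfl
    · exact absurd rfl hl'.yv
    · exact absurd (hl.unique_left hT hi hk hik hl').1 hxx
    · exact ⟨w', hl'⟩
  obtain ⟨b₁, p, lab⟩ := Link.exists_link hG hT nv.adj₁ nv.adj₂ nv.1 na.adj₂ na.1.symm
  obtain ⟨_, _, _, nb⟩ := hC b
  obtain ⟨b₂, nb⟩ := nb.exists_third nv.adj₂.symm lab.ky lab.yv.symm
  obtain ⟨c₁, q, lbc⟩ := Link.exists_link hG hT nv.adj₂ nv.adj₃ nv.2.2.1 nb.adj₂ nb.1.symm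
  obtain ⟨_, _, _, nc⟩ := hC c
  obtain ⟨c₂, nc⟩ := nc.exists_third nv.adj₃.symm lbc.ky lbc.yv.symm
  obtain ⟨y, r, lca⟩ := Link.exists_link hG hT nv.adj₃ nv.adj₁ nv.2.1.symm nc.adj₂ nc.1.symm
  obtain ⟨p', lab'⟩ := other nv.adj₁ nv.adj₂ nv.1 na.adj₃ na.2.1.symm nb lab na.2.2.1
  obtain ⟨q', lbc'⟩ := other nv.adj₂ nv.adj₃ nv.2.2.1 nb.adj₃ nb.2.1.symm nc lbc nb.2.2.1
  rcases na.eq_or lca.ky with rfl | rfl | rfl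
  · exact absurd rfl lca.yv
  · left
    obtain ⟨r', lca'⟩ := other nv.adj₃ nv.adj₁ nv.2.1.symm nc.adj₃ nc.2.1.symm na lca nc.2.2.1
    exact ⟨a, b, c, y, b₁, c₁, a₂, b₂, c₂, p, q, r, p', q', r', nv, na, nb, nc,
      lab.isNbrs hG hC hT nv lca.symm, lbc.isNbrs hG hC hT nv.rotate lab.symm,
      lca.isNbrs hG hC hT nv.rotate.rotate lbc.symm,
      lab'.isNbrs hG hC hT nv lca'.symm, lbc'.isNbrs hG hC hT nv.rotate lab'.symm,
      lca'.isNbrs hG hC hT nv.rotate.rotate lbc'.symm⟩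
  · right
    obtain ⟨r', lca'⟩ := other nv.adj₃ nv.adj₁ nv.2.1.symm nc.adj₃ nc.2.1.symm na.swap lca nc.2.2.1
    exact ⟨a, b, c, a₁, b₁, c₁, y, b₂, c₂, p, q, r, p', q', r', nv, na, nb, nc,
      (lab.isNbrs hG hC hT nv lca'.symm).swap, (lbc.isNbrs hG hC hT nv.rotate lab.symm).swap,
      (lca.isNbrs hG hC hT nv.rotate.rotate lbc.symm).swap,
      (lab'.isNbrs hG hC hT nv lca.symm).swap, (lbc'.isNbrs hG hC hT nv.rotate lab'.symm).swap,
      (lca'.isNbrs hG hC hT nv.rotate.rotate lbc'.symm).swap⟩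

end

section

/-- A neighbourhood-preserving map from a cubic graph of small diameter to a connected graph
without cycles of length less than six is an isomorphism. -/
theorem nonempty_iso_of_isNbrs (hG : NoShortCycle G) (hconn : G.Connected) {W : Type*}
    {H : SimpleGraph W} {n : W → Fin 3 → W} (hH : ∀ w x, H.Adj w x ↔ ∃ i, x = n w i) (w₀ : W)
    (hd : ∀ w, w = w₀ ∨ (∃ i j, w = n (n w₀ i) j ∧ w ≠ w₀) ∨
      (∃ i j k l, w = n (n (n (n w₀ i) j) k) l ∧ w₀ ≠ n (n w₀ i) j ∧
        n w₀ i ≠ n (n (n w₀ i) j) k) ∨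
      ∃ i j k l m, w = n (n (n (n (n w₀ i) j) k) l) m)
    (f : W → V) (hf : ∀ w, IsNbrs G (f w) (f (n w 0)) (f (n w 1)) (f (n w 2))) :
    Nonempty (G ≃g H) := by
  have adj : ∀ w i, G.Adj (f w) (f (n w i)) := by
    intro w i
    fin_cases i
    exacts [(hf w).adj₁, (hf w).adj₂, (hf w).adj₃]
  have lift : ∀ w y, G.Adj (f w) y → ∃ i, y = f (n w i) := by
    intro w y hy
    rcases (hf w).eq_or hy with rfl | rfl | rfl
    exacts [⟨0, rfl⟩, ⟨1, rfl⟩, ⟨2, rfl⟩]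
  have back : ∀ w i, ∃ j, w = n (n w i) j := fun w i =>
    (hH _ _).1 ((hH w _).2 ⟨i, rfl⟩).symm
  have locinj : ∀ w i j, f (n w i) = f (n w j) → i = j := by
    intro w i j h
    obtain ⟨h1, h2, h3, -⟩ := hf w
    fin_cases i <;> fin_cases j <;> simp_all [eq_comm]
  have base : ∀ w, f w = f w₀ → w = w₀ := by
    intro w hw
    rcases hd w with h | ⟨i, j, rfl, -⟩ | ⟨i, j, k, l, rfl, h1, h2⟩ | ⟨i, j, k, l, m, rfl⟩
    · exact h
    · obtain ⟨i', hi'⟩ := back w₀ i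
      rw [locinj (n w₀ i) j i' (hw.trans (congrArg f hi')), ← hi']
    · exfalso
      obtain ⟨i', hi'⟩ := back w₀ i
      obtain ⟨j', hj'⟩ := back (n w₀ i) j
      have hne : f w₀ ≠ f (n (n w₀ i) j) := fun h =>
        h1 (hi'.trans (by rw [locinj (n w₀ i) i' j ((congrArg f hi').symm.trans h)]))
      have h4 := adj (n (n (n w₀ i) j) k) l
      rw [hw] at h4
      have h := hG.quad (adj w₀ i) (adj _ j) (adj _ k) h4 hne
      exact h2 (hj'.trans (by rw [locinj _ j' k ((congrArg f hj').symm.trans h)]))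
    · exfalso
      have h5 := adj (n (n (n (n w₀ i) j) k) l) m
      rw [hw] at h5
      exact hG.pent (adj w₀ i) (adj _ j) (adj _ k) (adj _ l) h5
  have step : ∀ w i, (∀ w', f w' = f w → w' = w) → ∀ w', f w' = f (n w i) → w' = n w i := by
    intro w i hw u hu
    obtain ⟨j, hj⟩ := back w i
    have h1 : G.Adj (f u) (f w) := hu ▸ (adj w i).symm
    obtain ⟨k, hk⟩ := lift _ _ h1
    obtain ⟨l, hl⟩ := back u k
    rw [hw _ hk.symm] at hl
    rw [hl, locinj w l i (hl ▸ hu)]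
  have hinj : Function.Injective f := by
    intro w' w hw
    revert w'
    rcases hd w with rfl | ⟨i, j, rfl, -⟩ | ⟨i, j, k, l, rfl, -⟩ | ⟨i, j, k, l, m, rfl⟩
    · exact base
    all_goals repeat' refine step _ _ ?_
    all_goals exact base
  have hsurj : Function.Surjective f := by
    intro y
    obtain ⟨p⟩ := hconn.preconnected (f w₀) y
    have : ∀ {u v : V}, G.Walk u v → (∃ w, f w = u) → ∃ w, f w = v := by
      intro u v p
      induction p with
      | nil => exact id
      | cons h _ ih =>
        rintro ⟨w, rfl⟩
        obtain ⟨i, hi⟩ := lift _ _ h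
        exact ih ⟨_, hi.symm⟩
    exact this p ⟨w₀, rfl⟩
  refine ⟨Iso.symm ⟨Equiv.ofBijective f ⟨hinj, hsurj⟩, ?_⟩⟩
  intro w x
  rw [hH]
  constructor
  · intro h
    obtain ⟨i, hi⟩ := lift _ _ h
    exact ⟨i, hinj hi⟩
  · rintro ⟨i, rfl⟩
    exact adj w i

end

section

theorem Cubic.exists_third (hC : Cubic G) {v x y : V} (hx : G.Adj v x) (hy : G.Adj v y)
    (hxy : x ≠ y) : ∃ z, IsNbrs G v x y z := by
  obtain ⟨_, _, _, h⟩ := hC v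
  exact h.exists_third hx hy hxy

theorem IsNbrs.of_adj {v a b c x y z : V} (h : IsNbrs G v a b c) (hx : G.Adj v x) (hy : G.Adj v y)
    (hz : G.Adj v z) (hxy : x ≠ y) (hxz : x ≠ z) (hyz : y ≠ z) : IsNbrs G v x y z := by
  obtain ⟨w, hn⟩ := h.exists_third hx hy hxy
  rcases hn.eq_or hz with rfl | rfl | rfl
  · exact absurd rfl hxz
  · exact absurd rfl hyz
  · exact hn

theorem Cubic.isNbrs (hC : Cubic G) {v x y z : V} (hx : G.Adj v x) (hy : G.Adj v y)
    (hz : G.Adj v z) (hxy : x ≠ y) (hxz : x ≠ z) (hyz : y ≠ z) : IsNbrs G v x y z := by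
  obtain ⟨_, _, _, h⟩ := hC v
  exact h.of_adj hx hy hz hxy hxz hyz

namespace Triangles
variable {v a b c a₁ b₁ c₁ a₂ b₂ c₂ p q r p' q' r' : V}

theorem rotate (h : Triangles G v a b c a₁ b₁ c₁ a₂ b₂ c₂ p q r p' q' r') :
    Triangles G v b c a b₁ c₁ a₁ b₂ c₂ a₂ q r p q' r' p' :=
  ⟨h.nv.rotate, h.nb, h.nc, h.na, h.nb₁, h.nc₁, h.na₁, h.nb₂, h.nc₂, h.na₂⟩

variable [Fintype V]

theorem exists_apex (hG : NoShortCycle G) (hC : Cubic G) (hT : Tight G)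
    (h : Triangles G v a b c a₁ b₁ c₁ a₂ b₂ c₂ p q r p' q' r') :
    ∃ z, IsNbrs G p a₁ b₁ z ∧ IsNbrs G p' a₂ b₂ z ∧ ∀ x, G.Adj v x → ¬ G.Adj z x := by
  obtain ⟨nv, na, nb, nc, na₁, nb₁, nc₁, na₂, nb₂, nc₂⟩ := h
  have hab : a₁ ≠ b₁ := by
    rintro rfl
    exact nv.1 (hG.quad nv.adj₁ na.adj₂ nb.adj₂.symm nv.adj₂.symm na.1)
  have hab' : a₂ ≠ b₂ := by
    rintro rfl
    exact nv.1 (hG.quad nv.adj₁ na.adj₃ nb.adj₃.symm nv.adj₂.symm na.2.1)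
  obtain ⟨z, np⟩ := hC.exists_third na₁.adj₂.symm nb₁.adj₃.symm hab
  have hz : ∀ x, G.Adj v x → ¬ G.Adj z x := by
    intro x hx hzx
    rcases nv.eq_or hx with rfl | rfl | rfl
    · exact np.2.1 (hG.quad na.adj₂ na₁.adj₂ np.adj₃ hzx na₁.1)
    · exact np.2.2.1 (hG.quad nb.adj₂ nb₁.adj₃ np.adj₃ hzx nb₁.2.1)
    · exact np.2.2.1 (hT.unique np.adj₁ na₁.adj₁ nv.adj₁.symm na₁.1.symm na.1.symm np.adj₂
        hab.symm nb₁.adj₁ nv.adj₂.symm nv.1.symm np.adj₃ np.2.1.symm hzx nv.adj₃.symm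
        nv.2.1.symm).1
  have hA : G.Adj p' z ∨ G.Adj r' z := by
    obtain ⟨x, y, h1, h2, h3, h4, h5⟩ := hT.exists na.adj₂ na₁.adj₂ np.adj₃ na₁.1 np.2.1
    rcases na.eq_or h1 with rfl | rfl | rfl
    · exact absurd h4.symm (hz _ h3)
    · exact absurd rfl h2
    · rcases na₂.eq_or h3 with rfl | rfl | rfl
      · exact absurd h4.symm (hz _ nv.adj₁)
      · exact .inl h4
      · exact .inr h4
  have hB : G.Adj p' z ∨ G.Adj q' z := by
    obtain ⟨x, y, h1, h2, h3, h4, h5⟩ := hT.exists nb.adj₂ nb₁.adj₃ np.adj₃ nb₁.2.1 np.2.2.1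
    rcases nb.eq_or h1 with rfl | rfl | rfl
    · exact absurd h4.symm (hz _ h3)
    · exact absurd rfl h2
    · rcases nb₂.eq_or h3 with rfl | rfl | rfl
      · exact absurd h4.symm (hz _ nv.adj₂)
      · exact .inr h4
      · exact .inl h4
  have hp : G.Adj p' z := by
    rcases hA with h | hr
    · exact h
    rcases hB with h | hq
    · exact h
    have hzc : c₂ ≠ z := by
      rintro rfl
      exact hz _ nv.adj₃ nc₂.adj₁
    exact absurd (hG.quad nc₂.adj₂ hr hq.symm nc₂.adj₃.symm hzc) nc₂.2.2.1
  refine ⟨z, np, hC.isNbrs na₂.adj₂.symm nb₂.adj₃.symm hp hab' ?_ ?_, hz⟩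
  · rintro rfl
    exact hz _ nv.adj₁ na₂.adj₁
  · rintro rfl
    exact hz _ nv.adj₂ nb₂.adj₁

theorem apex_nbrs (hG : NoShortCycle G) (hC : Cubic G) (hT : Tight G)
    (h : Triangles G v a b c a₁ b₁ c₁ a₂ b₂ c₂ p q r p' q' r') {z z' y : V}
    (np : IsNbrs G p a₁ b₁ z) (np' : IsNbrs G p' a₂ b₂ z) (hz : ∀ x, G.Adj v x → ¬ G.Adj z x)
    (nr : IsNbrs G r c₁ a₁ z') (nr' : IsNbrs G r' c₂ a₂ z')
    (hz' : ∀ x, G.Adj v x → ¬ G.Adj z' x) (nz : IsNbrs G z p p' y) : IsNbrs G z' r r' y := by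
  obtain ⟨nv, na, nb, nc, na₁, nb₁, nc₁, na₂, nb₂, nc₂⟩ := h
  have hzr : ¬ G.Adj z r := fun h =>
    na₁.2.2.1 (hG.quad na₁.adj₂ np.adj₃ h na₁.adj₃.symm np.2.1)
  have hzr' : ¬ G.Adj z r' := fun h =>
    na₂.2.2.1 (hG.quad na₂.adj₂ np'.adj₃ h na₂.adj₃.symm np'.2.1)
  have hzq : ¬ G.Adj z q := fun h =>
    nb₁.2.2.1 (hG.quad nb₁.adj₂ h.symm np.adj₃.symm nb₁.adj₃.symm np.2.2.1)
  have hrr : r ≠ r' := by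
    rintro rfl
    exact na.2.2.1 (hG.quad na.adj₂ na₁.adj₃ nr'.adj₂ na.adj₃.symm na₁.2.1)
  have hza : a₂ ≠ z' := by
    rintro rfl
    exact hz' _ nv.adj₁ na₂.adj₁
  obtain ⟨x, y', h1, h2, h3, h4, h5⟩ := hT.exists np.adj₃.symm np.adj₁ na₁.adj₃ np.2.1.symm
    na₁.2.2.1
  have key : G.Adj z' y := by
    rcases nr.eq_or h4.symm with rfl | rfl | rfl
    · rcases nc₁.eq_or h3.symm with rfl | rfl | rfl
      · exact absurd h1 (hz _ nv.adj₃)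
      · exact absurd h1 hzr
      · exact absurd h1 hzq
    · exact absurd rfl h5
    · rcases nz.eq_or h1 with rfl | rfl | rfl
      · exact absurd rfl h2
      · exact absurd (hG.quad na₂.adj₂ h3 nr'.adj₃.symm nr'.adj₂ hza) na₂.2.2.1
      · exact h3.symm
  refine hC.isNbrs nr.adj₃.symm nr'.adj₃.symm key hrr ?_ ?_
  · rintro rfl
    exact hzr nz.adj₃
  · rintro rfl
    exact hzr' nz.adj₃

end Triangles

namespace Hexagon
variable {v a b c c₀ c₁ c₂ c₃ c₄ c₅ w₀ w₁ w₂ w₃ w₄ w₅ : V}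

theorem rotate (h : Hexagon G v a b c c₀ c₁ c₂ c₃ c₄ c₅ w₀ w₁ w₂ w₃ w₄ w₅) :
    Hexagon G v b c a c₁ c₂ c₃ c₄ c₅ c₀ w₁ w₂ w₃ w₄ w₅ w₀ :=
  ⟨h.nv.rotate, h.nb, h.nc, h.na.swap, h.nc₁, h.nc₂, h.nc₃, h.nc₄, h.nc₅, h.nc₀⟩

variable [Fintype V]

theorem isNbrs_two (hG : NoShortCycle G) (hC : Cubic G) (hT : Tight G)
    (h : Hexagon G v a b c c₀ c₁ c₂ c₃ c₄ c₅ w₀ w₁ w₂ w₃ w₄ w₅) {z : V}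
    (nw : IsNbrs G w₀ c₀ c₁ z) : IsNbrs G w₂ c₂ c₃ z := by
  obtain ⟨nv, na, nb, nc, nc₀, nc₁, nc₂, nc₃, nc₄, nc₅⟩ := h
  have hzc : ¬ G.Adj z c := fun hz =>
    nv.2.1 (hT.unique nc₁.adj₂.symm nb.adj₂.symm nb.adj₁ nc₁.1.symm nb.1.symm nw.adj₁ nw.1
      nc₀.adj₁ nv.adj₁.symm nv.1 nw.adj₃ nw.2.2.1.symm hz nv.adj₃.symm nv.2.2.1.symm).2
  have h₁₂ : c₁ ≠ c₂ := by
    rintro rfl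
    exact nv.2.2.1 (hG.quad nv.adj₂ nb.adj₂ nc.adj₂.symm nv.adj₃.symm nb.1)
  have h₂₃ : c₂ ≠ c₃ := by
    rintro rfl
    exact nv.2.1 (hG.quad nv.adj₁ na.adj₃ nc.adj₂.symm nv.adj₃.symm na.2.1)
  have hw : w₁ ≠ w₀ := nc₁.2.2.1.symm
  obtain ⟨x, y, h1, h2, h3, h4, h5⟩ := hT.exists nc₂.adj₂ nc₁.adj₃.symm nc₁.adj₂ h₁₂.symm hw
  have hzw : G.Adj w₂ z := by
    rcases nc₂.eq_or h1 with rfl | rfl | rfl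
    · rcases nw.eq_or h4.symm with rfl | rfl | rfl
      · exact absurd (hG.quad nv.adj₁ na.adj₂ h3.symm nv.adj₃.symm na.1) nv.2.1
      · exact absurd rfl h5
      · exact absurd h3.symm hzc
    · exact absurd rfl h2
    · rcases nw.eq_or h4.symm with rfl | rfl | rfl
      · exact absurd (hG.quad na.adj₂ h3.symm nc₃.adj₂.symm na.adj₃.symm nc₃.1) na.2.2.1
      · exact absurd rfl h5
      · exact h3
  refine hC.isNbrs nc₂.adj₃.symm nc₃.adj₂.symm hzw h₂₃ ?_ ?_
  · rintro rfl
    exact hzc nc₂.adj₁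
  · rintro rfl
    exact na.2.2.1 (hG.quad na.adj₂ nw.adj₁.symm nw.adj₃ na.adj₃.symm nc₀.2.1)

end Hexagon

end

section

/-- The neighbours in `GP(10, 3)`. -/
def petersenNbr : ZMod 10 × Bool → Fin 3 → ZMod 10 × Bool
  | (i, false) => ![(i + 1, false), (i - 1, false), (i, true)]
  | (i, true) => ![(i + 3, true), (i - 3, true), (i, false)]

/-- The neighbours in `Σ_3`. -/
def sigmaNbr : DihedralGroup 3 × Multiplicative (ZMod 3) →
    Fin 3 → DihedralGroup 3 × Multiplicative (ZMod 3)
  | (.r j, k) => ![(.sr (2 + j), k), (.sr j, .ofAdd 1 * k), (.sr j, .ofAdd 2 * k)]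
  | (.sr j, k) => ![(.r (j - 2), k), (.r j, .ofAdd 1 * k), (.r j, .ofAdd 2 * k)]

theorem genPetersen_adj (w x : ZMod 10 × Bool) :
    (genPetersen 10 3).Adj w x ↔ ∃ i, x = petersenNbr w i := by
  simp only [genPetersen, SimpleGraph.fromRel_adj]
  revert w x
  decide +kernel

theorem sigmaGraph_adj (w x : DihedralGroup 3 × Multiplicative (ZMod 3)) :
    (sigmaGraph 3).Adj w x ↔ ∃ i, x = sigmaNbr w i := by
  simp only [sigmaGraph, cayley, dihTau, SimpleGraph.fromRel_adj, Set.mem_insert_iff,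
    Set.mem_singleton_iff]
  revert w x
  decide +kernel

variable [Fintype V]

theorem Triangles.nonempty_iso (hG : NoShortCycle G) (hC : Cubic G) (hT : Tight G)
    (hconn : G.Connected) {v a b c a₁ b₁ c₁ a₂ b₂ c₂ p q r p' q' r' : V}
    (h : Triangles G v a b c a₁ b₁ c₁ a₂ b₂ c₂ p q r p' q' r') :
    Nonempty (G ≃g genPetersen 10 3) := by
  obtain ⟨x, np, np', hx⟩ := h.exists_apex hG hC hT
  obtain ⟨y, nq, nq', hy⟩ := h.rotate.exists_apex hG hC hT
  obtain ⟨z, nr, nr', hz⟩ := h.rotate.rotate.exists_apex hG hC hT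
  have hp : p ≠ p' := by
    rintro rfl
    exact h.na.2.2.1 (hG.quad h.na.adj₂ h.na₁.adj₂ np'.adj₁ h.na.adj₃.symm h.na₁.1)
  obtain ⟨o, nx⟩ := hC.exists_third np.adj₃.symm np'.adj₃.symm hp
  have nz := h.apex_nbrs hG hC hT np np' hx nr nr' hz nx
  have ny := h.rotate.rotate.apex_nbrs hG hC hT nr nr' hz nq nq' hy nz
  have hxy : x ≠ y := by
    rintro rfl
    exact h.nb₁.2.2.1 (hG.quad nq.adj₁.symm nq.adj₃ np.adj₃.symm np.adj₂ np.2.2.1)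
  have hxz : x ≠ z := by
    rintro rfl
    exact h.na₁.2.2.1 (hG.quad np.adj₁.symm np.adj₃ nr.adj₃.symm nr.adj₂ np.2.1)
  have hyz : y ≠ z := by
    rintro rfl
    exact h.nc₁.2.2.1 (hG.quad nr.adj₁.symm nr.adj₃ nq.adj₃.symm nq.adj₂ nr.2.1)
  have no := hC.isNbrs nx.adj₃.symm ny.adj₃.symm nz.adj₃.symm hxy hxz hyz
  refine nonempty_iso_of_isNbrs hG hconn genPetersen_adj (0, false) (by decide +kernel)
    (fun w => match w with
      | (i, false) => ![v, a, a₁, r, z, o, y, q', b₂, b] i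
      | (i, true) => ![c, a₂, p, c₁, r', x, q, c₂, p', b₁] i) ?_
  rintro ⟨i, _ | _⟩ <;> fin_cases i
  exacts [h.nv, h.na.rotate.swap, h.na₁.rotate.rotate, nr.swap.rotate, nz.rotate.rotate, no.rotate,
      ny.rotate, nq'.swap, h.nb₂, h.nb.swap, h.nc.rotate, h.na₂.swap.rotate, np.swap.rotate,
      h.nc₁.rotate.rotate, nr', nx.rotate.swap, nq, h.nc₂, np'.swap, h.nb₁.swap.rotate]

theorem Hexagon.nonempty_iso (hG : NoShortCycle G) (hC : Cubic G) (hT : Tight G)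
    (hconn : G.Connected) {v a b c c₀ c₁ c₂ c₃ c₄ c₅ w₀ w₁ w₂ w₃ w₄ w₅ : V}
    (h : Hexagon G v a b c c₀ c₁ c₂ c₃ c₄ c₅ w₀ w₁ w₂ w₃ w₄ w₅) :
    Nonempty (G ≃g sigmaGraph 3) := by
  have h₀₁ : c₀ ≠ c₁ := by
    rintro rfl
    exact h.nv.1 (hG.quad h.nv.adj₁ h.na.adj₂ h.nb.adj₂.symm h.nv.adj₂.symm h.na.1)
  have h₁₂ : c₁ ≠ c₂ := by
    rintro rfl
    exact h.nv.2.2.1 (hG.quad h.nv.adj₂ h.nb.adj₂ h.nc.adj₂.symm h.nv.adj₃.symm h.nb.1)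
  obtain ⟨y, n₀⟩ := hC.exists_third h.nc₀.adj₃.symm h.nc₁.adj₂.symm h₀₁
  obtain ⟨z, n₁⟩ := hC.exists_third h.nc₁.adj₃.symm h.nc₂.adj₂.symm h₁₂
  have n₂ := h.isNbrs_two hG hC hT n₀
  have n₃ := h.rotate.isNbrs_two hG hC hT n₁
  have n₄ := h.rotate.rotate.isNbrs_two hG hC hT n₂
  have n₅ := h.rotate.rotate.rotate.isNbrs_two hG hC hT n₃
  have ny : IsNbrs G y w₀ w₂ w₄ := by
    refine hC.isNbrs n₀.adj₃.symm n₂.adj₃.symm n₄.adj₃.symm ?_ ?_ ?_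
    · rintro rfl
      exact h.na.2.2.1 (hG.quad h.na.adj₂ n₀.adj₁.symm n₂.adj₂ h.na.adj₃.symm h.nc₀.2.1)
    · rintro rfl
      exact h.nb.2.2.1 (hG.quad h.nb.adj₂ n₀.adj₂.symm n₄.adj₁ h.nb.adj₃.symm h.nc₁.1)
    · rintro rfl
      exact h.nc.2.2.1 (hG.quad h.nc.adj₂ n₂.adj₁.symm n₄.adj₂ h.nc.adj₃.symm h.nc₂.2.1)
  have nz : IsNbrs G z w₁ w₃ w₅ := by
    refine hC.isNbrs n₁.adj₃.symm n₃.adj₃.symm n₅.adj₃.symm ?_ ?_ ?_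
    · rintro rfl
      exact h.nb.2.2.1 (hG.quad h.nb.adj₂ n₁.adj₁.symm n₃.adj₂ h.nb.adj₃.symm h.nc₁.2.1)
    · rintro rfl
      exact h.nc.2.2.1 (hG.quad h.nc.adj₂ n₁.adj₂.symm n₅.adj₁ h.nc.adj₃.symm h.nc₂.1)
    · rintro rfl
      exact h.na.2.2.1 (hG.quad h.na.adj₂ n₅.adj₂.symm n₃.adj₁ h.na.adj₃.symm h.nc₀.1)
  refine nonempty_iso_of_isNbrs hG hconn sigmaGraph_adj (.r 0, 1) (by decide +kernel)
    (fun w => match w with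
      | (.r j, k) => ![![v, c₂, c₁], ![z, c₄, c₅], ![y, c₀, c₃]] j k.toAdd
      | (.sr j, k) => ![![w₁, b, c], ![w₄, w₅, w₃], ![a, w₂, w₀]] j k.toAdd) ?_
  rintro ⟨j | j, k⟩ <;> fin_cases j <;> fin_cases k
  exacts [h.nv, h.nc₂.rotate.rotate, h.nc₁.rotate, nz.swap, h.nc₄, h.nc₅, ny.swap.rotate,
      h.nc₀.rotate, h.nc₃.rotate.rotate, n₁.swap.rotate, h.nb.swap.rotate, h.nc.rotate.rotate,
      n₄.rotate.rotate, n₅.rotate.swap, n₃.swap, h.na, n₂, n₀.rotate]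

end

end HexCount

/-- A finite connected simple cubic vertex-transitive graph of girth 6
with signature `(a, b, 4)` has `a = b = 4` and is isomorphic either to the Pappus
graph `Σ_3` or to the Desargues graph `GP(10, 3)`. -/
theorem cubic_vt_girth_six_signature_c_eq_four {V : Type*} [Fintype V] (Γ : SimpleGraph V)
    (hconn : Γ.Connected)
    (hcubic : ∀ v : V, (Γ.neighborSet v).ncard = 3)
    (hvt : ∀ u v : V, ∃ φ : Γ ≃g Γ, φ u = v)
    (hgirth : Γ.girth = 6)
    (a b : ℕ) (hab : a ≤ b) (hb : b ≤ 4)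
    (hsig : hasSignature Γ a b 4) :
    a = 4 ∧ b = 4 ∧
      (Nonempty (Γ ≃g sigmaGraph 3) ∨ Nonempty (Γ ≃g genPetersen 10 3)) := by
  classical
  have hG := HexCount.NoShortCycle.of_girth hgirth
  have := hconn.nonempty
  have hnbr := HexCount.exists_labelled_nbrs hG hsig
  have hC : HexCount.Cubic Γ := fun v => by
    obtain ⟨n₁, n₂, n₃, hn, -⟩ := hnbr v
    exact ⟨n₁, n₂, n₃, hn⟩
  have hcases : (a = 0 ∧ b = 4) ∨ (a = 1 ∧ b = 3) ∨ (a = 2 ∧ b = 2) ∨ (a = 2 ∧ b = 4) ∨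
      (a = 3 ∧ b = 3) ∨ (a = 4 ∧ b = 4) := by
    obtain ⟨v⟩ := hconn.nonempty
    obtain ⟨n₁, n₂, n₃, hn, h1, h2, h3⟩ := hnbr v
    obtain ⟨e1, e2, e3⟩ := HexCount.vertex_system hG hn
    omega
  have matched_three : ∀ {d : ℕ}, a = d → b = d → HexCount.IsMatched Γ 4 d := by
    intro d ha hb v
    obtain ⟨n₁, n₂, n₃, hn, h1, h2, h3⟩ := hnbr v
    exact ⟨n₃, n₁, n₂, hn.rotate.rotate, h3, h1.trans ha, h2.trans hb⟩
  have matched_one : b = 4 → HexCount.IsMatched Γ a 4 := by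
    intro hb v
    obtain ⟨n₁, n₂, n₃, hn, h1, h2, h3⟩ := hnbr v
    exact ⟨n₁, n₂, n₃, hn, h1, h2.trans hb, h3⟩
  rcases hcases with ⟨rfl, rfl⟩ | ⟨rfl, rfl⟩ | ⟨rfl, rfl⟩ | ⟨rfl, rfl⟩ | ⟨rfl, rfl⟩ | ⟨rfl, rfl⟩
  · exact absurd (matched_one rfl) (HexCount.not_isMatched_zero_four hG)
  · exact absurd hnbr (HexCount.not_signature_one_three hG)
  · exact absurd (matched_three rfl rfl) (HexCount.not_isMatched_four_two hG)
  · exact absurd (matched_one rfl) (HexCount.not_isMatched_two_four hG)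
  · exact absurd (matched_three rfl rfl) (HexCount.not_isMatched_four_three hG hvt)
  · have hT : HexCount.Tight Γ := HexCount.Tight.of_count₁ hG hC hvt fun v w h => by
      obtain ⟨n₁, n₂, n₃, hn, h1, h2, h3⟩ := hnbr v
      rcases hn.eq_or h with rfl | rfl | rfl
      exacts [h1, h2, h3]
    obtain ⟨v⟩ := hconn.nonempty
    refine ⟨rfl, rfl, ?_⟩
    rcases HexCount.exists_triangles_or_hexagon hG hC hT v with
      ⟨_, _, _, _, _, _, _, _, _, _, _, _, _, _, _, h⟩ |
      ⟨_, _, _, _, _, _, _, _, _, _, _, _, _, _, _, h⟩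
    · exact .inr (h.nonempty_iso hG hC hT hconn)
    · exact .inl (h.nonempty_iso hG hC hT hconn)
end

section
/- Let Γ be a finite connected simple cubic vertex-transitive graph of girth 6 with signature (a, b, c) where c = 3. Then a = 2, b = 3, and Γ is isomorphic to Δ_n = Cay(D_{3n}, {τ_0, τ_k, τ_n}) (with k = 3/gcd(3, n)) or to Σ_n = Cay(D_n × Z_3, {(τ_1, 0), (τ_0, 1), (τ_0, 2)}) for some integer n ≥ 4. -/
/-- The graph `Δ_n = Cay(D_{3n}, {τ_0, τ_k, τ_n})`, where `k = 3 / gcd(3, n)`. -/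
def deltaGraph (n : ℕ) : SimpleGraph (DihedralGroup (3 * n)) :=
  cayley ({dihTau 0, dihTau (3 / Nat.gcd 3 n), dihTau n} : Set (DihedralGroup (3 * n)))

namespace GirthSix

variable {V : Type*} {Γ : SimpleGraph V}

/-- A non-backtracking closed walk of length six, given by its consecutive vertices. In a graph
of girth six this is the same as a traversed 6-cycle. -/
structure IsHexagon (Γ : SimpleGraph V) (a b c d e f : V) : Prop where
  ab : Γ.Adj a b
  bc : Γ.Adj b c
  cd : Γ.Adj c d
  de : Γ.Adj d e
  ef : Γ.Adj e f
  fa : Γ.Adj f a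
  ac : a ≠ c
  bd : b ≠ d
  ce : c ≠ e
  df : d ≠ f
  ea : e ≠ a
  fb : f ≠ b

theorem IsHexagon.rotate {a b c d e f : V} (h : IsHexagon Γ a b c d e f) :
    IsHexagon Γ b c d e f a :=
  ⟨h.bc, h.cd, h.de, h.ef, h.fa, h.ab, h.bd, h.ce, h.df, h.ea, h.fb, h.ac⟩

theorem IsHexagon.reverse {a b c d e f : V} (h : IsHexagon Γ a b c d e f) :
    IsHexagon Γ f e d c b a :=
  ⟨h.ef.symm, h.de.symm, h.cd.symm, h.bc.symm, h.ab.symm, h.fa.symm,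
    h.df.symm, h.ce.symm, h.bd.symm, h.ac.symm, h.fb.symm, h.ea.symm⟩

theorem IsHexagon.map (φ : Γ ≃g Γ) {a b c d e f : V} (h : IsHexagon Γ a b c d e f) :
    IsHexagon Γ (φ a) (φ b) (φ c) (φ d) (φ e) (φ f) :=
  ⟨φ.map_adj_iff.2 h.ab, φ.map_adj_iff.2 h.bc, φ.map_adj_iff.2 h.cd, φ.map_adj_iff.2 h.de,
    φ.map_adj_iff.2 h.ef, φ.map_adj_iff.2 h.fa, φ.injective.ne h.ac, φ.injective.ne h.bd,
    φ.injective.ne h.ce, φ.injective.ne h.df, φ.injective.ne h.ea, φ.injective.ne h.fb⟩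

theorem no_triangle (hg : Γ.girth = 6) {a b c : V} (hab : Γ.Adj a b) (hbc : Γ.Adj b c)
    (hca : Γ.Adj c a) : False := by
  have h : (SimpleGraph.Walk.cons hab (.cons hbc (.cons hca .nil))).IsCycle := by
    simp [SimpleGraph.Walk.cons_isCycle_iff, hab.ne', hbc.ne, hca.ne, hab.ne, hca.ne']
  have := SimpleGraph.girth_le_length h
  simp [hg] at this

theorem no_square (hg : Γ.girth = 6) {a b c d : V} (hab : Γ.Adj a b) (hbc : Γ.Adj b c)
    (hcd : Γ.Adj c d) (hda : Γ.Adj d a) (hac : a ≠ c) (hbd : b ≠ d) : False := by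
  have h : (SimpleGraph.Walk.cons hab (.cons hbc (.cons hcd (.cons hda .nil)))).IsCycle := by
    simp [SimpleGraph.Walk.cons_isCycle_iff, hab.ne', hbc.ne, hcd.ne, hab.ne, hac, hac.symm, hbd,
      hda.ne, hda.ne']
  have := SimpleGraph.girth_le_length h
  simp [hg] at this

theorem IsHexagon.ad (hg : Γ.girth = 6) {a b c d e f : V} (h : IsHexagon Γ a b c d e f) :
    a ≠ d := by
  rintro rfl
  exact no_triangle hg h.ab h.bc h.cd

theorem sixCycleCount_eq_ncard_hexagon (hg : Γ.girth = 6) {u v : V} :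
    sixCycleCount Γ s(u, v) = {p : V × V × V × V |
      IsHexagon Γ u v p.1 p.2.1 p.2.2.1 p.2.2.2}.ncard := by
  symm
  refine Set.ncard_congr (fun p _ ↦ {e' | e' ∈
    [s(u, v), s(v, p.1), s(p.1, p.2.1), s(p.2.1, p.2.2.1), s(p.2.2.1, p.2.2.2), s(p.2.2.2, u)]})
    ?_ ?_ ?_
  · rintro ⟨c, d, e, f⟩ h
    have h : IsHexagon Γ u v c d e f := h
    refine ⟨⟨u, .cons h.ab (.cons h.bc (.cons h.cd (.cons h.de (.cons h.ef (.cons h.fa .nil))))),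
      ?_, rfl, by simp⟩, by simp⟩
    have h1 := h.ad hg
    have h2 := h.rotate.ad hg
    have h3 := h.rotate.rotate.ad hg
    obtain ⟨ab, bc, cd, de, ef, fa, ac, bd, ce, df, ea, fb⟩ := h
    simp [SimpleGraph.Walk.cons_isCycle_iff, ab.ne, bc.ne, cd.ne, de.ne, ef.ne, fa.ne,
      ab.ne', fa.ne', ac, bd, ce, df, ea, ac.symm, ea.symm, fb.symm, h1, h2, h3, h1.symm]
  · rintro ⟨c, d, e, f⟩ ⟨c', d', e', f'⟩ h h' heq
    have h : IsHexagon Γ u v c d e f := h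
    have h' : IsHexagon Γ u v c' d' e' f' := h'
    have h1 := h.ad hg
    have h2 := h.rotate.ad hg
    have h3 := h.rotate.rotate.ad hg
    have h1' := h'.ad hg
    have h2' := h'.rotate.ad hg
    have h3' := h'.rotate.rotate.ad hg
    obtain ⟨ab, bc, cd, de, ef, fa, ac, bd, ce, df, ea, fb⟩ := h
    obtain ⟨ab', bc', cd', de', ef', fa', ac', bd', ce', df', ea', fb'⟩ := h'
    have hmem : ∀ x y : V, s(x, y) ∈ [s(u, v), s(v, c), s(c, d), s(d, e), s(e, f), s(f, u)] ↔
      s(x, y) ∈ [s(u, v), s(v, c'), s(c', d'), s(d', e'), s(e', f'), s(f', u)] :=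
      fun x y ↦ Set.ext_iff.1 heq s(x, y)
    have ab := ab.ne
    have bc := bc.ne
    have cd := cd.ne
    have de := de.ne
    have ef := ef.ne
    have fa := fa.ne
    have ab' := ab'.ne
    have bc' := bc'.ne
    have cd' := cd'.ne
    have de' := de'.ne
    have ef' := ef'.ne
    have fa' := fa'.ne
    simp only [List.mem_cons, Sym2.eq_iff, List.not_mem_nil, or_false] at hmem
    have e1 : c = c' := by
      have := (hmem v c).1 (by simp)
      grind
    subst e1
    have e2 : d = d' := by
      have := (hmem c d).1 (by simp)
      grind
    subst e2
    have e3 : e = e' := by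
      have := (hmem d e).1 (by simp)
      grind
    subst e3
    have e4 : f = f' := by
      have := (hmem e f).1 (by simp)
      grind
    subst e4
    rfl
  · rintro s ⟨⟨x, w, hw, hl, rfl⟩, hs⟩
    have hs : s(u, v) ∈ w.edges := hs
    classical
    have hu := w.fst_mem_support_of_mem_edges hs
    have hw' := hw.rotate hu
    have hl' : (w.rotate u hu).length = 6 := by simpa using hl
    have he : ∀ z, z ∈ w.edges ↔ z ∈ (w.rotate u hu).edges :=
      fun z ↦ ((w.rotate_edges u hu).perm.mem_iff).symm
    have hset : {z | z ∈ w.edges} = {z | z ∈ (w.rotate u hu).edges} := Set.ext he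
    rw [hset]
    rw [he] at hs
    generalize w.rotate u hu = w' at *
    match w', hl', hw', hs with
    | .cons (v := b) h1 (.cons (v := c) h2 (.cons (v := d) h3 (.cons (v := e) h4
        (.cons (v := f) h5 (.cons h6 .nil))))), _, hw', hs =>
      have hn := hw'.support_nodup
      simp only [SimpleGraph.Walk.support_cons, SimpleGraph.Walk.support_nil, List.tail_cons,
        List.nodup_cons, List.mem_cons, List.not_mem_nil, or_false, not_or, List.nodup_nil,
        not_false_eq_true, and_true] at hn
      have hor : v = b ∨ v = f := by
        simp only [SimpleGraph.Walk.edges_cons, SimpleGraph.Walk.edges_nil, List.mem_cons,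
          List.not_mem_nil, or_false, Sym2.eq_iff] at hs
        grind
      rcases hor with rfl | rfl
      · refine ⟨(c, d, e, f), ?_, ?_⟩
        · constructor <;> first | assumption | grind
        · simp
      · refine ⟨(e, d, c, b), ?_, ?_⟩
        · constructor <;> first | assumption | (apply SimpleGraph.Adj.symm; assumption) | grind
        · ext z
          simp only [List.mem_cons, List.not_mem_nil, or_false, Set.mem_ofPred_eq,
            SimpleGraph.Walk.edges_cons, SimpleGraph.Walk.edges_nil]
          rw [Sym2.eq_swap (a := u) (b := v), Sym2.eq_swap (a := v) (b := e),
            Sym2.eq_swap (a := e) (b := d), Sym2.eq_swap (a := d) (b := c),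
            Sym2.eq_swap (a := c) (b := b), Sym2.eq_swap (a := b) (b := u)]
          tauto

/-- The number of hexagons through the 2-path `u, v, w`. -/
noncomputable def cornerCount (Γ : SimpleGraph V) (u v w : V) : ℕ :=
  {p : V × V × V | IsHexagon Γ u v w p.1 p.2.1 p.2.2}.ncard

theorem cornerCount_comm (u v w : V) : cornerCount Γ u v w = cornerCount Γ w v u := by
  refine Set.ncard_congr (fun p _ ↦ (p.2.2, p.2.1, p.1)) ?_ ?_ ?_
  · rintro ⟨d, e, f⟩ h
    exact (h.rotate.rotate.rotate).reverse
  · rintro ⟨d, e, f⟩ ⟨d', e', f'⟩ _ _ h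
    simp_all
  · rintro ⟨d, e, f⟩ h
    exact ⟨(f, e, d), (h.rotate.rotate.rotate).reverse, rfl⟩

theorem sixCycleCount_eq_add_cornerCount [Finite V] (hg : Γ.girth = 6) {u v y z : V}
    (hyz : y ≠ z) (huy : u ≠ y) (huz : u ≠ z)
    (hN : ∀ x, Γ.Adj v x ↔ x = u ∨ x = y ∨ x = z) :
    sixCycleCount Γ s(v, u) = cornerCount Γ u v y + cornerCount Γ u v z := by
  have himg : ∀ w, cornerCount Γ u v w = ((fun p : V × V × V ↦ (w, p.1, p.2.1, p.2.2)) ''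
      {p : V × V × V | IsHexagon Γ u v w p.1 p.2.1 p.2.2}).ncard := fun w ↦
    (Set.ncard_image_of_injective _ (by rintro ⟨a, b, c⟩ ⟨a', b', c'⟩ h; simpa using h)).symm
  rw [Sym2.eq_swap, sixCycleCount_eq_ncard_hexagon hg, himg, himg,
    ← Set.ncard_union_eq _ (Set.toFinite _) (Set.toFinite _)]
  · congr 1
    ext ⟨c, d, e, f⟩
    simp only [Set.mem_ofPred_eq, Set.mem_union, Set.mem_image, Prod.mk.injEq, Prod.exists]
    constructor
    · intro h
      rcases (hN c).1 h.bc with rfl | rfl | rfl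
      · exact absurd rfl h.ac
      · exact .inl ⟨d, e, f, h, rfl, rfl, rfl, rfl⟩
      · exact .inr ⟨d, e, f, h, rfl, rfl, rfl, rfl⟩
    · rintro (⟨d, e, f, h, rfl, rfl, rfl, rfl⟩ | ⟨d, e, f, h, rfl, rfl, rfl, rfl⟩) <;> exact h
  · rw [Set.disjoint_left]
    rintro _ ⟨p, _, rfl⟩ ⟨q, _, h⟩
    exact hyz (by simpa using (congrArg Prod.fst h).symm)

theorem sixCycleCount_map (hg : Γ.girth = 6) (φ : Γ ≃g Γ) (u v : V) :
    sixCycleCount Γ s(φ u, φ v) = sixCycleCount Γ s(u, v) := by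
  rw [sixCycleCount_eq_ncard_hexagon hg, sixCycleCount_eq_ncard_hexagon hg]
  refine Set.ncard_congr
    (fun p _ ↦ (φ.symm p.1, φ.symm p.2.1, φ.symm p.2.2.1, φ.symm p.2.2.2)) ?_ ?_ ?_
  · rintro ⟨c, d, e, f⟩ h
    have := IsHexagon.map φ.symm h
    simpa using this
  · rintro ⟨c, d, e, f⟩ ⟨c', d', e', f'⟩ _ _ h
    simpa using h
  · rintro ⟨c, d, e, f⟩ h
    exact ⟨(φ c, φ d, φ e, φ f), IsHexagon.map φ h, by simp⟩

theorem exists_labelling [Finite V] (hg : Γ.girth = 6) {a b c : ℕ} (hsig : hasSignature Γ a b c)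
    (v : V) : ∃ x y z, x ≠ y ∧ x ≠ z ∧ y ≠ z ∧ (∀ w, Γ.Adj v w ↔ w = x ∨ w = y ∨ w = z) ∧
      sixCycleCount Γ s(v, x) = a ∧ sixCycleCount Γ s(v, y) = b ∧ sixCycleCount Γ s(v, z) = c ∧
      a = cornerCount Γ x v y + cornerCount Γ x v z ∧
      b = cornerCount Γ x v y + cornerCount Γ y v z ∧
      c = cornerCount Γ x v z + cornerCount Γ y v z := by
  obtain ⟨e₁, e₂, e₃, h12, h13, h23, hinc, h1, h2, h3⟩ := hsig v
  have key : ∀ e ∈ Γ.incidenceSet v, ∃ x, e = s(v, x) := fun e he ↦ by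
    obtain ⟨x, hx⟩ := Sym2.mem_iff_exists.1 he.2
    exact ⟨x, hx⟩
  obtain ⟨x, rfl⟩ := key e₁ (by simp [hinc])
  obtain ⟨y, rfl⟩ := key e₂ (by simp [hinc])
  obtain ⟨z, rfl⟩ := key e₃ (by simp [hinc])
  have hxy : x ≠ y := fun h ↦ h12 (by rw [h])
  have hxz : x ≠ z := fun h ↦ h13 (by rw [h])
  have hyz : y ≠ z := fun h ↦ h23 (by rw [h])
  have hN : ∀ w, Γ.Adj v w ↔ w = x ∨ w = y ∨ w = z := fun w ↦ by
    rw [← SimpleGraph.mem_incidenceSet, hinc]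
    simp only [Set.mem_insert_iff, Set.mem_singleton_iff, Sym2.eq_iff]
    grind
  refine ⟨x, y, z, hxy, hxz, hyz, hN, h1, h2, h3, ?_, ?_, ?_⟩
  · rw [← h1, sixCycleCount_eq_add_cornerCount hg hyz hxy hxz hN]
  · rw [← h2, sixCycleCount_eq_add_cornerCount hg hxz hxy.symm hyz
      (fun w ↦ by rw [hN]; tauto), cornerCount_comm]
  · rw [← h3, sixCycleCount_eq_add_cornerCount hg hxy hxz.symm hyz.symm
      (fun w ↦ by rw [hN]; tauto), cornerCount_comm, cornerCount_comm z]

theorem exists_matching (hg : Γ.girth = 6) (t : ℕ)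
    (h : ∀ v, ∃! w, Γ.Adj v w ∧ sixCycleCount Γ s(v, w) = t) :
    ∃ M : V → V, (∀ v, Γ.Adj v (M v)) ∧ (∀ v, sixCycleCount Γ s(v, M v) = t) ∧
      (∀ v, M (M v) = v) ∧ (∀ (φ : Γ ≃g Γ) v, φ (M v) = M (φ v)) ∧
      ∀ v w, Γ.Adj v w → sixCycleCount Γ s(v, w) = t → w = M v := by
  choose M hM hu using h
  refine ⟨M, fun v ↦ (hM v).1, fun v ↦ (hM v).2, fun v ↦ ?_, fun φ v ↦ ?_,
    fun v w h1 h2 ↦ hu v w ⟨h1, h2⟩⟩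
  · exact (hu (M v) v ⟨(hM v).1.symm, by rw [Sym2.eq_swap]; exact (hM v).2⟩).symm
  · exact hu (φ v) (φ (M v)) ⟨φ.map_adj_iff.2 (hM v).1,
      by rw [sixCycleCount_map hg]; exact (hM v).2⟩

theorem not_isHexagon_of_cornerCount_eq_zero [Finite V] {u v w d e f : V}
    (h : cornerCount Γ u v w = 0) : ¬ IsHexagon Γ u v w d e f := fun hh ↦ by
  rw [cornerCount, Set.ncard_eq_zero (Set.toFinite _)] at h
  exact (Set.eq_empty_iff_forall_notMem.1 h (d, e, f)) hh

theorem exists_of_cornerCount_eq_one {u v w : V} (h : cornerCount Γ u v w = 1) :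
    (∃ d e f, IsHexagon Γ u v w d e f) ∧ ∀ {d e f d' e' f'}, IsHexagon Γ u v w d e f →
      IsHexagon Γ u v w d' e' f' → d = d' ∧ e = e' ∧ f = f' := by
  obtain ⟨⟨d, e, f⟩, hs⟩ := Set.ncard_eq_one.1 h
  have key : ∀ p : V × V × V, IsHexagon Γ u v w p.1 p.2.1 p.2.2 ↔ p = (d, e, f) :=
    Set.ext_iff.1 hs
  refine ⟨⟨d, e, f, (key (d, e, f)).2 rfl⟩, fun {d₁ e₁ f₁ d₂ e₂ f₂} h₁ h₂ ↦ ?_⟩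
  have := ((key (d₁, e₁, f₁)).1 h₁).trans ((key (d₂, e₂, f₂)).1 h₂).symm
  simpa using this

theorem exists_ne_of_one_lt_cornerCount [Finite V] {u v w : V} (h : 1 < cornerCount Γ u v w)
    (p : V × V × V) : ∃ d e f, IsHexagon Γ u v w d e f ∧ (d, e, f) ≠ p := by
  obtain ⟨⟨d, e, f⟩, h1, h2⟩ := Set.exists_ne_of_one_lt_ncard h p
  exact ⟨d, e, f, h1, h2⟩

theorem signature_ne_one_two_three [Finite V] [Nonempty V] (hg : Γ.girth = 6)
    (hvt : ∀ u v : V, ∃ φ : Γ ≃g Γ, φ u = v) (hsig : hasSignature Γ 1 2 3) : False := by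
  have hl := exists_labelling hg hsig
  obtain ⟨P, hPa, hPt, hPP, hPφ, hPu⟩ := exists_matching hg 1 (fun v ↦ by
    obtain ⟨x, y, z, -, -, -, hN, h1, h2, h3, -⟩ := hl v
    exact ⟨x, ⟨(hN x).2 (by simp), h1⟩, by rintro w ⟨hw, h⟩; grind⟩)
  obtain ⟨Q, hQa, hQt, hQQ, hQφ, hQu⟩ := exists_matching hg 2 (fun v ↦ by
    obtain ⟨x, y, z, -, -, -, hN, h1, h2, h3, -⟩ := hl v
    exact ⟨y, ⟨(hN y).2 (by simp), h2⟩, by rintro w ⟨hw, h⟩; grind⟩)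
  obtain ⟨R, hRa, hRt, hRR, hRφ, hRu⟩ := exists_matching hg 3 (fun v ↦ by
    obtain ⟨x, y, z, -, -, -, hN, h1, h2, h3, -⟩ := hl v
    exact ⟨z, ⟨(hN z).2 (by simp), h3⟩, by rintro w ⟨hw, h⟩; grind⟩)
  have hloc : ∀ v, P v ≠ Q v ∧ P v ≠ R v ∧ Q v ≠ R v ∧
      (∀ w, Γ.Adj v w ↔ w = P v ∨ w = Q v ∨ w = R v) ∧ cornerCount Γ (P v) v (Q v) = 0 ∧
      cornerCount Γ (P v) v (R v) = 1 ∧ cornerCount Γ (Q v) v (R v) = 2 := fun v ↦ by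
    obtain ⟨x, y, z, hxy, hxz, hyz, hN, h1, h2, h3, h4, h5, h6⟩ := hl v
    obtain rfl := hPu v x ((hN x).2 (by simp)) h1
    obtain rfl := hQu v y ((hN y).2 (by simp)) h2
    obtain rfl := hRu v z ((hN z).2 (by simp)) h3
    exact ⟨hxy, hxz, hyz, hN, by omega, by omega, by omega⟩
  have hPQ := fun v ↦ (hloc v).1
  have hPR := fun v ↦ (hloc v).2.1
  have hQR := fun v ↦ (hloc v).2.2.1
  have hN := fun v ↦ (hloc v).2.2.2.1
  have no : ∀ {v d e f}, ¬ IsHexagon Γ (P v) v (Q v) d e f :=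
    fun {v d e f} ↦ not_isHexagon_of_cornerCount_eq_zero (hloc v).2.2.2.2.1
  have no' : ∀ {v d e f}, ¬ IsHexagon Γ (Q v) v (P v) d e f :=
    fun {v d e f} h ↦ no h.rotate.rotate.rotate.reverse
  have uni := fun v ↦ exists_of_cornerCount_eq_one (hloc v).2.2.2.2.2.1
  -- a step along a hexagon after an edge of type `P` or `Q` is along `R`
  have stepP : ∀ {u d e f g}, IsHexagon Γ (P u) u d e f g → d = R u := by
    intro u d e f g h
    rcases (hN u d).1 h.bc with rfl | rfl | rfl
    · exact absurd rfl h.ac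
    · exact absurd h no
    · rfl
  have stepQ : ∀ {u d e f g}, IsHexagon Γ (Q u) u d e f g → d = R u := by
    intro u d e f g h
    rcases (hN u d).1 h.bc with rfl | rfl | rfl
    · exact absurd h no'
    · exact absurd rfl h.ac
    · rfl
  have form : ∀ {v d e f}, IsHexagon Γ (P v) v (R v) d e f → (d = P (R v) ∨ d = Q (R v)) ∧
      e = R d ∧ f = R (P v) ∧ (f = P e ∨ f = Q e) := by
    intro v d e f h
    have hd : d = P (R v) ∨ d = Q (R v) := by
      rcases (hN _ d).1 h.cd with rfl | rfl | rfl
      · simp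
      · simp
      · exact absurd (hRR v).symm h.bd
    have he : e = R d := by
      rcases hd with rfl | rfl
      · exact stepP (by simpa only [hPP] using h.rotate.rotate)
      · exact stepQ (by simpa only [hQQ] using h.rotate.rotate)
    refine ⟨hd, he, ?_, ?_⟩
    · exact stepP (by simpa only [hPP] using h.reverse.rotate.rotate.rotate.rotate)
    · have := h.df
      rcases (hN _ f).1 h.ef with h1 | h1 | h1
      · simp [h1]
      · simp [h1]
      · exact absurd (by rw [h1, he, hRR]) this
  by_cases hE : ∃ v e f, IsHexagon Γ (P v) v (R v) (P (R v)) e f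
  · have hE' : ∀ v, ∃ e f, IsHexagon Γ (P v) v (R v) (P (R v)) e f := fun v ↦ by
      obtain ⟨w, e, f, h⟩ := hE
      obtain ⟨φ, rfl⟩ := hvt w v
      exact ⟨φ e, φ f, by simpa only [hPφ, hRφ] using h.map φ⟩
    have rel : ∀ v, R (P v) = P (R (P (R v))) := fun v ↦ by
      obtain ⟨e, f, h⟩ := hE' v
      obtain ⟨-, rfl, rfl, h1 | h1⟩ := form h
      · exact h1
      · obtain ⟨e', f', h'⟩ := hE' (P v)
        rw [hPP] at h'
        have h2 := h.reverse.rotate.rotate.rotate.rotate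
        have := ((exists_of_cornerCount_eq_one
          (by simpa only [hPP] using (hloc (P v)).2.2.2.2.2.1)).2 h' h2).1
        rw [← this, hPP]
    obtain ⟨v⟩ := ‹Nonempty V›
    have uniq : ∀ {d e f}, IsHexagon Γ (Q v) v (R v) d e f →
        (d, e, f) = (Q (R v), R (Q (R v)), R (Q v)) := by
      intro d e f h
      have hf : f = R (Q v) :=
        stepQ (by simpa only [hQQ] using h.reverse.rotate.rotate.rotate.rotate)
      rcases (hN _ d).1 h.cd with rfl | rfl | rfl
      · have h1 := h.rotate.rotate
        have he := stepP (u := P (R v)) (by simpa only [hPP] using h1)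
        obtain ⟨e', f', h2⟩ := hE' (P (R v))
        rw [he] at h1
        obtain ⟨-, -, h3, h4⟩ := form (v := P (R v)) (by simpa only [hPP] using h1)
        have h5 := ((uni (P (R v))).2 (by simpa only [hPP] using h1) h2).1
        have h6 := form h2
        have h7 := form (v := P (R v)) (by simpa only [hPP] using h1)
        have h8 := rel (P (R v))
        have h9 := hPQ v
        simp only [hPP, hRR] at h8
        grind
      · have he := stepQ (u := Q (R v)) (by simpa only [hQQ] using h.rotate.rotate)
        rw [he, hf]
      · exact absurd (hRR v).symm h.bd
    obtain ⟨d, e, f, h1, h2⟩ := exists_ne_of_one_lt_cornerCount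
      (by rw [(hloc v).2.2.2.2.2.2]; norm_num) (Q (R v), R (Q (R v)), R (Q v))
    exact h2 (uniq h1)
  · push Not at hE
    have hF : ∀ v, ∃ e f, IsHexagon Γ (P v) v (R v) (Q (R v)) e f := fun v ↦ by
      obtain ⟨d, e, f, h⟩ := (uni v).1
      rcases (form h).1 with rfl | rfl
      · exact absurd h (hE _ _ _)
      · exact ⟨e, f, h⟩
    have rel : ∀ v, P v = R (Q (R (Q (R v)))) := fun v ↦ by
      obtain ⟨e, f, h⟩ := hF v
      obtain ⟨-, rfl, rfl, h1 | h1⟩ := form h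
      · have h2 := h.reverse.rotate.rotate.rotate.rotate
        have h3 : R (Q (R v)) = P (R (P v)) := by rw [h1, hPP]
        rw [h3] at h2
        exact absurd (by simpa only [hPP] using h2) (hE (P v) _ _)
      · rw [← h1, hRR]
    obtain ⟨v⟩ := ‹Nonempty V›
    refine no' (v := Q (R v)) (d := R (P (Q (R v)))) (e := Q (R (P (Q (R v))))) (f := v) ?_
    have hc : P (Q (R (P (Q (R v))))) = v := by simp only [rel, hQQ, hRR]
    have hne : ∀ {T S : V → V}, (∀ u, S (S u) = u) → (∀ u, T u ≠ S u) → ∀ u, u ≠ T (S u) :=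
      fun {T S} hS h u hu ↦ h (S u) (by rw [hS]; exact hu.symm)
    have hc' : Q (R (P (Q (R v)))) = P v := by rw [← hPP (Q (R (P (Q (R v))))), hc]
    rw [hQQ]
    refine ⟨hQa _, hPa _, hRa _, hQa _, hc'.symm ▸ (hPa v).symm, hRa v, ?_, ?_, ?_, ?_, ?_, ?_⟩
    · simpa only [hQQ] using hne hQQ hPQ (R v)
    · exact hne hPP (fun u ↦ (hPR u).symm) _
    · exact hne hRR hQR _
    · intro h
      exact hPQ _ (by rw [hc, h, hQQ])
    · rw [hc']; exact hPR v
    · simpa using hne hRR hQR v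

/-- Adjacency along the edges outside the perfect matching `M`. -/
def NAdj (Γ : SimpleGraph V) (M : V → V) (u v : V) : Prop := Γ.Adj u v ∧ v ≠ M u

/-- A vertex-transitive cubic graph of girth six together with an automorphism-invariant perfect
matching `M`. The remaining edges form a 2-factor. -/
structure Marking (Γ : SimpleGraph V) (M : V → V) : Prop where
  girth : Γ.girth = 6
  trans : ∀ u v : V, ∃ φ : Γ ≃g Γ, φ u = v
  adj : ∀ v, Γ.Adj v (M v)
  invol : ∀ v, M (M v) = v
  comm : ∀ (φ : Γ ≃g Γ) v, φ (M v) = M (φ v)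
  exists_two : ∀ v, ∃ f g, f ≠ g ∧ NAdj Γ M v f ∧ NAdj Γ M v g ∧ ∀ w, NAdj Γ M v w → w = f ∨ w = g

theorem exists_marking [Finite V] (hg : Γ.girth = 6)
    (hvt : ∀ u v : V, ∃ φ : Γ ≃g Γ, φ u = v) {p : ℕ} (hp : p < 2)
    (hsig : hasSignature Γ (2 * p) 3 3) : ∃ M : V → V, Marking Γ M ∧
      (∀ v f, NAdj Γ M v f → cornerCount Γ (M v) v f = p) ∧
      ∀ a b c, NAdj Γ M a b → NAdj Γ M b c → a ≠ c → 1 < cornerCount Γ a b c := by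
  have hl := exists_labelling hg hsig
  obtain ⟨M, hMa, hMt, hMM, hMφ, hMu⟩ := exists_matching hg (2 * p) (fun v ↦ by
    obtain ⟨x, y, z, -, -, -, hN, h1, h2, h3, -⟩ := hl v
    exact ⟨x, ⟨(hN x).2 (by simp), h1⟩, by rintro w ⟨hw, h⟩; grind⟩)
  have hloc : ∀ v, ∃ f g, f ≠ g ∧ f ≠ M v ∧ g ≠ M v ∧
      (∀ w, Γ.Adj v w ↔ w = M v ∨ w = f ∨ w = g) ∧
      cornerCount Γ (M v) v f = p ∧ cornerCount Γ (M v) v g = p ∧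
      cornerCount Γ f v g = 3 - p ∧ cornerCount Γ g v f = 3 - p := fun v ↦ by
    obtain ⟨x, y, z, hxy, hxz, hyz, hN, h1, h2, h3, h4, h5, h6⟩ := hl v
    obtain rfl := hMu v x ((hN x).2 (by simp)) h1
    exact ⟨y, z, hyz, hxy.symm, hxz.symm, hN, by omega, by omega, by omega,
      by rw [cornerCount_comm]; omega⟩
  refine ⟨M, ⟨hg, hvt, hMa, hMM, hMφ, fun v ↦ ?_⟩, fun v w hw ↦ ?_, fun a b c hab hbc hac ↦ ?_⟩
  · obtain ⟨f, g, hfg, hf, hg, hN, -⟩ := hloc v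
    exact ⟨f, g, hfg, ⟨(hN f).2 (by simp), hf⟩, ⟨(hN g).2 (by simp), hg⟩,
      fun w hw ↦ ((hN w).1 hw.1).resolve_left hw.2⟩
  · obtain ⟨f, g, hfg, hf, hg, hN, h1, h2, -⟩ := hloc v
    rcases ((hN w).1 hw.1).resolve_left hw.2 with rfl | rfl <;> assumption
  · obtain ⟨f, g, hfg, hf, hg, hN, -, -, h1, h2⟩ := hloc b
    have ha : a ≠ M b := fun h ↦ hab.2 (by rw [h, hMM])
    rcases ((hN a).1 hab.1.symm).resolve_left ha with rfl | rfl <;>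
    rcases ((hN c).1 hbc.1).resolve_left hbc.2 with rfl | rfl
    · exact absurd rfl hac
    · omega
    · omega
    · exact absurd rfl hac

namespace Marking

variable {M : V → V}

theorem symm (H : Marking Γ M) {u v : V} (h : NAdj Γ M u v) : NAdj Γ M v u :=
  ⟨h.1.symm, fun h' ↦ h.2 (by rw [h', H.invol])⟩

theorem exists_next (H : Marking Γ M) {a b : V} (_ : NAdj Γ M a b) :
    ∃ c, NAdj Γ M b c ∧ a ≠ c := by
  obtain ⟨f, g, hfg, hf, hg, -⟩ := H.exists_two b
  by_cases h1 : a = f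
  · exact ⟨g, hg, h1 ▸ hfg⟩
  · exact ⟨f, hf, h1⟩

theorem next_unique (H : Marking Γ M) {a b c c' : V} (h : NAdj Γ M a b) (hc : NAdj Γ M b c)
    (hc' : NAdj Γ M b c') (hac : a ≠ c) (hac' : a ≠ c') : c = c' := by
  obtain ⟨f, g, hfg, hf, hg, hu⟩ := H.exists_two b
  have := hu a (H.symm h)
  have := hu c hc
  have := hu c' hc'
  grind

theorem map (H : Marking Γ M) (φ : Γ ≃g Γ) {u v : V} (h : NAdj Γ M u v) :
    NAdj Γ M (φ u) (φ v) :=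
  ⟨φ.map_adj_iff.2 h.1, fun h' ↦ h.2 (φ.injective (by rw [h', H.comm]))⟩

theorem nadj_or (_ : Marking Γ M) {u v : V} (h : Γ.Adj u v) : v = M u ∨ NAdj Γ M u v := by
  by_cases h' : v = M u
  · exact .inl h'
  · exact .inr ⟨h, h'⟩

/-- Continuing a hexagon after an edge `u, M u`. -/
theorem nadj_of_match (_ : Marking Γ M) {u c d e f : V} (h : IsHexagon Γ (M u) u c d e f) :
    NAdj Γ M u c := ⟨h.bc, h.ac.symm⟩

theorem cornerCount_ne_zero [Finite V] [Nonempty V] (H : Marking Γ M)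
    (hM : ∀ v f, NAdj Γ M v f → cornerCount Γ (M v) v f = 0)
    (hN : ∀ a b c, NAdj Γ M a b → NAdj Γ M b c → a ≠ c → 1 < cornerCount Γ a b c) : False := by
  obtain ⟨v⟩ := ‹Nonempty V›
  have no : ∀ {v f d e g}, ¬ IsHexagon Γ (M v) v f d e g := fun {v f d e g} h ↦
    not_isHexagon_of_cornerCount_eq_zero (hM _ _ (H.nadj_of_match h)) h
  have all : ∀ {a b c d e f}, IsHexagon Γ a b c d e f → NAdj Γ M a b := fun h ↦
    ⟨h.ab, by rintro rfl; exact no h.reverse.rotate.rotate.rotate.rotate⟩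
  obtain ⟨f, -, -, hf, -, -⟩ := H.exists_two v
  obtain ⟨c, hc, hvc⟩ := H.exists_next hf
  obtain ⟨d₁, e₁, g₁, h₁, -⟩ := exists_ne_of_one_lt_cornerCount (hN _ _ _ hf hc hvc) (v, v, v)
  obtain ⟨d₂, e₂, g₂, h₂, hne⟩ := exists_ne_of_one_lt_cornerCount (hN _ _ _ hf hc hvc) (d₁, e₁, g₁)
  apply hne
  obtain rfl := H.next_unique hc (all h₁.rotate.rotate) (all h₂.rotate.rotate) h₁.bd h₂.bd
  obtain rfl := H.next_unique (all h₁.rotate.rotate) (all h₁.rotate.rotate.rotate)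
    (all h₂.rotate.rotate.rotate) h₁.ce h₂.ce
  obtain rfl := H.next_unique (all h₁.rotate.rotate.rotate) (all h₁.rotate.rotate.rotate.rotate)
    (all h₂.rotate.rotate.rotate.rotate) h₁.df h₂.df
  rfl

/-- The hexagon through `M v, v, f` leaves the 2-factor after one edge. -/
def RunOne (Γ : SimpleGraph V) (M : V → V) (v f : V) : Prop :=
  ∃ d e, IsHexagon Γ (M v) v f (M f) d e

/-- The hexagon through `M v, v, f` leaves the 2-factor after two edges. -/
def RunTwo (Γ : SimpleGraph V) (M : V → V) (v f : V) : Prop :=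
  ∃ c e, NAdj Γ M f c ∧ IsHexagon Γ (M v) v f c (M c) e

/-- The hexagon through `M v, v, f` leaves the 2-factor after three edges. -/
def RunThree (Γ : SimpleGraph V) (M : V → V) (v f : V) : Prop :=
  ∃ c d, NAdj Γ M f c ∧ NAdj Γ M c d ∧ IsHexagon Γ (M v) v f c d (M d)

/-- The hexagon through `M v, v, f` has five consecutive edges in the 2-factor. -/
def RunFive (Γ : SimpleGraph V) (M : V → V) (v f : V) : Prop :=
  ∃ c d e, NAdj Γ M f c ∧ NAdj Γ M c d ∧ NAdj Γ M d e ∧ NAdj Γ M e (M v) ∧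
    IsHexagon Γ (M v) v f c d e

theorem runOne_map (H : Marking Γ M) (φ : Γ ≃g Γ) {v f : V} :
    RunOne Γ M v f → RunOne Γ M (φ v) (φ f) := fun ⟨d, e, h⟩ ↦
  ⟨φ d, φ e, by simpa only [H.comm] using h.map φ⟩

theorem runThree_map (H : Marking Γ M) (φ : Γ ≃g Γ) {v f : V} :
    RunThree Γ M v f → RunThree Γ M (φ v) (φ f) := fun ⟨c, d, h1, h2, h⟩ ↦
  ⟨φ c, φ d, H.map φ h1, H.map φ h2, by simpa only [H.comm] using h.map φ⟩

theorem runFive_map (H : Marking Γ M) (φ : Γ ≃g Γ) {v f : V} :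
    RunFive Γ M v f → RunFive Γ M (φ v) (φ f) := fun ⟨c, d, e, h1, h2, h3, h4, h⟩ ↦
  ⟨φ c, φ d, φ e, H.map φ h1, H.map φ h2, H.map φ h3, by simpa only [H.comm] using H.map φ h4,
    by simpa only [H.comm] using h.map φ⟩

theorem runOne_symm (_ : Marking Γ M) {v f : V} : RunOne Γ M v f → RunOne Γ M f v :=
  fun ⟨d, e, h⟩ ↦ ⟨e, d, h.reverse.rotate.rotate⟩

theorem RunOne.nadj (H : Marking Γ M) {v f : V} (h : RunOne Γ M v f) : NAdj Γ M v f := by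
  obtain ⟨_, _, h⟩ := h
  exact H.nadj_of_match h

theorem RunTwo.nadj (H : Marking Γ M) {v f : V} (h : RunTwo Γ M v f) : NAdj Γ M v f := by
  obtain ⟨_, _, -, h⟩ := h
  exact H.nadj_of_match h

theorem RunThree.nadj (H : Marking Γ M) {v f : V} (h : RunThree Γ M v f) : NAdj Γ M v f := by
  obtain ⟨_, _, -, -, h⟩ := h
  exact H.nadj_of_match h

theorem RunFive.nadj (H : Marking Γ M) {v f : V} (h : RunFive Γ M v f) : NAdj Γ M v f := by
  obtain ⟨_, _, _, -, -, -, -, h⟩ := h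
  exact H.nadj_of_match h

theorem RunThree.exists_runOne (H : Marking Γ M) {v f : V} (h : RunThree Γ M v f) :
    ∃ d, NAdj Γ M v f ∧ RunOne Γ M (M v) (M d) ∧ ∃ c, NAdj Γ M f c ∧ NAdj Γ M c d ∧ v ≠ c ∧
      f ≠ d := by
  obtain ⟨c, d, h1, h2, h⟩ := h
  refine ⟨d, H.nadj_of_match h, ⟨c, f, ?_⟩, c, h1, h2, h.bd, h.ce⟩
  rw [H.invol, H.invol]
  exact h.reverse.rotate.rotate.rotate.rotate

theorem runFive_reverse (H : Marking Γ M) {v f : V} (h : RunFive Γ M v f) :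
    ∃ e, RunFive Γ M (M v) e ∧ ∃ c d, NAdj Γ M f c ∧ NAdj Γ M c d ∧ NAdj Γ M d e ∧
      v ≠ c ∧ f ≠ d ∧ c ≠ e := by
  obtain ⟨c, d, e, h1, h2, h3, h4, h⟩ := h
  refine ⟨e, ⟨d, c, f, H.symm h3, H.symm h2, H.symm h1, ?_, ?_⟩, c, d, h1, h2, h3, h.bd, h.ce, h.df⟩
  · rw [H.invol]
    exact H.symm (H.nadj_of_match h)
  · rw [H.invol]
    exact h.reverse.rotate.rotate.rotate.rotate

theorem run_cases [Finite V] (H : Marking Γ M)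
    (hM : ∀ v f, NAdj Γ M v f → cornerCount Γ (M v) v f = 1) {v f : V} (hf : NAdj Γ M v f) :
    RunOne Γ M v f ∨ RunTwo Γ M v f ∨ RunThree Γ M v f ∨ RunFive Γ M v f := by
  obtain ⟨⟨c, d, e, h⟩, -⟩ := exists_of_cornerCount_eq_one (hM v f hf)
  rcases H.nadj_or h.cd with rfl | hc
  · exact .inl ⟨d, e, h⟩
  rcases H.nadj_or h.de with rfl | hd
  · exact .inr (.inl ⟨c, e, hc, h⟩)
  rcases H.nadj_or h.ef with rfl | he
  · exact .inr (.inr (.inl ⟨c, d, hc, hd, h⟩))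
  rcases H.nadj_or h.fa with h1 | hv
  · exact absurd (by rw [← H.invol e, ← h1, H.invol]) h.fb
  · exact .inr (.inr (.inr ⟨c, d, e, hc, hd, he, hv, h⟩))

theorem isHexagon_unique [Finite V] (H : Marking Γ M)
    (hM : ∀ v f, NAdj Γ M v f → cornerCount Γ (M v) v f = 1) {v f d e g d' e' g' : V}
    (h : IsHexagon Γ (M v) v f d e g) (h' : IsHexagon Γ (M v) v f d' e' g') :
    d = d' ∧ e = e' ∧ g = g' :=
  (exists_of_cornerCount_eq_one (hM v f (H.nadj_of_match h))).2 h h'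

/-- A hexagon all of whose edges lie in the 2-factor is determined by any corner. -/
theorem eq_of_nadj (H : Marking Γ M) {a b c d e f d' e' f' : V} (hbc : NAdj Γ M b c)
    (h : IsHexagon Γ a b c d e f) (hcd : NAdj Γ M c d) (hde : NAdj Γ M d e) (hef : NAdj Γ M e f)
    (h' : IsHexagon Γ a b c d' e' f') (hcd' : NAdj Γ M c d') (hde' : NAdj Γ M d' e')
    (hef' : NAdj Γ M e' f') : (d, e, f) = (d', e', f') := by
  obtain rfl := H.next_unique hbc hcd hcd' h.bd h'.bd
  obtain rfl := H.next_unique hcd hde hde' h.ce h'.ce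
  obtain rfl := H.next_unique hde hef hef' h.df h'.df
  rfl

end Marking

namespace Marking

variable {M : V → V}

theorem runFive_next (H : Marking Γ M) {v f c : V} (h : RunFive Γ M v f) (hc : NAdj Γ M f c)
    (hvc : v ≠ c) : ¬ RunFive Γ M f c := by
  rintro ⟨d', e', g', h1', h2', h3', h4', h'⟩
  obtain ⟨c₁, d, e, h1, h2, h3, h4, h⟩ := h
  have hvf := H.nadj_of_match h
  obtain rfl := H.next_unique hvf hc h1 hvc h.bd
  obtain rfl := H.next_unique hc h2 h1' h.ce h'.bd
  obtain rfl := H.next_unique h2 h3 h2' h.df h'.ce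
  obtain rfl := H.next_unique h3 h4 h3' h.ea h'.df
  exact no_square H.girth hvf.1 (H.adj f) h4'.1.symm (H.adj v).symm
    (fun h5 ↦ hvf.2 (by rw [h5, H.invol])) hvf.2

theorem not_runOne_runTwo [Finite V] (H : Marking Γ M)
    (hM : ∀ v f, NAdj Γ M v f → cornerCount Γ (M v) v f = 1) {v f : V}
    (h1 : RunOne Γ M v f) (h2 : RunTwo Γ M v f) : False := by
  obtain ⟨d, e, h1⟩ := h1
  obtain ⟨c, e', hc, h2⟩ := h2
  exact hc.2 (H.isHexagon_unique hM h1 h2).1.symm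

theorem not_runTwo_runFive [Finite V] (H : Marking Γ M)
    (hM : ∀ v f, NAdj Γ M v f → cornerCount Γ (M v) v f = 1) {v f : V}
    (h1 : RunTwo Γ M v f) (h2 : RunFive Γ M v f) : False := by
  obtain ⟨c, e', hc, h1⟩ := h1
  obtain ⟨c', d, e, hc, hd, -, -, h2⟩ := h2
  obtain ⟨rfl, rfl, -⟩ := H.isHexagon_unique hM h1 h2
  exact hd.2 rfl

theorem runTwo_reverse (H : Marking Γ M) {v f c : V} (h : RunTwo Γ M v f) (hc : NAdj Γ M f c)
    (hvc : v ≠ c) : RunTwo Γ M c f := by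
  obtain ⟨c', e, hc', h⟩ := h
  obtain rfl := H.next_unique (H.nadj_of_match h) hc hc' hvc h.bd
  exact ⟨v, e, H.symm (H.nadj_of_match h), h.reverse.rotate⟩

theorem runTwo_of_no_runOne [Finite V] (H : Marking Γ M)
    (hM : ∀ v f, NAdj Γ M v f → cornerCount Γ (M v) v f = 1)
    (h1 : ∀ v f, ¬ RunOne Γ M v f) {v f : V} (hf : NAdj Γ M v f) : RunTwo Γ M v f := by
  have cases : ∀ {v f}, NAdj Γ M v f → RunTwo Γ M v f ∨ RunFive Γ M v f := fun {v f} hf ↦ by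
    rcases H.run_cases hM hf with h | h | h | h
    · exact absurd h (h1 _ _)
    · exact .inl h
    · obtain ⟨d, -, h, -⟩ := h.exists_runOne H
      exact absurd h (h1 _ _)
    · exact .inr h
  refine (cases hf).resolve_right fun h5 ↦ ?_
  have h5' : ∀ u, ∃ g, RunFive Γ M u g := fun u ↦ by
    obtain ⟨φ, rfl⟩ := H.trans v u
    exact ⟨φ f, H.runFive_map φ h5⟩
  -- the run of length five is `v, f, c, d, e, M v`
  obtain ⟨e, hr, c, d, hfc, hcd, hde, hvc, hfd, hce⟩ := H.runFive_reverse h5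
  have hedge : ∀ {u x y}, NAdj Γ M x u → NAdj Γ M u y → x ≠ y → RunTwo Γ M u x →
      RunFive Γ M u y := fun {u x y} hx hy hxy h2 ↦ by
    obtain ⟨g, hg⟩ := h5' u
    by_cases hgx : x = g
    · subst hgx
      exact absurd hg (fun h ↦ H.not_runTwo_runFive hM h2 h)
    · obtain rfl := H.next_unique hx hy (hg.nadj H) hxy hgx
      exact hg
  have hfc2 : RunTwo Γ M f c := (cases hfc).resolve_right (H.runFive_next h5 hfc hvc)
  have hd5 : RunFive Γ M d e := hedge hcd hde hce (H.runTwo_reverse hfc2 hcd hfd)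
  have heM := hr.nadj H
  have hdM : d ≠ M v := by
    rintro rfl
    exact no_square H.girth hf.1 hfc.1 hcd.1 (H.adj v).symm hvc hf.2
  have he2 : RunTwo Γ M e (M v) :=
    (cases (H.symm heM)).resolve_right (H.runFive_next hd5 (H.symm heM) hdM)
  exact H.runFive_next hr (H.symm hde) hdM.symm (hedge heM (H.symm hde) hdM.symm he2)

/-- A vertex-transitive argument: the edges of run length one form a perfect matching. -/
theorem exists_colouring [Finite V] (H : Marking Γ M)
    (hM : ∀ v f, NAdj Γ M v f → cornerCount Γ (M v) v f = 1)
    (hN : ∀ a b c, NAdj Γ M a b → NAdj Γ M b c → a ≠ c → 1 < cornerCount Γ a b c)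
    {v₀ f₀ : V} (h₀ : RunOne Γ M v₀ f₀) : ∃ A B : V → V, (∀ v, RunOne Γ M v (A v)) ∧
      (∀ v, NAdj Γ M v (B v)) ∧ (∀ v, ¬ RunOne Γ M v (B v)) ∧ (∀ v, A (A v) = v) ∧
      (∀ v, B (B v) = v) ∧ ∀ v w, NAdj Γ M v w → w = A v ∨ w = B v := by
  have hall : ∀ v, ∃ f, RunOne Γ M v f := fun v ↦ by
    obtain ⟨φ, rfl⟩ := H.trans v₀ v
    exact ⟨φ f₀, H.runOne_map φ h₀⟩
  choose A hA using hall
  have hnot : ∃ v g, NAdj Γ M v g ∧ ¬ RunOne Γ M v g := by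
    by_contra hcon
    push Not at hcon
    have no : ∀ {u x c d e}, NAdj Γ M x c → ¬ IsHexagon Γ (M u) u x c d e := fun {u x c d e} hc h ↦ by
      obtain ⟨d', e', h'⟩ := hcon u x (H.nadj_of_match h)
      exact hc.2 (H.isHexagon_unique hM h h').1
    have step : ∀ {x u c d e f}, IsHexagon Γ x u c d e f → NAdj Γ M x u → NAdj Γ M u c →
        NAdj Γ M c d := fun {x u c d e f} h hx hu ↦ by
      rcases H.nadj_or h.cd with rfl | h'
      · exact absurd h.reverse.rotate.rotate (no (H.symm hx))
      · exact h'
    obtain ⟨f, -, -, hf, -, -⟩ := H.exists_two v₀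
    obtain ⟨c, hc, hvc⟩ := H.exists_next hf
    obtain ⟨d, e, g, h, -⟩ := exists_ne_of_one_lt_cornerCount (hN _ _ _ hf hc hvc) (f, f, f)
    obtain ⟨d', e', g', h', hne⟩ := exists_ne_of_one_lt_cornerCount (hN _ _ _ hf hc hvc) (d, e, g)
    have k1 := step h hf hc
    have k2 := step h.rotate hc k1
    have k3 := step h.rotate.rotate k1 k2
    have k1' := step h' hf hc
    have k2' := step h'.rotate hc k1'
    have k3' := step h'.rotate.rotate k1' k2'
    exact hne (H.eq_of_nadj hc h' k1' k2' k3' h k1 k2 k3)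
  have hB : ∀ v, ∃ g, NAdj Γ M v g ∧ ¬ RunOne Γ M v g := fun v ↦ by
    obtain ⟨u, g, hg, hg'⟩ := hnot
    obtain ⟨φ, rfl⟩ := H.trans u v
    exact ⟨φ g, H.map φ hg, fun h ↦ hg' (by simpa using H.runOne_map φ.symm h)⟩
  choose B hB hB' using hB
  have htwo : ∀ v w, NAdj Γ M v w → w = A v ∨ w = B v := fun v w hw ↦ by
    by_contra! hcon
    exact hB' v (H.next_unique (H.symm ((hA v).nadj H)) hw (hB v) hcon.1.symm
      (fun h ↦ hB' v (h ▸ hA v)) ▸ absurd (H.next_unique (H.symm hw) ((hA v).nadj H) (hB v)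
        hcon.1 hcon.2) (fun h ↦ hB' v (h ▸ hA v)))
  refine ⟨A, B, hA, hB, hB', fun v ↦ ?_, fun v ↦ ?_, htwo⟩
  · rcases htwo (A v) v (H.symm ((hA v).nadj H)) with h | h
    · exact h.symm
    · exact absurd (h ▸ H.runOne_symm (hA v)) (hB' (A v))
  · rcases htwo (B v) v (H.symm (hB v)) with h | h
    · refine absurd (H.runOne_symm (?_ : RunOne Γ M (B v) v)) (hB' v)
      have := hA (B v)
      rwa [← h] at this
    · exact h.symm

end Marking

namespace Marking

variable {M : V → V}

theorem not_runOne_runThree [Finite V] (H : Marking Γ M)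
    (hM : ∀ v f, NAdj Γ M v f → cornerCount Γ (M v) v f = 1) {v f : V}
    (h1 : RunOne Γ M v f) (h2 : RunThree Γ M v f) : False := by
  obtain ⟨d, e, h1⟩ := h1
  obtain ⟨c, d', hc, -, h2⟩ := h2
  exact hc.2 (H.isHexagon_unique hM h1 h2).1.symm

theorem not_runOne_runFive [Finite V] (H : Marking Γ M)
    (hM : ∀ v f, NAdj Γ M v f → cornerCount Γ (M v) v f = 1) {v f : V}
    (h1 : RunOne Γ M v f) (h2 : RunFive Γ M v f) : False := by
  obtain ⟨d, e, h1⟩ := h1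
  obtain ⟨c, _, _, hc, -, -, -, h2⟩ := h2
  exact hc.2 (H.isHexagon_unique hM h1 h2).1.symm

theorem not_runOne [Finite V] (H : Marking Γ M)
    (hM : ∀ v f, NAdj Γ M v f → cornerCount Γ (M v) v f = 1)
    (hN : ∀ a b c, NAdj Γ M a b → NAdj Γ M b c → a ≠ c → 1 < cornerCount Γ a b c)
    (v₀ f₀ : V) : ¬ RunOne Γ M v₀ f₀ := by
  intro h₀
  obtain ⟨A, B, hA, hB, hAB, hAA, hBB, hu⟩ := H.exists_colouring hM hN h₀
  have hAn : ∀ v, NAdj Γ M v (A v) := fun v ↦ (hA v).nadj H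
  have hne : ∀ v, A v ≠ B v := fun v h ↦ hAB v (h ▸ hA v)
  have hMM := H.invol
  -- the vertex following `v, B v` along the 2-factor
  have nextB : ∀ {v c}, NAdj Γ M (B v) c → v ≠ c → c = A (B v) := fun {v c} h h' ↦
    (hu _ _ h).resolve_right (by rw [hBB]; exact h'.symm)
  have nextA : ∀ {v c}, NAdj Γ M (A v) c → v ≠ c → c = B (A v) := fun {v c} h h' ↦
    (hu _ _ h).resolve_left (by rw [hAA]; exact h'.symm)
  have spread : ∀ {P : V → V → Prop}, (∀ (φ : Γ ≃g Γ) v f, P v f → P (φ v) (φ f)) →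
      (∀ v f, RunOne Γ M v f → ¬ P v f) → P v₀ (B v₀) → ∀ v, P v (B v) := by
    intro P hP hP1 h v
    obtain ⟨φ, rfl⟩ := H.trans v₀ v
    have h1 := hP φ _ _ h
    rcases hu _ _ (H.map φ (hB v₀)) with h2 | h2
    · rw [h2] at h1
      exact absurd h1 (hP1 _ _ (hA _))
    · rwa [h2] at h1
  rcases H.run_cases hM (hB v₀) with h | h | h | h
  · exact hAB _ h
  · obtain ⟨c, hc, hvc⟩ := H.exists_next (hB v₀)
    have h2 := H.runTwo_reverse h hc hvc
    obtain rfl := nextB hc hvc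
    have h1 := hA (A (B v₀))
    rw [hAA] at h1
    exact H.not_runOne_runTwo hM h1 h2
  · have h3 := spread (fun φ v f ↦ H.runThree_map φ)
      (fun v f h1 h3 ↦ H.not_runOne_runThree hM h1 h3) h
    have hex : ∀ v, IsHexagon Γ (M v) v (B v) (A (B v)) (B (A (B v))) (M (B (A (B v)))) :=
        fun v ↦ by
      obtain ⟨c, d, hc, hd, hh⟩ := h3 v
      obtain rfl := nextB hc hh.bd
      obtain rfl := nextA hd hh.ce
      exact hh
    have rel1 : ∀ v, M (B (A (B v))) = A (M v) := fun v ↦ by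
      have h1 := (hex v).reverse.rotate.rotate.rotate.rotate
      have h2 : RunOne Γ M (M v) (M (B (A (B v)))) := ⟨_, _, by
        rw [hMM, hMM]
        exact h1⟩
      rcases hu _ _ (h2.nadj H) with h4 | h4
      · exact h4
      · exact absurd (h4 ▸ h2) (hAB _)
    have rel2 : ∀ v, B (A (B v)) = A (B (A v)) := fun v ↦ by
      have hAv : NAdj Γ M (A v) v := H.symm (hAn v)
      obtain ⟨d, e, g, h5, hne5⟩ := exists_ne_of_one_lt_cornerCount
        (hN (A v) v (B v) hAv (hB v) (hne v)) (M (B v), M (B (A v)), B (A v))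
      have hnd : d ≠ M (B v) := by
        rintro rfl
        have h6 := h5.reverse.rotate.rotate
        have h7 := hex (B v)
        rw [hBB] at h7
        obtain ⟨-, h8, h9⟩ := H.isHexagon_unique hM h6 h7
        exact hne5 (by rw [h8, h9])
      have hd := nextB ((H.nadj_or h5.cd).resolve_left hnd) h5.bd
      have hdn : NAdj Γ M (B v) d := hd ▸ hAn _
      have hBd : B v = A d := by rw [hd, hAA]
      have hnee : e ≠ M d := by
        rintro rfl
        have h6 := h5.reverse.rotate
        obtain ⟨_, _, h7⟩ := hA d
        rw [← hBd] at h7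
        exact (H.symm (hB v)).2 (H.isHexagon_unique hM h6 h7).1
      have he : e = B d := by
        have h6 : B v ≠ e := h5.ce
        have h7 := (hu _ _ ((H.nadj_or h5.de).resolve_left hnee))
        rw [← hBd] at h7
        exact h7.resolve_left h6.symm
      have hde : d = B e := by rw [he, hBB]
      have hng : g ≠ M e := by
        rintro rfl
        have h6 := h5.reverse
        have h7 := hex e
        rw [← hde] at h7
        have h8 := (H.isHexagon_unique hM h6 h7)
        have h9 := h8.2.2
        have h10 := h8.2.1
        rw [← h10] at h9
        exact hAv.2 (by rw [h9, hMM])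
      have hg : g = A e := by
        have h7 := (hu _ _ ((H.nadj_or h5.ef).resolve_left hng))
        rw [← hde] at h7
        exact h7.resolve_right h5.df.symm
      have hgM : g ≠ M (A v) := by
        rintro rfl
        obtain ⟨_, _, h7⟩ := hA (A v)
        rw [hAA] at h7
        exact (hB v).2 (H.isHexagon_unique hM h5.rotate.rotate.rotate.rotate.rotate h7).1
      have hgB : g = B (A v) := nextA ((H.nadj_or h5.fa.symm).resolve_left hgM) h5.fb.symm
      rw [← hgB, hg, hAA, he, hd]
    have rel3 : ∀ v, B v = A (M (A (M (A v)))) := fun v ↦ by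
      rw [← rel1 (A v), hMM, rel2, hAA, hAA]
    have rel4 : ∀ v, M (B (M (B v))) = v := fun v ↦ by
      have h6 := rel1 (M (A v))
      rw [hMM, hAA] at h6
      simp only [rel3, hAA] at h6 ⊢
      exact h6
    refine no_square H.girth (hB v₀).1 (H.adj _) (hB (M (B v₀))).1 ?_ ?_ ?_
    · have := H.adj (B (M (B v₀)))
      rwa [rel4] at this
    · intro h6
      exact (hB v₀).2 (by rw [h6, hMM, ← h6])
    · intro h6
      have := rel4 v₀
      rw [← h6] at this
      exact (hB v₀).2 (by rw [← this, hMM, this])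
  · have h5 := spread (fun φ v f ↦ H.runFive_map φ)
      (fun v f h1 h5 ↦ H.not_runOne_runFive hM h1 h5) h
    have rel : ∀ v, M v = B (A (B (A (B v)))) := fun v ↦ by
      obtain ⟨c, d, e, hc, hd, he, hv, hh⟩ := h5 v
      obtain rfl := nextB hc hh.bd
      obtain rfl := nextA hd hh.ce
      obtain rfl := nextB he hh.df
      exact nextA hv hh.ea
    have hc : ∀ v, M (B (A (M (B (A v))))) = v := fun v ↦ by
      simp only [rel, hAA, hBB]
    refine H.not_runTwo_runFive hM (v := B (A v₀)) (f := A v₀) ?_ ?_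
    · refine ⟨v₀, A (M (B (A v₀))), ?_, ?_⟩
      · exact H.symm (hAn v₀)
      · have hc' : B (A (M (B (A v₀)))) = M v₀ := by rw [← hMM (B _), hc]
        refine ⟨(H.adj _).symm, (hB _).1.symm, (hAn _).1.symm, H.adj _, ?_, (hAn _).1.symm,
          ?_, ?_, ?_, ?_, ?_, ?_⟩
        · rw [← hc']
          exact (hB _).1.symm
        · exact (H.symm (hB (A v₀))).2.symm
        · intro h6
          exact hne v₀ (by rw [← hBB (A v₀), h6])
        · intro h6
          exact (hAn v₀).2 h6
        · intro h6
          have := hc v₀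
          rw [← h6] at this
          exact (hB v₀).2 (by rw [← this, hMM, this])
        · intro h6
          exact hne (A (M (B (A v₀)))) (by rw [hAA, hc', h6])
        · intro h6
          exact (hAn (M (B (A v₀)))).2 (by rw [h6, hMM])
    · have := h5 (B (A v₀))
      rwa [hBB] at this

end Marking

/-- A hexagon of the 2-factor. -/
structure NHexagon (Γ : SimpleGraph V) (M : V → V) (a b c d e f : V) : Prop where
  hex : IsHexagon Γ a b c d e f
  ab : NAdj Γ M a b
  bc : NAdj Γ M b c
  cd : NAdj Γ M c d
  de : NAdj Γ M d e
  ef : NAdj Γ M e f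
  fa : NAdj Γ M f a

theorem NHexagon.rotate {M : V → V} {a b c d e f : V} (h : NHexagon Γ M a b c d e f) :
    NHexagon Γ M b c d e f a :=
  ⟨h.hex.rotate, h.bc, h.cd, h.de, h.ef, h.fa, h.ab⟩

/-- Two vertices joined by a path of length two in the 2-factor. -/
def Rel (Γ : SimpleGraph V) (M : V → V) (v w : V) : Prop := ∃ f, NAdj Γ M v f ∧ NAdj Γ M f w

namespace Marking

variable {M : V → V}

theorem exists_nHexagon [Finite V] (H : Marking Γ M)
    (hM : ∀ v f, NAdj Γ M v f → cornerCount Γ (M v) v f = 1)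
    (hN : ∀ a b c, NAdj Γ M a b → NAdj Γ M b c → a ≠ c → 1 < cornerCount Γ a b c)
    (h2 : ∀ v f, NAdj Γ M v f → RunTwo Γ M v f) (v : V) :
    ∃ b c d e f, NHexagon Γ M v b c d e f := by
  obtain ⟨f, -, -, hf, -, -⟩ := H.exists_two v
  obtain ⟨c, hc, hvc⟩ := H.exists_next hf
  obtain ⟨c', e₀, hc', h₀⟩ := h2 v f hf
  obtain rfl := H.next_unique hf hc hc' hvc h₀.bd
  obtain ⟨d, e, g, h, hne⟩ := exists_ne_of_one_lt_cornerCount (hN _ _ _ hf hc hvc) (M c, e₀, M v)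
  have key : ∀ {u x y z s t}, IsHexagon Γ (M u) u x y z s → NAdj Γ M x y → NAdj Γ M y t →
      t = z → False := fun {u x y z s t} h hxy hyz ht ↦ by
    obtain ⟨y', e', hy', h'⟩ := h2 u x (H.nadj_of_match h)
    obtain ⟨rfl, rfl, -⟩ := H.isHexagon_unique hM h h'
    exact hyz.2 ht
  have hd : NAdj Γ M c d := (H.nadj_or h.cd).resolve_left fun hd ↦ by
    subst hd
    obtain ⟨-, rfl, rfl⟩ := H.isHexagon_unique hM h.reverse.rotate.rotate h₀.reverse.rotate
    exact hne rfl
  have hg : NAdj Γ M v g := (H.nadj_or h.fa.symm).resolve_left fun hg ↦ by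
    subst hg
    obtain ⟨-, rfl, rfl⟩ := H.isHexagon_unique hM h.rotate.rotate.rotate.rotate.rotate h₀
    exact hne rfl
  have hde : NAdj Γ M d e := (H.nadj_or h.de).resolve_left fun he ↦ by
    subst he
    exact key h.reverse.rotate (H.symm hc) (H.symm hf) rfl
  have heg : NAdj Γ M e g := H.symm <| (H.nadj_or h.ef.symm).resolve_left fun he ↦ by
    subst he
    exact key h.rotate.rotate.rotate.rotate hf hc rfl
  exact ⟨f, c, d, e, g, h, hf, hc, hd, hde, heg, H.symm hg⟩

theorem nadj_iff (H : Marking Γ M) {a b c d e f : V} (h : NHexagon Γ M a b c d e f) (w : V) :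
    NAdj Γ M a w ↔ w = b ∨ w = f := by
  constructor
  · intro hw
    by_contra! hcon
    exact hcon.1 (H.next_unique h.fa hw h.ab hcon.2.symm h.hex.fb)
  · rintro (rfl | rfl)
    · exact h.ab
    · exact H.symm h.fa

theorem rel_iff (H : Marking Γ M) {a b c d e f : V} (h : NHexagon Γ M a b c d e f) (w : V) :
    Rel Γ M a w ↔ w = a ∨ w = c ∨ w = e := by
  have hb := H.nadj_iff h.rotate
  have hf := H.nadj_iff h.rotate.rotate.rotate.rotate.rotate
  constructor
  · rintro ⟨x, hx, hw⟩
    rcases (H.nadj_iff h x).1 hx with rfl | rfl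
    · rcases (hb w).1 hw with rfl | rfl <;> simp
    · rcases (hf w).1 hw with rfl | rfl <;> simp
  · rintro (rfl | rfl | rfl)
    · exact ⟨b, h.ab, H.symm h.ab⟩
    · exact ⟨b, h.ab, h.bc⟩
    · exact ⟨f, H.symm h.fa, H.symm h.ef⟩

theorem opposite_unique (H : Marking Γ M) {a b c d e f b' c' d' e' f' : V}
    (h : NHexagon Γ M a b c d e f) (h' : NHexagon Γ M a b' c' d' e' f') : d = d' := by
  rcases (H.nadj_iff h b').1 h'.ab with rfl | rfl
  · obtain rfl := H.next_unique h.ab h.bc h'.bc h.hex.ac h'.hex.ac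
    exact H.next_unique h.bc h.cd h'.cd h.hex.bd h'.hex.bd
  · obtain rfl := H.next_unique h'.ab h'.bc (H.symm h.ef) h'.hex.ac h.hex.ea.symm
    exact H.next_unique h'.bc (H.symm h.de) h'.cd h.hex.df.symm h'.hex.bd

theorem rel_match (H : Marking Γ M) (h2 : ∀ v f, NAdj Γ M v f → RunTwo Γ M v f) {v w : V}
    (h : Rel Γ M v w) : Rel Γ M (M v) (M w) := by
  obtain ⟨f, hf, hw⟩ := h
  by_cases hvw : v = w
  · subst hvw
    obtain ⟨g, -, -, hg, -⟩ := H.exists_two (M v)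
    exact ⟨g, hg, H.symm hg⟩
  obtain ⟨c, e, hc, h⟩ := h2 v f hf
  obtain rfl := H.next_unique hf hw hc hvw h.bd
  exact ⟨e, ⟨h.fa.symm, by rw [H.invol]; exact h.fb⟩,
    H.symm ⟨h.ef, by rw [H.invol]; exact h.df.symm⟩⟩

end Marking

/-- Classes of size three arranged in a ring, consecutive ones being joined alternately by the
perfect matching `M` and by the complement of the perfect matching `α`. -/
structure Belt (Γ : SimpleGraph V) (M α : V → V) (R : V → V → Prop) : Prop where
  equiv : Equivalence R
  class_eq : ∀ v, ∃ x y, x ≠ v ∧ y ≠ v ∧ x ≠ y ∧ ∀ w, R v w ↔ w = v ∨ w = x ∨ w = y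
  M_invol : ∀ v, M (M v) = v
  α_invol : ∀ v, α (α v) = v
  M_rel : ∀ {v w}, R v w → R (M v) (M w)
  α_rel : ∀ {v w}, R v w → R (α v) (α w)
  M_ne : ∀ v, M v ≠ v
  α_ne : ∀ v, α v ≠ v
  adj_iff : ∀ v w, Γ.Adj v w ↔ w = M v ∨ R (α v) w ∧ w ≠ α v
  trans : ∀ u v, ∃ φ : Γ ≃g Γ, φ u = v ∧ (∀ x, φ (M x) = M (φ x)) ∧ (∀ x, φ (α x) = α (φ x)) ∧
    ∀ x y, R x y → R (φ x) (φ y)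
  not_rel_one : ∀ v, ¬ R (M (α v)) v
  not_rel_two : ∀ v, ¬ R (M (α (M (α v)))) v
  not_rel_three : ∀ v, ¬ R (M (α (M (α (M (α v)))))) v

theorem Marking.exists_belt [Finite V] {M : V → V} (H : Marking Γ M)
    (hM : ∀ v f, NAdj Γ M v f → cornerCount Γ (M v) v f = 1)
    (hN : ∀ a b c, NAdj Γ M a b → NAdj Γ M b c → a ≠ c → 1 < cornerCount Γ a b c) :
    ∃ α R, Belt Γ M α R := by
  have h1 := H.not_runOne hM hN
  have h2 : ∀ v f, NAdj Γ M v f → RunTwo Γ M v f := fun v f ↦ H.runTwo_of_no_runOne hM h1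
  choose b c α e f hh using H.exists_nHexagon hM hN h2
  have hα : ∀ {a b c d e f}, NHexagon Γ M a b c d e f → α a = d := fun h ↦
    H.opposite_unique (hh _) h
  have equiv : Equivalence (Rel Γ M) := by
    refine ⟨fun v ↦ (H.rel_iff (hh v) v).2 (.inl rfl), fun ⟨f, h1, h2⟩ ↦ ⟨f, H.symm h2, H.symm h1⟩,
      fun {x y z} hxy hyz ↦ ?_⟩
    rw [H.rel_iff (hh x)] at hxy ⊢
    rcases hxy with rfl | rfl | rfl
    · rwa [H.rel_iff (hh _)] at hyz
    · rw [H.rel_iff (hh x).rotate.rotate] at hyz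
      tauto
    · rw [H.rel_iff (hh x).rotate.rotate.rotate.rotate] at hyz
      tauto
  have M_rel : ∀ {v w}, Rel Γ M v w → Rel Γ M (M v) (M w) := H.rel_match h2
  have α_rel : ∀ {v w}, Rel Γ M v w → Rel Γ M (α v) (α w) := fun {v w} h ↦ by
    have hv := (hh v).rotate.rotate.rotate
    rw [H.rel_iff hv]
    rcases (H.rel_iff (hh v) w).1 h with rfl | rfl | rfl
    · simp
    · rw [hα (hh v).rotate.rotate]
      simp
    · rw [hα (hh v).rotate.rotate.rotate.rotate]
      simp
  have α_invol : ∀ v, α (α v) = v := fun v ↦ hα (hh v).rotate.rotate.rotate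
  have nadj_iff : ∀ v w, NAdj Γ M v w ↔ Rel Γ M (α v) w ∧ w ≠ α v := fun v w ↦ by
    rw [H.nadj_iff (hh v), H.rel_iff (hh v).rotate.rotate.rotate]
    have h3 := (hh v).hex.df
    have h4 := (hh v).hex.bd
    grind
  refine ⟨α, Rel Γ M, equiv, fun v ↦ ⟨c v, e v, (hh v).hex.ac.symm, (hh v).hex.ea, (hh v).hex.ce,
    H.rel_iff (hh v)⟩, H.invol, α_invol, M_rel, α_rel, fun v ↦ (H.adj v).ne',
    fun v ↦ ?_, fun v w ↦ ?_, fun u v ↦ ?_, fun v h ↦ ?_, fun v h ↦ ?_, fun v h ↦ ?_⟩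
  · intro h
    have := (hh v).cd.1
    rw [h] at this
    exact no_triangle H.girth (hh v).ab.1 (hh v).bc.1 this
  · rw [← nadj_iff]
    constructor
    · exact H.nadj_or
    · rintro (rfl | h)
      · exact H.adj v
      · exact h.1
  · obtain ⟨φ, rfl⟩ := H.trans u v
    refine ⟨φ, rfl, H.comm φ, fun x ↦ ?_, ?_⟩
    · have h := hh x
      exact (hα ⟨h.hex.map φ, H.map φ h.ab, H.map φ h.bc, H.map φ h.cd, H.map φ h.de,
        H.map φ h.ef, H.map φ h.fa⟩).symm
    · rintro x y ⟨f, hf, hg⟩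
      exact ⟨φ f, H.map φ hf, H.map φ hg⟩
  · have h3 := M_rel h
    rw [H.invol] at h3
    by_cases h4 : M v = α v
    · have h5 := (hh v).cd.1.symm
      rw [← h4] at h5
      refine no_square H.girth (H.adj v) h5 (hh v).bc.1.symm (hh v).ab.1.symm (hh v).hex.ac ?_
      rw [h4]
      exact (hh v).hex.bd.symm
    · exact ((nadj_iff v (M v)).2 ⟨h3, h4⟩).2 rfl
  · obtain ⟨x, y, hxy, hx, hy, -⟩ := H.exists_two v
    obtain ⟨g, hg, hg'⟩ : ∃ g, NAdj Γ M v g ∧ g ≠ M (α (M v)) := by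
      by_cases hx' : x = M (α (M v))
      · exact ⟨y, hy, by rw [← hx']; exact hxy.symm⟩
      · exact ⟨x, hx, hx'⟩
    have h3 := α_rel (M_rel ((nadj_iff _ _).1 hg).1)
    have h4 := M_rel h
    rw [H.invol] at h4
    have h5 : NAdj Γ M (M g) (M v) := (nadj_iff _ _).2
      ⟨equiv.trans (equiv.symm h3) h4, fun h6 ↦ hg' (by rw [h6, α_invol, H.invol])⟩
    exact no_square H.girth hg.1 (H.adj g) h5.1 (H.adj v).symm
      (fun h6 ↦ hg.2 (by rw [h6, H.invol])) hg.2
  · obtain ⟨x, -, -, hx, -⟩ := H.exists_two v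
    obtain ⟨y, z, hyz, hy, hz, -⟩ := H.exists_two (M x)
    obtain ⟨g, hg, hg'⟩ : ∃ g, NAdj Γ M (M x) g ∧ g ≠ M (α (M v)) := by
      by_cases hy' : y = M (α (M v))
      · exact ⟨z, hz, by rw [← hy']; exact hyz.symm⟩
      · exact ⟨y, hy, hy'⟩
    have h3 := α_rel (M_rel ((nadj_iff _ _).1 hx).1)
    have h3' := α_rel (M_rel (equiv.trans h3 ((nadj_iff _ _).1 hg).1))
    have h4 := M_rel h
    rw [H.invol] at h4
    have h5 : NAdj Γ M (M g) (M v) := (nadj_iff _ _).2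
      ⟨equiv.trans (equiv.symm h3') h4, fun h6 ↦ hg' (by rw [h6, α_invol, H.invol])⟩
    have hMinj : ∀ {s t}, M s = M t → s = t := fun {s t} h ↦ by rw [← H.invol s, h, H.invol]
    refine h1 v x ⟨g, M g, (H.adj v).symm, hx.1, H.adj x, hg.1, H.adj g, h5.1, hx.2.symm,
      fun h6 ↦ hx.2 (by rw [h6, H.invol]), ?_, ?_, ?_, ?_⟩
    · rintro rfl
      exact hg.2 (H.invol _).symm
    · intro h6
      exact hg.2 (by rw [H.invol]; exact (hMinj h6).symm)
    · rintro rfl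
      exact h5.2 (H.invol _).symm
    · intro h6
      exact h5.2 (by rw [H.invol, ← h6, H.invol])

/-- The permutations preserving a relation. -/
def relGroup (R : V → V → Prop) : Subgroup (Equiv.Perm V) where
  carrier := {σ | ∀ v w, R (σ v) (σ w) ↔ R v w}
  mul_mem' := fun {σ τ} hσ hτ v w ↦ (hσ (τ v) (τ w)).trans (hτ v w)
  one_mem' := fun _ _ ↦ Iff.rfl
  inv_mem' := fun {σ} hσ v w ↦ by simpa using (hσ (σ⁻¹ v) (σ⁻¹ w)).symm

namespace Belt

variable {m a : Equiv.Perm V} {R : V → V → Prop}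

theorem m_mul_m (B : Belt Γ m a R) : m * m = 1 := Equiv.ext B.M_invol

theorem a_mul_a (B : Belt Γ m a R) : a * a = 1 := Equiv.ext B.α_invol

theorem m_mem (B : Belt Γ m a R) : m ∈ relGroup R := fun v w ↦
  ⟨fun h ↦ by simpa [B.M_invol] using B.M_rel h, B.M_rel⟩

theorem a_mem (B : Belt Γ m a R) : a ∈ relGroup R := fun v w ↦
  ⟨fun h ↦ by simpa [B.α_invol] using B.α_rel h, B.α_rel⟩

theorem zpow_mem (B : Belt Γ m a R) (i : ℤ) : (m * a) ^ i ∈ relGroup R :=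
  Subgroup.zpow_mem _ (Subgroup.mul_mem _ B.m_mem B.a_mem) i

theorem exists_perm (B : Belt Γ m a R) (u v : V) : ∃ φ : Equiv.Perm V, φ u = v ∧
    (∀ (i : ℤ) x, φ (((m * a) ^ i) x) = ((m * a) ^ i) (φ x)) ∧ ∀ x y, R x y → R (φ x) (φ y) := by
  obtain ⟨φ, h, hm, ha, hR⟩ := B.trans u v
  have : Commute (φ.toEquiv : Equiv.Perm V) (m * a) := by
    refine Commute.mul_right (Equiv.ext hm) (Equiv.ext ha)
  exact ⟨φ.toEquiv, h, fun i x ↦ congrArg (fun σ : Equiv.Perm V ↦ σ x) (this.zpow_right i).eq, hR⟩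

theorem rel_zpow_all (B : Belt Γ m a R) {i : ℤ} {v : V} (h : R (((m * a) ^ i) v) v) (u : V) :
    R (((m * a) ^ i) u) u := by
  obtain ⟨φ, rfl, h1, h2⟩ := B.exists_perm v u
  rw [← h1]
  exact h2 _ _ h

theorem zpow_eq_one (B : Belt Γ m a R) {i : ℤ} {v : V} (h : ((m * a) ^ i) v = v) :
    (m * a) ^ i = 1 := by
  ext u
  obtain ⟨φ, rfl, h1, -⟩ := B.exists_perm v u
  rw [← h1, h]
  rfl

theorem conj_zpow (B : Belt Γ m a R) (i : ℤ) : a * (m * a) ^ i * a = (m * a) ^ (-i) := by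
  have ha : a⁻¹ = a := inv_eq_of_mul_eq_one_left B.a_mul_a
  have hm : m⁻¹ = m := inv_eq_of_mul_eq_one_left B.m_mul_m
  have h := _root_.conj_zpow (i := i) (a := a) (b := m * a)
  rw [zpow_neg, ← inv_zpow, mul_inv_rev, ha, hm]
  rw [ha] at h
  rw [← h, mul_assoc, mul_assoc, B.a_mul_a, mul_one]

theorem zpow_mul_a (B : Belt Γ m a R) (i : ℤ) : (m * a) ^ i * a = a * (m * a) ^ (-i) := by
  rw [← B.conj_zpow, ← mul_assoc, ← mul_assoc, B.a_mul_a, one_mul]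

theorem not_rel_of_involution (B : Belt Γ m a R) {σ : Equiv.Perm V} (h1 : σ * σ = 1)
    (hR : σ ∈ relGroup R) (hσ : ∀ v, σ v ≠ v) (v : V) : ¬ R (σ v) v := by
  intro h
  have hss : ∀ v, σ (σ v) = v := fun v ↦ congrArg (fun τ : Equiv.Perm V ↦ τ v) h1
  obtain ⟨x, y, hx, hy, hxy, hc⟩ := B.class_eq v
  have stab : ∀ w, R v w → R v (σ w) := fun w hw ↦
    B.equiv.trans (B.equiv.symm h) ((hR v w).2 hw)
  have h3 := (hc _).1 (stab v ((hc v).2 (by simp)))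
  have h4 := (hc _).1 (stab x ((hc x).2 (by simp)))
  have h5 := (hc _).1 (stab y ((hc y).2 (by simp)))
  have h6 := hσ v
  have h7 := hσ x
  have h8 := hσ y
  have h9 := hss v
  have h10 := hss x
  have h11 := hss y
  grind

theorem not_rel_reflection (B : Belt Γ m a R) (i : ℤ) (v : V) :
    ¬ R ((a * (m * a) ^ i) v) v := by
  refine B.not_rel_of_involution ?_ (Subgroup.mul_mem _ B.a_mem (B.zpow_mem i)) (fun w hw ↦ ?_) v
  · rw [← mul_assoc, B.conj_zpow, ← zpow_add, neg_add_cancel, zpow_zero]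
  · obtain ⟨j, rfl | rfl⟩ := Int.even_or_odd' i
    · apply B.α_ne (((m * a) ^ j) w)
      have h : (m * a) ^ j * (a * (m * a) ^ (2 * j)) = a * (m * a) ^ j := by
        rw [← mul_assoc, B.zpow_mul_a, mul_assoc, ← zpow_add]
        congr 2
        ring
      have h' := congrArg (fun σ : Equiv.Perm V ↦ σ w) h
      simp only [Equiv.Perm.mul_apply] at h' hw
      rw [hw] at h'
      exact h'.symm
    · apply B.M_ne (a (((m * a) ^ j) w))
      have h : (m * a) ^ j * (a * (m * a) ^ (2 * j + 1)) = a * ((m * a) * (m * a) ^ j) := by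
        rw [← mul_assoc, B.zpow_mul_a, mul_assoc, ← zpow_add, ← zpow_one_add]
        congr 2
        ring
      have h' := congrArg (fun σ : Equiv.Perm V ↦ a (σ w)) h
      simp only [Equiv.Perm.mul_apply] at h' hw
      rw [hw, B.α_invol] at h'
      exact h'.symm

/-- The number of pairs of consecutive classes around the ring. -/
theorem exists_length [Finite V] [Nonempty V] (B : Belt Γ m a R) :
    ∃ n : ℕ, 4 ≤ n ∧ ∀ (i : ℤ) v, R (((m * a) ^ i) v) v ↔ (n : ℤ) ∣ i := by
  let K : AddSubgroup ℤ :=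
    { carrier := {i | ∀ v, R (((m * a) ^ i) v) v}
      zero_mem' := fun v ↦ B.equiv.refl v
      add_mem' := fun {i j} hi hj v ↦ by
        rw [zpow_add]
        exact B.equiv.trans ((B.zpow_mem i _ _).2 (hj v)) (hi v)
      neg_mem' := fun {i} hi v ↦ by
        have := hi (((m * a) ^ (-i)) v)
        rw [← Equiv.Perm.mul_apply, ← zpow_add, add_neg_cancel] at this
        exact B.equiv.symm this }
  have hK : ∀ (i : ℤ) v, R (((m * a) ^ i) v) v ↔ i ∈ K := fun i v ↦
    ⟨fun h ↦ B.rel_zpow_all h, fun h ↦ h v⟩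
  obtain ⟨g, hg⟩ := Int.subgroup_cyclic K
  have hdvd : ∀ (i : ℤ) v, R (((m * a) ^ i) v) v ↔ (g.natAbs : ℤ) ∣ i := fun i v ↦ by
    rw [hK, hg, ← AddSubgroup.zmultiples_eq_closure, Int.mem_zmultiples_iff, Int.natAbs_dvd]
  refine ⟨g.natAbs, ?_, hdvd⟩
  obtain ⟨v⟩ := ‹Nonempty V›
  have h0 : (g.natAbs : ℤ) ∣ orderOf (m * a) := (hdvd _ v).1 <| by
    rw [zpow_natCast, pow_orderOf_eq_one]
    exact B.equiv.refl v
  have hpos : 0 < orderOf (m * a) := orderOf_pos _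
  have h1 : g.natAbs ≠ 0 := by
    intro h
    rw [h] at h0
    have := zero_dvd_iff.1 h0
    omega
  have h2 := fun i ↦ (hdvd i v).2
  by_contra! hlt
  have : g.natAbs = 1 ∨ g.natAbs = 2 ∨ g.natAbs = 3 := by omega
  rcases this with h | h | h
  · exact B.not_rel_one v (h2 1 (by rw [h]; simp))
  · exact B.not_rel_two v (h2 2 (by rw [h]; simp))
  · exact B.not_rel_three v (h2 3 (by rw [h]; simp))

end Belt

/-- A dihedral group acts through any pair consisting of an involution and an element it inverts. -/
theorem exists_dihedral_hom {G : Type*} [Group G] {k : ℕ} {a s : G} (ha : a * a = 1)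
    (hs : a * s * a = s⁻¹) (hk : s ^ k = 1) : ∃ F : DihedralGroup k →* G,
      (∀ i : ℤ, F (.r i) = s ^ i) ∧ ∀ i : ℤ, F (.sr i) = a * s ^ i := by
  obtain ⟨p, hp⟩ : ∃ p : ZMod k → G, ∀ i : ℤ, p i = s ^ i := by
    refine ⟨fun x ↦ s ^ (x.cast : ℤ), fun i ↦ ?_⟩
    rw [zpow_eq_zpow_iff_modEq]
    have h : ((((i : ZMod k).cast : ℤ)) : ZMod k) = i := ZMod.intCast_zmod_cast _
    rw [ZMod.intCast_eq_intCast_iff] at h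
    exact h.of_dvd (Int.natCast_dvd_natCast.2 (orderOf_dvd_of_pow_eq_one hk))
  have ha' : a⁻¹ = a := inv_eq_of_mul_eq_one_left ha
  have hconj : ∀ i : ℤ, a * s ^ i * a = s ^ (-i) := fun i ↦ by
    have h := conj_zpow (i := i) (a := a) (b := s)
    rw [ha'] at h
    rw [← h, hs, inv_zpow, zpow_neg]
  have hcomm : ∀ i : ℤ, s ^ i * a = a * s ^ (-i) := fun i ↦ by
    rw [← hconj, ← mul_assoc, ← mul_assoc, ha, one_mul]
  refine ⟨⟨⟨fun | .r i => p i | .sr i => a * p i, ?_⟩, ?_⟩, hp, fun i ↦ congrArg _ (hp i)⟩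
  · rw [DihedralGroup.one_def]
    have := hp 0
    simpa using this
  · rintro (x | x) (y | y) <;>
    obtain ⟨i, rfl⟩ := ZMod.intCast_surjective x <;>
    obtain ⟨j, rfl⟩ := ZMod.intCast_surjective y
    · simp only [DihedralGroup.r_mul_r]
      rw [← Int.cast_add]
      simp only [hp, zpow_add]
    · simp only [DihedralGroup.r_mul_sr]
      rw [← Int.cast_sub]
      simp only [hp]
      rw [← mul_assoc, hcomm, mul_assoc, ← zpow_add]
      congr 2
      ring
    · simp only [DihedralGroup.sr_mul_r]
      rw [← Int.cast_add]
      simp only [hp, zpow_add, mul_assoc]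
    · simp only [DihedralGroup.sr_mul_sr]
      rw [← Int.cast_sub]
      simp only [hp]
      rw [← mul_assoc, hconj, ← zpow_add]
      congr 1
      ring

theorem nonempty_iso_cayley {G : Type*} [Group G] (hconn : Γ.Connected) {S : Set G}
    (hS : ∀ s ∈ S, s⁻¹ ∈ S) {Φ : G → V} (hinj : Function.Injective Φ)
    (hadj : ∀ g w, Γ.Adj (Φ g) w ↔ ∃ s ∈ S, w = Φ (s * g)) : Nonempty (Γ ≃g cayley S) := by
  have hsurj : Function.Surjective Φ := fun w ↦ by
    obtain ⟨p⟩ := hconn.preconnected (Φ 1) w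
    have key : ∀ {u w} (p : Γ.Walk u w), (∃ g, Φ g = u) → ∃ g, Φ g = w := by
      intro u w p
      induction p with
      | nil => exact id
      | cons h _ ih =>
        rintro ⟨g, rfl⟩
        obtain ⟨s, -, rfl⟩ := (hadj _ _).1 h
        exact ih ⟨_, rfl⟩
    exact key p ⟨1, rfl⟩
  refine ⟨(⟨Equiv.ofBijective Φ ⟨hinj, hsurj⟩, fun {g k} ↦ ?_⟩ : cayley S ≃g Γ).symm⟩
  simp only [cayley, SimpleGraph.fromRel_adj]
  have hsymm : ∀ {x y : G}, x * y⁻¹ ∈ S → y * x⁻¹ ∈ S := fun h ↦ by simpa using hS _ h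
  constructor
  · intro h
    refine ⟨fun h' ↦ h.ne (congrArg Φ h'), .inr ?_⟩
    obtain ⟨s, hs, h'⟩ := (hadj _ _).1 h
    rw [hinj h']
    simpa using hs
  · rintro ⟨-, h⟩
    exact (hadj g (Φ k)).2 ⟨k * g⁻¹, h.elim hsymm id, by simp⟩

theorem dihTau_eq {k : ℕ} (i : ℕ) :
    (dihTau i : DihedralGroup k) = .sr (((-(i : ℤ) : ℤ)) : ZMod k) := by
  rw [dihTau, DihedralGroup.r_one_pow, DihedralGroup.r_mul_sr]
  simp

theorem dihTau_inv {k : ℕ} (i : ℕ) : (dihTau i : DihedralGroup k)⁻¹ = dihTau i := by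
  rw [dihTau_eq, DihedralGroup.inv_sr]

namespace Belt

variable {m a : Equiv.Perm V} {R : V → V → Prop}

theorem mul_inv_one (B : Belt Γ m a R) : a * (m * a) ^ (-1 : ℤ) = m := by
  rw [← B.zpow_mul_a, zpow_one, mul_assoc, B.a_mul_a, mul_one]

theorem exists_enum (B : Belt Γ m a R) (v : V) :
    ∃ e : Fin 3 → V, Function.Injective e ∧ ∀ w, R v w ↔ ∃ t, w = e t := by
  obtain ⟨x, y, hx, hy, hxy, hc⟩ := B.class_eq v
  refine ⟨![v, x, y], fun s t h ↦ ?_, fun w ↦ ?_⟩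
  · fin_cases s <;> fin_cases t <;> first | rfl | simp_all
  · simp [hc, Fin.exists_fin_succ]

theorem nonempty_iso_sigmaGraph [Nonempty V] (B : Belt Γ m a R) (hconn : Γ.Connected) {n : ℕ}
    (hn : ∀ (i : ℤ) v, R (((m * a) ^ i) v) v ↔ (n : ℤ) ∣ i) (hone : (m * a) ^ n = 1) :
    Nonempty (Γ ≃g sigmaGraph n) := by
  obtain ⟨F, hr, hsr⟩ := exists_dihedral_hom B.a_mul_a
    (by simpa using B.conj_zpow 1) hone
  have h0 : F (dihTau 0) = a := by
    rw [dihTau_eq, hsr]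
    simp
  have h1 : F (dihTau 1) = m := by
    rw [dihTau_eq, hsr]
    exact B.mul_inv_one
  have hfree : ∀ g v, R (F g v) v → g = 1 := by
    rintro (x | x) v h <;> obtain ⟨i, rfl⟩ := ZMod.intCast_surjective x
    · rw [hr, hn] at h
      rw [(ZMod.intCast_zmod_eq_zero_iff_dvd i n).2 h, DihedralGroup.r_zero]
    · rw [hsr] at h
      exact absurd h (B.not_rel_reflection i v)
  have hmem : ∀ g, F g ∈ relGroup R := by
    rintro (x | x) <;> obtain ⟨i, rfl⟩ := ZMod.intCast_surjective x
    · rw [hr]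
      exact B.zpow_mem i
    · rw [hsr]
      exact Subgroup.mul_mem _ B.a_mem (B.zpow_mem i)
  obtain ⟨v⟩ := ‹Nonempty V›
  obtain ⟨e, he, hev⟩ : ∃ e : ZMod 3 → V, Function.Injective e ∧ ∀ w, R v w ↔ ∃ t, w = e t :=
    B.exists_enum v
  have hee : ∀ s t, R (e s) (e t) := fun s t ↦
    B.equiv.trans (B.equiv.symm ((hev _).2 ⟨s, rfl⟩)) ((hev _).2 ⟨t, rfl⟩)
  have hinj : ∀ {g h s t}, F g (e s) = F h (e t) → g = h ∧ s = t := fun {g h s t} heq ↦ by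
    have h2 : F (h⁻¹ * g) (e s) = e t := by
      rw [map_mul, Equiv.Perm.mul_apply, heq, ← Equiv.Perm.mul_apply, ← map_mul]
      simp
    have h3 := hfree _ _ (h2 ▸ hee t s)
    obtain rfl := inv_mul_eq_one.1 h3
    exact ⟨rfl, he ((F h).injective heq)⟩
  have htwo : ∀ s t : ZMod 3, s ≠ t ↔ s = 1 + t ∨ s = 2 + t := by decide
  refine nonempty_iso_cayley hconn (Φ := fun g ↦ F g.1 (e g.2.toAdd)) ?_ ?_ ?_
  · rintro s (rfl | rfl | rfl)
    · simp [dihTau_inv]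
    · refine .inr (.inr ?_)
      simp only [Prod.inv_mk, dihTau_inv]
      rfl
    · refine .inr (.inl ?_)
      simp only [Prod.inv_mk, dihTau_inv]
      rfl
  · rintro ⟨g, s⟩ ⟨h, t⟩ heq
    obtain ⟨rfl, h⟩ := hinj heq
    exact Prod.ext rfl (Multiplicative.toAdd.injective h)
  · rintro ⟨g, t⟩ w
    simp only [B.adj_iff, Set.mem_insert_iff, Set.mem_singleton_iff, exists_eq_or_imp,
      exists_eq_left, Prod.mk_mul_mk, map_mul, h0, h1, Equiv.Perm.mul_apply, one_mul, toAdd_mul,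
      toAdd_ofAdd]
    refine or_congr Iff.rfl ?_
    constructor
    · rintro ⟨hR, hne⟩
      rw [← h0, ← Equiv.Perm.mul_apply, ← map_mul] at hR
      have h2 := (hmem (dihTau 0 * g)⁻¹ _ _).2 hR
      rw [← Equiv.Perm.mul_apply, ← map_mul, inv_mul_cancel, map_one, Equiv.Perm.one_apply] at h2
      obtain ⟨s, hs⟩ := (hev _).1 (B.equiv.trans ((hev _).2 ⟨_, rfl⟩) h2)
      have hw : w = a (F g (e s)) := by
        rw [← hs, ← h0, ← Equiv.Perm.mul_apply, ← map_mul, ← Equiv.Perm.mul_apply, ← map_mul]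
        simp
      subst hw
      rcases (htwo s t.toAdd).1 (by rintro rfl; exact hne rfl) with rfl | rfl <;> simp
    · have key : ∀ s, s ≠ t.toAdd → R (a (F g (e t.toAdd))) (a (F g (e s))) ∧
          a (F g (e s)) ≠ a (F g (e t.toAdd)) := fun s hs ↦
        ⟨(B.a_mem _ _).2 ((hmem g _ _).2 (hee _ _)),
          fun h ↦ hs (he ((F g).injective (a.injective h)))⟩
      rintro (rfl | rfl)
      · exact key _ ((htwo _ _).2 (.inl rfl))
      · exact key _ ((htwo _ _).2 (.inr rfl))

end Belt

namespace Belt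

variable {m a : Equiv.Perm V} {R : V → V → Prop}

/-- A fixed-point-free permutation preserving each class rotates it. -/
theorem rel_iff_of_rotation (B : Belt Γ m a R) {σ : Equiv.Perm V} (hR : ∀ v, R (σ v) v)
    (hσ : ∀ v, σ v ≠ v) (v : V) : σ (σ (σ v)) = v ∧ σ (σ v) ≠ v ∧
      ∀ w, R v w ↔ w = v ∨ w = σ v ∨ w = σ (σ v) := by
  obtain ⟨x, y, hx, hy, hxy, hc⟩ := B.class_eq v
  have stab : ∀ w, R v w → R v (σ w) := fun w hw ↦ B.equiv.trans hw (B.equiv.symm (hR w))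
  have h3 := (hc _).1 (stab v ((hc v).2 (by simp)))
  have h4 := (hc _).1 (stab x ((hc x).2 (by simp)))
  have h5 := (hc _).1 (stab y ((hc y).2 (by simp)))
  have h6 := hσ v
  have h7 := hσ x
  have h8 := hσ y
  have h9 : ∀ {s t}, σ s = σ t → s = t := fun h ↦ σ.injective h
  rcases h3 with h3 | h3 | h3
  · exact absurd h3 h6
  · have hxy' : σ x = y := by
      rcases h4 with h4 | h4 | h4
      · rcases h5 with h5 | h5 | h5
        · exact absurd (h9 (h4.trans h5.symm)) hxy
        · exact absurd (h9 (h5.trans h3.symm)) hy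
        · exact absurd h5 h8
      · exact absurd h4 h7
      · exact h4
    have hyv : σ y = v := by
      rcases h5 with h5 | h5 | h5
      · exact h5
      · exact absurd (h9 (h5.trans h3.symm)) hy
      · exact absurd h5 h8
    refine ⟨by rw [h3, hxy', hyv], by rw [h3, hxy']; exact hy, fun w ↦ ?_⟩
    rw [hc, h3, hxy']
  · have hyx' : σ y = x := by
      rcases h5 with h5 | h5 | h5
      · rcases h4 with h4 | h4 | h4
        · exact absurd (h9 (h4.trans h5.symm)) hxy
        · exact absurd h4 h7
        · exact absurd (h9 (h4.trans h3.symm)) hx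
      · exact h5
      · exact absurd h5 h8
    have hxv : σ x = v := by
      rcases h4 with h4 | h4 | h4
      · exact h4
      · exact absurd h4 h7
      · exact absurd (h9 (h4.trans h3.symm)) hx
    refine ⟨by rw [h3, hyx', hxv], by rw [h3, hyx']; exact hx, fun w ↦ ?_⟩
    rw [hc, h3, hyx']
    tauto

theorem nonempty_iso_deltaGraph [Finite V] [Nonempty V] (B : Belt Γ m a R)
    (hconn : Γ.Connected) {n : ℕ} (hn0 : 0 < n)
    (hn : ∀ (i : ℤ) v, R (((m * a) ^ i) v) v ↔ (n : ℤ) ∣ i) (hne : (m * a) ^ n ≠ 1) :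
    Nonempty (Γ ≃g deltaGraph n) := by
  have hcube : ((m * a) ^ n) ^ 3 = 1 := by
    ext v
    refine (B.rel_iff_of_rotation (σ := (m * a) ^ n) (fun v ↦ ?_) (fun v h ↦ hne ?_) v).1
    · simpa using (hn n v).2 dvd_rfl
    · simpa using B.zpow_eq_one (i := n) (v := v) (by simpa using h)
  have horder : orderOf (m * a) = 3 * n := by
    obtain ⟨v⟩ := ‹Nonempty V›
    apply Nat.dvd_antisymm
    · rw [orderOf_dvd_iff_pow_eq_one, mul_comm, pow_mul, hcube]
    · obtain ⟨t, ht⟩ : n ∣ orderOf (m * a) := Int.natCast_dvd_natCast.1 <| (hn _ v).1 <| by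
        rw [zpow_natCast, pow_orderOf_eq_one]
        exact B.equiv.refl v
      have h3 : 3 ∣ t := by
        have := Fact.mk Nat.prime_three
        rw [← orderOf_eq_prime hcube hne, orderOf_dvd_iff_pow_eq_one, ← pow_mul, ← ht,
          pow_orderOf_eq_one]
      rw [ht, mul_comm]
      exact mul_dvd_mul_left n h3
  set k := 3 / Nat.gcd 3 n with hk
  have hcop : Nat.Coprime (k + n) (orderOf (m * a)) := by
    rw [horder]
    by_cases h : 3 ∣ n
    · have h1 : k = 1 := by rw [hk, Nat.gcd_eq_left h]
      rw [h1]
      refine Nat.Coprime.mul_right ?_ (by simp)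
      rw [Nat.coprime_comm, Nat.Prime.coprime_iff_not_dvd Nat.prime_three]
      omega
    · have h0 : Nat.Coprime 3 n := (Nat.Prime.coprime_iff_not_dvd Nat.prime_three).2 h
      have h1 : k = 3 := by rw [hk, Nat.coprime_iff_gcd_eq_one.1 h0]
      rw [h1]
      refine Nat.Coprime.mul_right ?_ (by simpa using h0)
      simpa using h0.symm
  obtain ⟨l, hl⟩ := exists_pow_eq_self_of_coprime hcop
  set s := (m * a) ^ l with hs
  have hsz : ∀ i : ℤ, s ^ i = (m * a) ^ (l * i) := fun i ↦ by
    rw [hs, ← zpow_natCast, ← zpow_mul]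
  have hsk : s ^ ((k + n : ℕ) : ℤ) = m * a := by
    rw [zpow_natCast, hs, ← pow_mul, mul_comm, pow_mul, hl]
  have hsord : orderOf s = 3 * n := by
    rw [← horder]
    apply Nat.dvd_antisymm
    · exact orderOf_pow_dvd l
    · conv_lhs => rw [← hsk, zpow_natCast]
      exact orderOf_pow_dvd _
  have hconj : ∀ i : ℤ, s ^ i * a = a * s ^ (-i) := fun i ↦ by
    rw [hsz, hsz, B.zpow_mul_a, mul_neg]
  have hconj' : ∀ i : ℤ, a * s ^ i * a = s ^ (-i) := fun i ↦ by
    rw [mul_assoc, hconj, ← mul_assoc, B.a_mul_a, one_mul]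
  obtain ⟨F, hr, hsr⟩ := exists_dihedral_hom (k := 3 * n) (a := a * s ^ (-n : ℤ)) (s := s)
    (by rw [← mul_assoc, hconj', ← zpow_add]; simp)
    (by
      rw [mul_assoc a, ← zpow_add_one, ← mul_assoc, hconj', ← zpow_add, ← zpow_neg_one]
      congr 1
      ring)
    (by rw [← hsord, pow_orderOf_eq_one])
  have hsr' : ∀ i : ℤ, F (.sr i) = a * s ^ (-n + i) := fun i ↦ by
    rw [hsr, mul_assoc, ← zpow_add]
  have hone : ∀ {i : ℤ} {v}, (s ^ i) v = v → ((3 * n : ℕ) : ℤ) ∣ i := fun {i v} h ↦ by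
    rw [hsz] at h
    rw [← hsord, orderOf_dvd_iff_zpow_eq_one, hsz, B.zpow_eq_one h]
  have hfree : ∀ g v, F g v = v → g = 1 := by
    rintro (x | x) v h <;> obtain ⟨i, rfl⟩ := ZMod.intCast_surjective x
    · rw [hr] at h
      rw [(ZMod.intCast_zmod_eq_zero_iff_dvd i (3 * n)).2 (hone h), DihedralGroup.r_zero]
    · rw [hsr', hsz] at h
      refine absurd ?_ (B.not_rel_reflection (l * (-n + i)) v)
      rw [h]
      exact B.equiv.refl v
  have hrot := B.rel_iff_of_rotation (σ := s ^ (n : ℤ))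
    (fun v ↦ by
      rw [hsz, hn]
      exact dvd_mul_left _ _)
    (fun v h ↦ by
      have := Int.natCast_dvd_natCast.1 (hone h)
      have := Nat.le_of_dvd hn0 this
      omega)
  have h0 : F (dihTau 0) = s ^ (n : ℤ) * a := by
    rw [dihTau_eq, hsr', hconj]
    simp
  have h1 : F (dihTau k) = m := by
    rw [dihTau_eq, hsr', ← B.mul_inv_one, ← hsk, ← zpow_mul]
    congr 2
    push_cast
    ring
  have h2 : F (dihTau n) = s ^ (n : ℤ) * (s ^ (n : ℤ) * a) := by
    rw [dihTau_eq, hsr', ← mul_assoc, ← zpow_add, hconj]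
    congr 2
    ring
  obtain ⟨v⟩ := ‹Nonempty V›
  refine nonempty_iso_cayley hconn (Φ := fun g ↦ F g v) ?_ (fun g h heq ↦ ?_) fun g w ↦ ?_
  · rintro s (rfl | rfl | rfl) <;> simp [dihTau_inv]
  · refine (inv_mul_eq_one.1 (hfree (h⁻¹ * g) v ?_)).symm
    dsimp only at heq
    rw [map_mul, Equiv.Perm.mul_apply, heq, ← Equiv.Perm.mul_apply, ← map_mul]
    simp
  · simp only [B.adj_iff, Set.mem_insert_iff, Set.mem_singleton_iff, exists_eq_or_imp,
      exists_eq_left, map_mul, h0, h2, Equiv.Perm.mul_apply]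
    obtain ⟨-, h3, h4⟩ := hrot (a (F g v))
    have h5 : (s ^ (n : ℤ)) (a (F g v)) ≠ a (F g v) := fun h ↦ h3 (by rw [h, h])
    rw [h4]
    grind

end Belt

theorem signature_eq_two_three [Finite V] [Nonempty V] (hg : Γ.girth = 6)
    (hvt : ∀ u v : V, ∃ φ : Γ ≃g Γ, φ u = v) {a b : ℕ} (hab : a ≤ b) (hb : b ≤ 3)
    (hsig : hasSignature Γ a b 3) : a = 2 ∧ b = 3 := by
  obtain ⟨v⟩ := ‹Nonempty V›
  obtain ⟨x, y, z, -, -, -, -, -, -, -, h1, h2, h3⟩ := exists_labelling hg hsig v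
  have hcases : (a = 2 * 0 ∧ b = 3) ∨ (a = 1 ∧ b = 2) ∨ (a = 2 ∧ b = 3) := by omega
  rcases hcases with ⟨rfl, rfl⟩ | ⟨rfl, rfl⟩ | h
  · obtain ⟨M, H, hM, hN⟩ := exists_marking hg hvt (by norm_num) hsig
    exact (H.cornerCount_ne_zero hM hN).elim
  · exact (signature_ne_one_two_three hg hvt hsig).elim
  · exact h

end GirthSix

/-- A finite connected simple cubic vertex-transitive graph of girth 6
with signature `(a, b, 3)` has `a = 2`, `b = 3`, and is isomorphic to `Δ_n` or `Σ_n`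
for some `n ≥ 4`. -/
theorem cubic_vt_girth_six_signature_c_eq_three {V : Type*} [Fintype V] (Γ : SimpleGraph V)
    (hconn : Γ.Connected)
    (hcubic : ∀ v : V, (Γ.neighborSet v).ncard = 3)
    (hvt : ∀ u v : V, ∃ φ : Γ ≃g Γ, φ u = v)
    (hgirth : Γ.girth = 6)
    (a b : ℕ) (hab : a ≤ b) (hb : b ≤ 3)
    (hsig : hasSignature Γ a b 3) :
    a = 2 ∧ b = 3 ∧ ∃ n : ℕ, 4 ≤ n ∧
      (Nonempty (Γ ≃g deltaGraph n) ∨ Nonempty (Γ ≃g sigmaGraph n)) := by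
  have := hconn.nonempty
  obtain ⟨rfl, rfl⟩ := GirthSix.signature_eq_two_three hgirth hvt hab hb hsig
  obtain ⟨M, H, hM, hN⟩ := GirthSix.exists_marking (p := 1) hgirth hvt (by norm_num) hsig
  obtain ⟨α, R, B⟩ := H.exists_belt hM hN
  have B' : GirthSix.Belt Γ (Function.Involutive.toPerm M B.M_invol)
      (Function.Involutive.toPerm α B.α_invol) R := B
  obtain ⟨n, hn4, hn⟩ := B'.exists_length
  refine ⟨rfl, rfl, n, hn4, ?_⟩
  by_cases hone : (Function.Involutive.toPerm M B.M_invol *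
      Function.Involutive.toPerm α B.α_invol) ^ n = 1
  · exact .inr (B'.nonempty_iso_sigmaGraph hconn hn hone)
  · exact .inl (B'.nonempty_iso_deltaGraph hconn (by omega) hn hone)
end
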